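/- Let (W,S) and (W̃,S̃) be Coxeter systems. Write W = W_{X_1} × ⋯ × W_{X_a} × W_{Z_2} × W_{Z_3}, where W_{X_1},…,W_{X_a} are the non-spherical and non-affine irreducible components of W, W_{Z_2} is the affine part, and W_{Z_3} is the finite part, and let the affine dimension of W be d = |Z_2| − (number of affine irreducible components); define W̃_{X̃_1},…,W̃_{X̃_c} and the affine dimension of W̃ similarly. Then W and W̃ are commensurable if and only if a = c, the affine dimensions of W and W̃ are equal, and there exists a permutation σ of {1,…,a} such that W_{X_i} and W̃_{X̃_{σ(i)}} are commensurable for all 1 ≤ i ≤ a. -/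

import Mathlib

/-!
Statement 18 (Corollary 6.3): Two Coxeter groups are commensurable iff they have the same
number of non-spherical non-affine irreducible components, the same affine dimension
(d = |Z_2| − number of affine irreducible components), and pairwise commensurable
non-spherical non-affine components, up to a permutation.
-/

noncomputable section

namespace CoxeterPaper

variable {B : Type*} {W : Type*} [Group W]

/-- The entry `⟨α_s, α_t⟩` of the canonical bilinear form: `-cos (π / m_{s,t})` if
`m_{s,t} < ∞`, and `-1` if `m_{s,t} = ∞` (encoded by `M s t = 0`). -/
noncomputable def formEntry (M : CoxeterMatrix B) (s t : B) : ℝ :=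
  if M s t = 0 then -1 else -Real.cos (Real.pi / (M s t : ℝ))

/-- The canonical bilinear form on `V = ⊕_{s ∈ S} ℝ α_s`, identified with `B → ℝ` via the
basis of simple roots. -/
noncomputable def canonicalForm [Fintype B] (M : CoxeterMatrix B) (x y : B → ℝ) : ℝ :=
  ∑ s, ∑ t, x s * y t * formEntry M s t

/-- The Coxeter graph of `M`: vertex set `B`, with `s, t` joined by an edge iff `m_{s,t} ≥ 3`
(where `m_{s,t} = ∞` is encoded by `M s t = 0`). -/
def coxeterGraph (M : CoxeterMatrix B) : SimpleGraph B :=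
  SimpleGraph.fromRel (fun s t => M s t = 0 ∨ 3 ≤ M s t)

/-- The standard parabolic subgroup `W_X`, generated by the simple reflections indexed by `X`. -/
def standardParabolic {M : CoxeterMatrix B} (cs : CoxeterSystem M W) (X : Set B) : Subgroup W :=
  Subgroup.closure (cs.simple '' X)

/-- The canonical form is positive semidefinite on the span of `{α_s : s ∈ X}`. -/
def PosSemidefOn [Fintype B] (M : CoxeterMatrix B) (X : Set B) : Prop :=
  ∀ x : B → ℝ, Function.support x ⊆ X → 0 ≤ canonicalForm M x x

/-- The canonical form is positive definite on the span of `{α_s : s ∈ X}`. -/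
def PosDefOn [Fintype B] (M : CoxeterMatrix B) (X : Set B) : Prop :=
  ∀ x : B → ℝ, Function.support x ⊆ X → x ≠ 0 → 0 < canonicalForm M x x

/-- A connected component of the Coxeter graph is of affine type: the canonical form is
positive semidefinite but not positive definite on the span of its simple roots. -/
def IsAffineComponent [Fintype B] (M : CoxeterMatrix B)
    (c : (coxeterGraph M).ConnectedComponent) : Prop :=
  PosSemidefOn M c.supp ∧ ¬ PosDefOn M c.supp

/-- The affine dimension of a Coxeter group: `|Z₂|` minus the number of affine irreducible
components, where `Z₂` is the union of the vertex sets of the affine components. -/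
noncomputable def affineDim (B : Type*) [Fintype B] (M : CoxeterMatrix B) : ℕ :=
  {s : B | IsAffineComponent M ((coxeterGraph M).connectedComponentMk s)}.ncard
    - Nat.card {c : (coxeterGraph M).ConnectedComponent // IsAffineComponent M c}

/-- Two groups are commensurable if they have isomorphic finite index subgroups. -/
def AreCommensurable (G H : Type*) [Group G] [Group H] : Prop :=
  ∃ (G' : Subgroup G) (H' : Subgroup H),
    G'.FiniteIndex ∧ H'.FiniteIndex ∧ Nonempty (G' ≃* H')

section Commensurable

variable {G H L : Type*} [Group G] [Group H] [Group L]

theorem areCommensurable_iff_exists_hom :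
    AreCommensurable G H ↔ ∃ (Q : Subgroup G) (f : Q →* H),
      Q.FiniteIndex ∧ Function.Injective f ∧ f.range.FiniteIndex := by
  constructor
  · rintro ⟨Q, R, hQ, hR, ⟨e⟩⟩
    refine ⟨Q, R.subtype.comp e.toMonoidHom, hQ, ?_, ?_⟩
    · exact R.subtype_injective.comp e.injective
    · have : (R.subtype.comp e.toMonoidHom).range = R := by
        rw [MonoidHom.range_comp, MonoidHom.range_eq_top.2 e.surjective,
          ← MonoidHom.range_eq_map, Subgroup.range_subtype]
      rwa [this]
  · rintro ⟨Q, f, hQ, hf, hR⟩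
    exact ⟨Q, f.range, hQ, hR, ⟨MonoidHom.ofInjective hf⟩⟩

theorem AreCommensurable.symm (h : AreCommensurable G H) : AreCommensurable H G := by
  obtain ⟨Q, R, hQ, hR, ⟨e⟩⟩ := h
  exact ⟨R, Q, hR, hQ, ⟨e.symm⟩⟩

theorem areCommensurable_of_hom (f : G →* H) (hf : Function.Injective f)
    (hr : f.range.FiniteIndex) : AreCommensurable G H :=
  ⟨⊤, f.range, inferInstance, hr, ⟨Subgroup.topEquiv.trans (MonoidHom.ofInjective hf)⟩⟩

theorem areCommensurable_of_mulEquiv (e : G ≃* H) : AreCommensurable G H :=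
  areCommensurable_of_hom e.toMonoidHom e.injective (by
    rw [MonoidHom.range_eq_top.2 e.surjective]; infer_instance)

theorem areCommensurable_subgroup (K : Subgroup G) [hK : K.FiniteIndex] : AreCommensurable K G :=
  areCommensurable_of_hom K.subtype K.subtype_injective (by rwa [Subgroup.range_subtype])

theorem finiteIndex_map_of_injective (f : G →* H) (hf : Function.Injective f)
    (hr : f.range.FiniteIndex) (K : Subgroup G) [hK : K.FiniteIndex] :
    (K.map f).FiniteIndex := by
  constructor
  rw [Subgroup.index_map_of_injective K hf]
  exact mul_ne_zero hK.index_ne_zero hr.index_ne_zero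

theorem areCommensurable_of_common {P : Type*} [Group P] (f : P →* G) (g : P →* H)
    (hf : Function.Injective f) (hg : Function.Injective g)
    (hfr : f.range.FiniteIndex) (hgr : g.range.FiniteIndex) : AreCommensurable G H :=
  ⟨f.range, g.range, hfr, hgr,
    ⟨(MonoidHom.ofInjective hf).symm.trans (MonoidHom.ofInjective hg)⟩⟩

theorem finiteIndex_comap (f : G →* H) (K : Subgroup H) [hK : K.FiniteIndex] :
    (K.comap f).FiniteIndex := by
  constructor
  rw [Subgroup.index_comap]
  exact fun h => hK.index_ne_zero (Subgroup.index_eq_zero_of_relIndex_eq_zero h)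

theorem AreCommensurable.trans (h : AreCommensurable G H) (h' : AreCommensurable H L) :
    AreCommensurable G L := by
  obtain ⟨Q, f, hQ, hf, hfr⟩ := areCommensurable_iff_exists_hom.1 h
  obtain ⟨R, g, hR, hg, hgr⟩ := areCommensurable_iff_exists_hom.1 h'
  let P := R.comap f
  have hP : P.FiniteIndex := finiteIndex_comap f R
  let k : P →* R := (f.comp P.subtype).codRestrict R (fun x => x.2)
  have hk : Function.Injective k := by
    intro x y hxy
    have : f x = f y := congrArg Subtype.val hxy
    exact Subtype.ext (hf this)
  have hkr : k.range.FiniteIndex := by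
    have : k.range = f.range.comap R.subtype := by
      ext y
      constructor
      · rintro ⟨x, rfl⟩
        exact ⟨x, rfl⟩
      · rintro ⟨x, hx⟩
        refine ⟨⟨x, ?_⟩, Subtype.ext hx⟩
        change f x ∈ R
        rw [hx]; exact y.2
    rw [this]
    exact finiteIndex_comap _ _
  refine areCommensurable_of_common (Q.subtype.comp P.subtype) (g.comp k)
    (Q.subtype_injective.comp P.subtype_injective) (hg.comp hk) ?_ ?_
  · rw [MonoidHom.range_comp, Subgroup.range_subtype]
    exact finiteIndex_map_of_injective _ Q.subtype_injective
      (by rwa [Subgroup.range_subtype]) P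
  · rw [MonoidHom.range_comp]
    exact finiteIndex_map_of_injective _ hg hgr _

theorem areCommensurable_of_finite [Finite G] [Finite H] : AreCommensurable G H := by
  refine ⟨⊥, ⊥, inferInstance, inferInstance, ⟨?_⟩⟩
  exact MulEquiv.ofUnique

theorem areCommensurable_prod {G' H' : Type*} [Group G'] [Group H']
    (h : AreCommensurable G H) (h' : AreCommensurable G' H') :
    AreCommensurable (G × G') (H × H') := by
  obtain ⟨Q, R, hQ, hR, ⟨e⟩⟩ := h
  obtain ⟨Q', R', hQ', hR', ⟨e'⟩⟩ := h'
  refine ⟨Q.prod Q', R.prod R', ⟨?_⟩, ⟨?_⟩, ⟨?_⟩⟩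
  · rw [Subgroup.index_prod]; exact mul_ne_zero hQ.index_ne_zero hQ'.index_ne_zero
  · rw [Subgroup.index_prod]; exact mul_ne_zero hR.index_ne_zero hR'.index_ne_zero
  · exact ((Subgroup.prodEquiv Q Q').trans (e.prodCongr e')).trans (Subgroup.prodEquiv R R').symm

theorem finiteIndex_pi {ι : Type*} [Finite ι] {G : ι → Type*} [∀ i, Group (G i)]
    (Q : ∀ i, Subgroup (G i)) (hQ : ∀ i, (Q i).FiniteIndex) :
    (Subgroup.pi Set.univ Q).FiniteIndex := by
  have : Subgroup.pi Set.univ Q = ⨅ i, (Q i).comap (Pi.evalMonoidHom G i) := by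
    ext x
    simp [Subgroup.mem_pi, Subgroup.mem_iInf]
  rw [this]
  exact Subgroup.finiteIndex_iInf fun i => finiteIndex_comap _ _

theorem areCommensurable_pi {ι : Type*} [Finite ι] {G H : ι → Type*} [∀ i, Group (G i)]
    [∀ i, Group (H i)] (h : ∀ i, AreCommensurable (G i) (H i)) :
    AreCommensurable (∀ i, G i) (∀ i, H i) := by
  choose Q R hQ hR e using h
  refine ⟨Subgroup.pi Set.univ Q, Subgroup.pi Set.univ R, finiteIndex_pi Q hQ,
    finiteIndex_pi R hR, ⟨?_⟩⟩
  · refine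
      { toFun := fun x => ⟨fun i => (e i).some ⟨x.1 i, x.2 i trivial⟩,
          fun i _ => ((e i).some ⟨x.1 i, x.2 i trivial⟩).2⟩
        invFun := fun x => ⟨fun i => (e i).some.symm ⟨x.1 i, x.2 i trivial⟩,
          fun i _ => ((e i).some.symm ⟨x.1 i, x.2 i trivial⟩).2⟩
        left_inv := ?_
        right_inv := ?_
        map_mul' := ?_ }
    · intro x; ext i; simp
    · intro x; ext i; simp
    · intro x y
      ext i
      have : (⟨(x * y).1 i, (x * y).2 i trivial⟩ : Q i)
        = ⟨x.1 i, x.2 i trivial⟩ * ⟨y.1 i, y.2 i trivial⟩ := rfl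
      simp only [this, map_mul]
      rfl

end Commensurable
end CoxeterPaper

namespace CoxeterPaper

/-- Torsion-free nontrivial groups in which two commuting subgroups normalized by a common
finite index subgroup cannot both be nontrivial. -/
structure IsPrimeGroup (N : Type*) [Group N] : Prop where
  eq_one_of_isOfFinOrder : ∀ x : N, IsOfFinOrder x → x = 1
  exists_ne_one : ∃ x : N, x ≠ 1
  eq_bot_or_eq_bot : ∀ (H : Subgroup N), H.FiniteIndex → ∀ A B : Subgroup N,
    (∀ h ∈ H, ∀ x ∈ A, h * x * h⁻¹ ∈ A) → (∀ h ∈ H, ∀ x ∈ B, h * x * h⁻¹ ∈ B) →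
    (∀ x ∈ A, ∀ y ∈ B, x * y = y * x) → A = ⊥ ∨ B = ⊥

theorem IsPrimeGroup.ne_bot {N : Type*} [Group N] (hN : IsPrimeGroup N) (H : Subgroup N)
    (hH : H.FiniteIndex) : H ≠ ⊥ := by
  rintro rfl
  obtain ⟨x, hx⟩ := hN.exists_ne_one
  have : Finite N := (Subgroup.finite_iff_finite_and_finiteIndex ⊥).2
    ⟨(inferInstance : Finite (⊥ : Subgroup N)), hH⟩
  exact hx (hN.eq_one_of_isOfFinOrder x (isOfFinOrder_of_finite x))

section Splitting

variable {P T : Type*} [Group P] [CommGroup T] {ι : Type*} {N : ι → Type*}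
  [∀ i, Group (N i)] (f : P →* (∀ i, N i) × T)

/-- The coordinate of `f` in the factor `N i`. -/
def coordHom (i : ι) : P →* N i :=
  (Pi.evalMonoidHom N i).comp ((MonoidHom.fst _ _).comp f)

/-- The preimage under `f` of the factor `N i`. -/
def factorPreimage (i : ι) : Subgroup P where
  carrier := {x | (∀ k, k ≠ i → (f x).1 k = 1) ∧ (f x).2 = 1}
  mul_mem' := by
    rintro x y ⟨hx, hx'⟩ ⟨hy, hy'⟩
    refine ⟨fun k hk => ?_, ?_⟩
    · simp [hx k hk, hy k hk]
    · simp [hx', hy']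
  one_mem' := by simp
  inv_mem' := by
    rintro x ⟨hx, hx'⟩
    refine ⟨fun k hk => ?_, ?_⟩
    · simp [hx k hk]
    · simp [hx']

/-- The preimage under `f` of the abelian factor. -/
def abelianPreimage : Subgroup P where
  carrier := {x | ∀ k, (f x).1 k = 1}
  mul_mem' := by
    intro x y hx hy k
    simp [hx k, hy k]
  one_mem' := by simp
  inv_mem' := by
    intro x hx k
    simp [hx k]

theorem coordHom_apply (i : ι) (x : P) : coordHom f i x = (f x).1 i := rfl

theorem factorPreimage_conj (i : ι) (g : P) {x : P} (hx : x ∈ factorPreimage f i) :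
    g * x * g⁻¹ ∈ factorPreimage f i := by
  refine ⟨fun k hk => ?_, ?_⟩
  · simp [hx.1 k hk]
  · simp [hx.2]

theorem abelianPreimage_conj (g : P) {x : P} (hx : x ∈ abelianPreimage f) :
    g * x * g⁻¹ ∈ abelianPreimage f := by
  intro k
  simp [hx k]

theorem factorPreimage_comm (hf : Function.Injective f) {i j : ι} (hij : i ≠ j) {x y : P}
    (hx : x ∈ factorPreimage f i) (hy : y ∈ factorPreimage f j) : x * y = y * x := by
  apply hf
  rw [map_mul, map_mul]
  refine Prod.ext (funext fun k => ?_) (mul_comm _ _)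
  by_cases hk : k = i
  · subst hk
    simp [hy.1 k hij]
  · simp [hx.1 k hk]

theorem abelianPreimage_comm (hf : Function.Injective f) {x : P} (y : P)
    (hx : x ∈ abelianPreimage f) : x * y = y * x := by
  apply hf
  rw [map_mul, map_mul]
  refine Prod.ext (funext fun k => ?_) (mul_comm _ _)
  simp [hx k]

theorem comm_of_mem_factorPreimage (hf : Function.Injective f) {i : ι} {x y : P}
    (hx : x ∈ factorPreimage f i) (hy : coordHom f i y = 1) : x * y = y * x := by
  apply hf
  rw [map_mul, map_mul]
  refine Prod.ext (funext fun k => ?_) (mul_comm _ _)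
  by_cases hk : k = i
  · subst hk
    rw [coordHom_apply] at hy
    simp [hy]
  · simp [hx.1 k hk]

theorem finiteIndex_map_factorPreimage (hr : f.range.FiniteIndex) (i : ι) :
    ((factorPreimage f i).map (coordHom f i)).FiniteIndex := by
  classical
  let s : N i →* (∀ i, N i) × T := (MonoidHom.inl _ _).comp (MonoidHom.mulSingle N i)
  have h := finiteIndex_comap s f.range
  refine @Subgroup.finiteIndex_of_le _ _ _ _ h ?_
  rintro n ⟨x, hx⟩
  refine ⟨x, ⟨fun k hk => ?_, ?_⟩, ?_⟩
  · rw [hx]; simp [s, hk]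
  · rw [hx]; simp [s]
  · rw [coordHom_apply, hx]; simp [s]

theorem finiteIndex_range_coordHom (hr : f.range.FiniteIndex) (i : ι) :
    (coordHom f i).range.FiniteIndex := by
  refine @Subgroup.finiteIndex_of_le _ _ _ _ (finiteIndex_map_factorPreimage f hr i) ?_
  rintro _ ⟨x, -, rfl⟩
  exact ⟨x, rfl⟩

theorem finiteIndex_map_abelianPreimage (hr : f.range.FiniteIndex) :
    ((abelianPreimage f).map ((MonoidHom.snd _ _).comp f)).FiniteIndex := by
  have h := finiteIndex_comap (MonoidHom.inr (∀ i, N i) T) f.range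
  refine @Subgroup.finiteIndex_of_le _ _ _ _ h ?_
  rintro n ⟨x, hx⟩
  refine ⟨x, fun k => ?_, ?_⟩
  · rw [hx]; simp
  · simp [hx]

theorem finiteIndex_of_factorPreimage_le [Finite ι] (hf : Function.Injective f)
    (hr : f.range.FiniteIndex) (K : Subgroup P) (h : ∀ i, factorPreimage f i ≤ K)
    (h' : abelianPreimage f ≤ K) : K.FiniteIndex := by
  classical
  have hA : ∀ i, ((factorPreimage f i).map (coordHom f i)).FiniteIndex :=
    finiteIndex_map_factorPreimage f hr
  have hB := finiteIndex_map_abelianPreimage f hr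
  have hp := finiteIndex_pi _ hA
  set A := Subgroup.pi Set.univ fun i => (factorPreimage f i).map (coordHom f i)
  set C := (abelianPreimage f).map ((MonoidHom.snd _ _).comp f)
  have hprod : (A.prod C).FiniteIndex :=
    ⟨by rw [Subgroup.index_prod]; exact mul_ne_zero hp.index_ne_zero hB.index_ne_zero⟩
  have hle : A.prod C ≤ K.map f := by
    rintro ⟨x, y⟩ ⟨hx, hy⟩
    have h1 : A ≤ (K.map f).comap (MonoidHom.inl _ _) := by
      intro x hx
      refine Subgroup.pi_mem_of_mulSingle_mem (H := (K.map f).comap (MonoidHom.inl _ _)) x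
        fun i => ?_
      obtain ⟨z, hz, hzx⟩ := hx i trivial
      refine ⟨z, h i hz, ?_⟩
      refine Prod.ext (funext fun k => ?_) ?_
      · by_cases hk : k = i
        · subst hk
          simpa [coordHom_apply] using hzx
        · simp [hk, hz.1 k hk]
      · simpa using hz.2
    have h2 : ((x, 1) : (∀ i, N i) × T) ∈ K.map f := h1 hx
    have h3 : ((1, y) : (∀ i, N i) × T) ∈ K.map f := by
      obtain ⟨z, hz, hzy⟩ := hy
      refine ⟨z, h' hz, Prod.ext (funext fun k => ?_) ?_⟩
      · simpa using hz k
      · simpa using hzy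
    simpa using mul_mem h2 h3
  have hK := @Subgroup.finiteIndex_of_le _ _ _ _ hprod hle
  have := finiteIndex_comap f (K.map f)
  rwa [Subgroup.comap_map_eq_self_of_injective hf] at this

end Splitting

section PairSplitting

variable {P T T' : Type*} [Group P] [CommGroup T] [CommGroup T'] {ι κ : Type*}
  {N : ι → Type*} [∀ i, Group (N i)] {M : κ → Type*} [∀ j, Group (M j)]
  (f : P →* (∀ i, N i) × T) (g : P →* (∀ j, M j) × T')

theorem normalized_map {Q N : Type*} [Group Q] [Group N] (φ : Q →* N) (A : Subgroup Q)
    (hA : ∀ g, ∀ x ∈ A, g * x * g⁻¹ ∈ A) :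
    ∀ h ∈ φ.range, ∀ x ∈ A.map φ, h * x * h⁻¹ ∈ A.map φ := by
  rintro _ ⟨h, rfl⟩ _ ⟨x, hx, rfl⟩
  exact ⟨h * x * h⁻¹, hA h x hx, by simp⟩

theorem le_ker_or_le_ker {N : Type*} [Group N] (hN : IsPrimeGroup N) (φ : P →* N)
    (hφ : φ.range.FiniteIndex) (A B : Subgroup P) (hA : ∀ g, ∀ x ∈ A, g * x * g⁻¹ ∈ A)
    (hB : ∀ g, ∀ x ∈ B, g * x * g⁻¹ ∈ B) (hAB : ∀ x ∈ A, ∀ y ∈ B, x * y = y * x) :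
    A ≤ φ.ker ∨ B ≤ φ.ker := by
  have := hN.eq_bot_or_eq_bot φ.range hφ (A.map φ) (B.map φ) (normalized_map φ A hA)
    (normalized_map φ B hB) (by
      rintro _ ⟨x, hx, rfl⟩ _ ⟨y, hy, rfl⟩
      rw [← map_mul, hAB x hx y hy, map_mul])
  simpa only [Subgroup.map_eq_bot_iff] using this

variable (hf : Function.Injective f) (hg : Function.Injective g) (hfr : f.range.FiniteIndex)
  (hgr : g.range.FiniteIndex) (hN : ∀ i, IsPrimeGroup (N i)) (hM : ∀ j, IsPrimeGroup (M j))

include hg hfr hN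

theorem eq_of_not_factorPreimage_le_ker {i : ι} {j j' : κ}
    (h : ¬ factorPreimage g j ≤ (coordHom f i).ker)
    (h' : ¬ factorPreimage g j' ≤ (coordHom f i).ker) : j = j' := by
  by_contra hne
  rcases le_ker_or_le_ker (hN i) (coordHom f i) (finiteIndex_range_coordHom f hfr i)
    (factorPreimage g j) (factorPreimage g j') (fun x y hy => factorPreimage_conj g j x hy)
    (fun x y hy => factorPreimage_conj g j' x hy)
    (fun x hx y hy => factorPreimage_comm g hg hne hx hy) with h1 | h1
  · exact h h1
  · exact h' h1

theorem abelianPreimage_le : abelianPreimage g ≤ abelianPreimage f := by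
  intro x hx i
  rcases le_ker_or_le_ker (hN i) (coordHom f i) (finiteIndex_range_coordHom f hfr i)
    (abelianPreimage g) ⊤ (fun x y hy => abelianPreimage_conj g x hy)
    (fun _ _ _ => trivial) (fun x hx y _ => abelianPreimage_comm g hg y hx) with h1 | h1
  · exact h1 hx
  · exact h1 (Subgroup.mem_top x)

include hgr in
theorem exists_not_factorPreimage_le_ker [Finite κ] (i : ι) :
    ∃ j, ¬ factorPreimage g j ≤ (coordHom f i).ker := by
  by_contra! h
  have hK : (coordHom f i).ker.FiniteIndex := by
    refine finiteIndex_of_factorPreimage_le g hg hgr _ h ?_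
    intro x hx
    exact abelianPreimage_le f g hg hfr hN hx i
  have hfin : Finite (coordHom f i).range := by
    have := Subgroup.finite_quotient_of_finiteIndex (H := (coordHom f i).ker)
    exact Finite.of_equiv _ (QuotientGroup.quotientKerEquivRange (coordHom f i)).toEquiv
  refine (hN i).ne_bot _ (finiteIndex_range_coordHom f hfr i) ?_
  rw [eq_bot_iff]
  intro x hx
  have : IsOfFinOrder (⟨x, hx⟩ : (coordHom f i).range) := isOfFinOrder_of_finite _
  exact (hN i).eq_one_of_isOfFinOrder x
    ((coordHom f i).range.subtype.isOfFinOrder this)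

include hf hgr hM in
theorem eq_of_not_le_ker_of_not_le_ker {i : ι} {j j' : κ}
    (h : ¬ factorPreimage g j ≤ (coordHom f i).ker)
    (h' : ¬ factorPreimage f i ≤ (coordHom g j').ker) : j' = j := by
  by_contra hne
  have h1 : factorPreimage g j' ≤ (coordHom f i).ker := by
    by_contra h2
    exact hne (eq_of_not_factorPreimage_le_ker f g hg hfr hN h2 h)
  rcases le_ker_or_le_ker (hM j') (coordHom g j') (finiteIndex_range_coordHom g hgr j')
    (factorPreimage f i) (factorPreimage g j') (fun x y hy => factorPreimage_conj f i x hy)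
    (fun x y hy => factorPreimage_conj g j' x hy)
    (fun x hx y hy => comm_of_mem_factorPreimage f hf hx (h1 hy)) with h2 | h2
  · exact h' h2
  · refine (hM j').ne_bot _ (finiteIndex_map_factorPreimage g hgr j') ?_
    rwa [Subgroup.map_eq_bot_iff]

include hf hgr hM in
theorem areCommensurable_factors [Finite ι] {i : ι} {j : κ}
    (h : ¬ factorPreimage g j ≤ (coordHom f i).ker)
    (h' : ¬ factorPreimage f i ≤ (coordHom g j).ker) : AreCommensurable (N i) (M j) := by
  let φ : factorPreimage f i →* N i := (coordHom f i).comp (factorPreimage f i).subtype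
  let ψ : factorPreimage f i →* M j := (coordHom g j).comp (factorPreimage f i).subtype
  have key : ∀ x ∈ factorPreimage f i, coordHom f i x = 1 → x = 1 := by
    intro x hx h1
    apply hf
    rw [map_one]
    refine Prod.ext (funext fun k => ?_) hx.2
    by_cases hk : k = i
    · subst hk; exact h1
    · exact hx.1 k hk
  refine areCommensurable_of_common φ ψ ?_ ?_ ?_ ?_
  · rw [injective_iff_map_eq_one]
    intro x hx
    exact Subtype.ext (key x x.2 hx)
  · rw [injective_iff_map_eq_one]
    intro x hx
    refine Subtype.ext (key x x.2 ?_)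
    have : (x : P) ∈ abelianPreimage g := by
      intro k
      by_cases hk : k = j
      · subst hk; exact hx
      · by_contra hne
        exact hk (eq_of_not_le_ker_of_not_le_ker f g hf hg hfr hgr hN hM h
          (fun hle => hne (hle x.2)))
    exact abelianPreimage_le f g hg hfr hN this i
  · rw [MonoidHom.range_comp, Subgroup.range_subtype]
    exact finiteIndex_map_factorPreimage f hfr i
  · rw [MonoidHom.range_comp, Subgroup.range_subtype]
    set Q := (factorPreimage f i).map (coordHom g j)
    have hK : (Q.comap (coordHom g j)).FiniteIndex := by
      refine finiteIndex_of_factorPreimage_le f hf hfr _ (fun k => ?_) ?_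
      · by_cases hk : k = i
        · subst hk
          exact Subgroup.le_comap_map _ _
        · have : factorPreimage f k ≤ (coordHom g j).ker := by
            by_contra h2
            exact hk (eq_of_not_factorPreimage_le_ker g f hf hgr hM h2 h')
          intro x hx
          have := this hx
          rw [MonoidHom.mem_ker] at this
          rw [Subgroup.mem_comap, this]
          exact one_mem _
      · intro x hx
        have : coordHom g j x = 1 := abelianPreimage_le g f hf hgr hM hx j
        rw [Subgroup.mem_comap, this]
        exact one_mem _
    have h1 : ((Q.comap (coordHom g j)).map (coordHom g j)).FiniteIndex := by
      constructor
      rw [Subgroup.index_map]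
      refine mul_ne_zero ?_ (finiteIndex_range_coordHom g hgr j).index_ne_zero
      exact (@Subgroup.finiteIndex_of_le _ _ _ _ hK le_sup_left).index_ne_zero
    exact @Subgroup.finiteIndex_of_le _ _ _ _ h1 (Subgroup.map_comap_le _ _)

include hf hgr hM in
theorem areCommensurable_abelian_factors : AreCommensurable T T' := by
  have he : abelianPreimage f = abelianPreimage g :=
    le_antisymm (abelianPreimage_le g f hf hgr hM) (abelianPreimage_le f g hg hfr hN)
  let φ : abelianPreimage f →* T := ((MonoidHom.snd _ _).comp f).comp (abelianPreimage f).subtype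
  let ψ : abelianPreimage f →* T' := ((MonoidHom.snd _ _).comp g).comp (abelianPreimage f).subtype
  refine areCommensurable_of_common φ ψ ?_ ?_ ?_ ?_
  · rw [injective_iff_map_eq_one]
    intro x hx
    refine Subtype.ext (hf ?_)
    rw [OneMemClass.coe_one, map_one]
    exact Prod.ext (funext x.2) hx
  · rw [injective_iff_map_eq_one]
    intro x hx
    refine Subtype.ext (hg ?_)
    rw [OneMemClass.coe_one, map_one]
    have h1 : (x : P) ∈ abelianPreimage g := he ▸ x.2
    exact Prod.ext (funext h1) hx
  · rw [MonoidHom.range_comp, Subgroup.range_subtype]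
    exact finiteIndex_map_abelianPreimage f hfr
  · rw [MonoidHom.range_comp, Subgroup.range_subtype, he]
    exact finiteIndex_map_abelianPreimage g hgr

end PairSplitting

theorem le_of_subgroup_injective {d e : ℕ} (Q : Subgroup (Multiplicative (Fin d → ℤ)))
    (hQ : Q.FiniteIndex) (f : Q →* Multiplicative (Fin e → ℤ)) (hf : Function.Injective f) :
    d ≤ e := by
  let n := Q.index
  have hn : n ≠ 0 := hQ.index_ne_zero
  let p : Multiplicative (Fin d → ℤ) →* Q :=
    (powMonoidHom n).codRestrict Q (fun x => Subgroup.pow_index_mem Q x)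
  have hp : Function.Injective p := by
    intro x y hxy
    have h1 : x ^ n = y ^ n := congrArg Subtype.val hxy
    have h2 : n • x.toAdd = n • y.toAdd := congrArg Multiplicative.toAdd h1
    have h3 : x.toAdd = y.toAdd := by
      funext i
      have := congrFun h2 i
      simp only [Pi.smul_apply, nsmul_eq_mul] at this
      exact mul_left_cancel₀ (by exact_mod_cast hn) this
    exact h3
  let q : (Fin d → ℤ) →+ (Fin e → ℤ) := MonoidHom.toAdditive (f.comp p)
  have hq : Function.Injective q.toIntLinearMap := hf.comp hp
  simpa using LinearMap.finrank_le_finrank_of_injective hq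

theorem eq_of_areCommensurable_int {d e : ℕ}
    (h : AreCommensurable (Multiplicative (Fin d → ℤ)) (Multiplicative (Fin e → ℤ))) :
    d = e := by
  obtain ⟨Q, f, hQ, hf, -⟩ := areCommensurable_iff_exists_hom.1 h
  obtain ⟨Q', f', hQ', hf', -⟩ := areCommensurable_iff_exists_hom.1 h.symm
  exact le_antisymm (le_of_subgroup_injective Q hQ f hf) (le_of_subgroup_injective Q' hQ' f' hf')

theorem areCommensurable_prime_products {a c d e : ℕ} {N : Fin a → Type*} [∀ i, Group (N i)]
    {M : Fin c → Type*} [∀ j, Group (M j)] (hN : ∀ i, IsPrimeGroup (N i))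
    (hM : ∀ j, IsPrimeGroup (M j))
    (h : AreCommensurable ((∀ i, N i) × Multiplicative (Fin d → ℤ))
      ((∀ j, M j) × Multiplicative (Fin e → ℤ))) :
    a = c ∧ d = e ∧ ∃ σ : Fin a ≃ Fin c, ∀ i, AreCommensurable (N i) (M (σ i)) := by
  obtain ⟨Q, R, hQ, hR, ⟨E⟩⟩ := h
  let f := Q.subtype
  let g := R.subtype.comp E.toMonoidHom
  have hf : Function.Injective f := Q.subtype_injective
  have hg : Function.Injective g := R.subtype_injective.comp E.injective
  have hfr : f.range.FiniteIndex := by rwa [Subgroup.range_subtype]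
  have hgr : g.range.FiniteIndex := by
    rw [MonoidHom.range_comp, MonoidHom.range_eq_top.2 E.surjective, ← MonoidHom.range_eq_map,
      Subgroup.range_subtype]
    exact hR
  choose τ hτ using exists_not_factorPreimage_le_ker f g hg hfr hgr hN
  choose τ' hτ' using exists_not_factorPreimage_le_ker g f hf hgr hfr hM
  have h1 : ∀ j, τ (τ' j) = j := fun j =>
    (eq_of_not_le_ker_of_not_le_ker f g hf hg hfr hgr hN hM (hτ (τ' j)) (hτ' j)).symm
  have h2 : ∀ i, τ' (τ i) = i := fun i =>
    (eq_of_not_le_ker_of_not_le_ker g f hg hf hgr hfr hM hN (hτ' (τ i)) (hτ i)).symm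
  let σ : Fin a ≃ Fin c := ⟨τ, τ', h2, h1⟩
  refine ⟨by simpa using Fintype.card_congr σ,
    eq_of_areCommensurable_int (areCommensurable_abelian_factors f g hf hg hfr hgr hN hM),
    σ, fun i => ?_⟩
  refine areCommensurable_factors f g hf hg hfr hgr hN hM (hτ i) ?_
  have := hτ' (τ i)
  rwa [h2] at this

section FormEntry

variable {B : Type*} (M : CoxeterMatrix B)

theorem formEntry_symm (s t : B) : formEntry M s t = formEntry M t s := by
  simp [formEntry, M.symmetric s t]

theorem formEntry_self (s : B) : formEntry M s s = 1 := by
  simp [formEntry]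

theorem two_le_of_ne {s t : B} (h : s ≠ t) (h0 : M s t ≠ 0) : 2 ≤ M s t := by
  have := M.off_diagonal s t h
  omega

theorem formEntry_nonpos {s t : B} (h : s ≠ t) : formEntry M s t ≤ 0 := by
  unfold formEntry
  split_ifs with h0
  · norm_num
  · have h2 : (2 : ℝ) ≤ M s t := by exact_mod_cast two_le_of_ne M h h0
    rw [neg_nonpos]
    apply Real.cos_nonneg_of_neg_pi_div_two_le_of_le
    · have : 0 ≤ Real.pi / (M s t : ℝ) := by positivity
      linarith [Real.pi_pos]
    · exact div_le_div_of_nonneg_left Real.pi_pos.le (by norm_num) h2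

theorem neg_one_le_formEntry (s t : B) : -1 ≤ formEntry M s t := by
  unfold formEntry
  split_ifs with h0
  · exact le_rfl
  · linarith [Real.cos_le_one (Real.pi / (M s t : ℝ))]

theorem formEntry_eq_zero_iff {s t : B} (h : s ≠ t) : formEntry M s t = 0 ↔ M s t = 2 := by
  unfold formEntry
  split_ifs with h0
  · simp [h0]
  · have h2 := two_le_of_ne M h h0
    constructor
    · intro hc
      by_contra hne
      have h3 : (3 : ℝ) ≤ M s t := by
        have : 3 ≤ M s t := by omega
        exact_mod_cast this
      have : 0 < Real.cos (Real.pi / (M s t : ℝ)) := by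
        apply Real.cos_pos_of_mem_Ioo
        constructor
        · have : 0 ≤ Real.pi / (M s t : ℝ) := by positivity
          linarith [Real.pi_pos]
        · apply div_lt_div_of_pos_left Real.pi_pos (by norm_num)
          linarith
      linarith
    · intro hm
      simp [hm]

theorem coxeterGraph_adj_iff {s t : B} :
    (coxeterGraph M).Adj s t ↔ s ≠ t ∧ formEntry M s t ≠ 0 := by
  unfold coxeterGraph
  rw [SimpleGraph.fromRel_adj, M.symmetric t s, or_self]
  refine and_congr_right fun h => ?_
  rw [Ne, formEntry_eq_zero_iff M h]
  by_cases h0 : M s t = 0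
  · simp [h0]
  · have := two_le_of_ne M h h0
    omega

theorem formEntry_eq_zero_of_not_mem {c : (coxeterGraph M).ConnectedComponent} {s t : B}
    (hs : s ∈ c.supp) (ht : t ∉ c.supp) : formEntry M s t = 0 := by
  by_contra h
  have hne : s ≠ t := by rintro rfl; exact ht hs
  exact ht (c.mem_supp_of_adj_mem_supp hs ((coxeterGraph_adj_iff M).2 ⟨hne, h⟩))

theorem component_induction {c : (coxeterGraph M).ConnectedComponent} {s₀ : B}
    (hs₀ : s₀ ∈ c.supp) (Q : B → Prop) (h0 : Q s₀)
    (h : ∀ s t, s ∈ c.supp → t ∈ c.supp → s ≠ t → formEntry M s t ≠ 0 → Q s → Q t) :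
    ∀ t ∈ c.supp, Q t := by
  intro t ht
  have hr : (coxeterGraph M).Reachable s₀ t := by
    rw [SimpleGraph.ConnectedComponent.mem_supp_iff] at hs₀ ht
    exact SimpleGraph.ConnectedComponent.exact (hs₀.trans ht.symm)
  obtain ⟨p⟩ := hr
  induction p with
  | nil => exact h0
  | cons hadj p ih =>
    have h1 := c.mem_supp_of_adj_mem_supp hs₀ hadj
    obtain ⟨hne, hz⟩ := (coxeterGraph_adj_iff M).1 hadj
    exact ih h1 (h _ _ hs₀ h1 hne hz h0) ht

end FormEntry

section GeomRep

variable {V : Type*} [AddCommGroup V] [Module ℝ V] (b : LinearMap.BilinForm ℝ V)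

theorem two_smul_form_apply {x : V} (hx : b x x = 1) : ((2 : ℝ) • b x) x = 2 := by
  simp [hx]

open Polynomial.Chebyshev in
theorem reflection_mul_pow_eq_one (hb : ∀ x y, b x y = b y x) {x y : V} (hx : b x x = 1)
    (hy : b y y = 1) {m : ℕ} (hm : 2 ≤ m) (hxy : b x y = -Real.cos (Real.pi / m)) :
    (Module.reflection (two_smul_form_apply b hx) *
      Module.reflection (two_smul_form_apply b hy)) ^ m = 1 := by
  have hyx : b y x = -Real.cos (Real.pi / m) := by rw [hb, hxy]
  ext z
  set θ : ℝ := 2 * (Real.pi / m) with hθ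
  have ht : 2 * Real.cos θ = ((2 : ℝ) • b x) y * ((2 : ℝ) • b y) x - 2 := by
    simp only [LinearMap.smul_apply, smul_eq_mul, hxy, hyx]
    rw [hθ, Real.cos_two_mul]
    ring
  rw [Module.reflection_mul_reflection_pow_apply _ _ m z (2 * Real.cos θ) ht]
  have hm0 : (m : ℝ) ≠ 0 := by positivity
  rcases eq_or_lt_of_le hm with h2 | h2
  · subst h2
    have h0 : b x y = 0 := by simp [hxy]
    have h0' : b y x = 0 := by simp [hyx]
    have hc : Real.cos θ = -1 := by
      rw [hθ, Nat.cast_ofNat, mul_div_cancel₀ _ (two_ne_zero), Real.cos_pi]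
    norm_num [h0, h0', hc]
    abel
  · have hsin : Real.sin θ ≠ 0 := by
      apply ne_of_gt
      apply Real.sin_pos_of_pos_of_lt_pi
      · positivity
      · rw [hθ, ← mul_div_assoc, div_lt_iff₀ (by positivity)]
        have : (3 : ℝ) ≤ m := by exact_mod_cast h2
        nlinarith [Real.pi_pos]
    have hS : ∀ n : ℤ, (S ℝ n).eval (2 * Real.cos θ) = Real.sin ((n + 1) * θ) / Real.sin θ := by
      intro n
      rw [eq_div_iff hsin, S_two_mul_real_cos]
    obtain ⟨k, hk⟩ := Nat.even_or_odd' m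
    have key :
        (S ℝ (((m : ℤ) - 1) / 2)).eval (2 * Real.cos θ)
          + (S ℝ (((m : ℤ) - 3) / 2)).eval (2 * Real.cos θ) = 0 ∧
        (S ℝ (m / 2)).eval (2 * Real.cos θ)
          + (S ℝ (((m : ℤ) - 2) / 2)).eval (2 * Real.cos θ) = 0 ∨
        (S ℝ (((m : ℤ) - 2) / 2)).eval (2 * Real.cos θ) = 0 ∧
          (S ℝ (((m : ℤ) - 1) / 2)).eval (2 * Real.cos θ) = 0 := by
      rcases hk with hk | hk
      · right
        have e1 : ((m : ℤ) - 2) / 2 = k - 1 := by omega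
        have e2 : ((m : ℤ) - 1) / 2 = k - 1 := by omega
        have : (((k : ℤ) - 1 : ℤ) + 1 : ℝ) * θ = Real.pi := by
          have : (m : ℝ) = 2 * k := by exact_mod_cast hk
          push_cast
          rw [hθ, this]
          have : (k : ℝ) ≠ 0 := by
            rintro h; apply hm0; rw [this, h]; simp
          field_simp
          ring
        rw [e1, e2, hS, this]
        simp
      · left
        have e1 : ((m : ℤ) - 2) / 2 = k - 1 := by omega
        have e2 : ((m : ℤ) - 1) / 2 = k := by omega
        have e3 : ((m : ℤ) - 3) / 2 = k - 1 := by omega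
        have e4 : (m : ℤ) / 2 = k := by omega
        rw [e1, e2, e3, e4, hS, hS]
        have : ((k : ℤ) + 1 : ℝ) * θ = 2 * Real.pi - (((k : ℤ) - 1 : ℤ) + 1 : ℝ) * θ := by
          have : (m : ℝ) = 2 * k + 1 := by exact_mod_cast hk
          push_cast
          rw [hθ, this]
          rw [this] at hm0
          field_simp
          ring
        rw [this, Real.sin_two_pi_sub]
        constructor <;> ring
    rcases key with h | h
    · simp [h.1, h.2]
    · simp [h.1, h.2]

variable {B : Type*} {W : Type*} [Group W] {M : CoxeterMatrix B} (cs : CoxeterSystem M W)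
  (hb : ∀ x y, b x y = b y x) (e : B → V) (he : ∀ s t, b (e s) (e t) = formEntry M s t)

include hb in
theorem isLiftable_reflection : M.IsLiftable fun s => Module.reflection
    (two_smul_form_apply b ((he s s).trans (formEntry_self M s))) := by
  intro s t
  dsimp only
  by_cases h0 : M s t = 0
  · rw [h0, pow_zero]
  by_cases hst : s = t
  · subst hst
    rw [M.diagonal, pow_one]
    ext z
    simp [(Module.involutive_reflection _).eq_iff, LinearEquiv.mul_apply]
  · refine reflection_mul_pow_eq_one b hb ((he s s).trans (formEntry_self M s))
      ((he t t).trans (formEntry_self M t)) (two_le_of_ne M hst h0) ?_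
    rw [he, formEntry, if_neg h0]

/-- The reflection representation attached to a family of vectors whose Gram matrix is the
canonical form. -/
def geomRep : W →* (V ≃ₗ[ℝ] V) :=
  cs.lift ⟨_, isLiftable_reflection b hb e he⟩

theorem geomRep_simple (s : B) (x : V) :
    geomRep b cs hb e he (cs.simple s) x = x - (2 * b (e s) x) • e s := by
  rw [geomRep, CoxeterSystem.lift_apply_simple, Module.reflection_apply]
  simp

theorem geomRep_isometry (w : W) (x y : V) :
    b (geomRep b cs hb e he w x) (geomRep b cs hb e he w y) = b x y := by
  induction w using cs.simple_induction_left generalizing x y with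
  | one => simp
  | mul_simple_left w s ih =>
    rw [map_mul, LinearEquiv.mul_apply, LinearEquiv.mul_apply, geomRep_simple, geomRep_simple,
      ← ih x y]
    set x' := geomRep b cs hb e he w x
    set y' := geomRep b cs hb e he w y
    have h1 : b (e s) (e s) = 1 := (he s s).trans (formEntry_self M s)
    simp only [map_sub, map_smul, LinearMap.sub_apply, LinearMap.smul_apply, smul_eq_mul, h1,
      hb x' (e s)]
    ring

end GeomRep

section Rep

variable {B : Type*} [Fintype B] (M : CoxeterMatrix B)

/-- The canonical form as a bilinear form. -/
def cform : LinearMap.BilinForm ℝ (B → ℝ) :=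
  LinearMap.mk₂ ℝ (canonicalForm M)
    (by
      intro x y z
      simp only [canonicalForm, Pi.add_apply, add_mul, Finset.sum_add_distrib])
    (by
      intro c x y
      simp only [canonicalForm, Pi.smul_apply, smul_eq_mul, Finset.mul_sum, mul_assoc])
    (by
      intro x y z
      simp only [canonicalForm, Pi.add_apply, mul_add, add_mul, Finset.sum_add_distrib])
    (by
      intro c x y
      simp only [canonicalForm, Pi.smul_apply, smul_eq_mul, Finset.mul_sum]
      exact Finset.sum_congr rfl fun _ _ => Finset.sum_congr rfl fun _ _ => by ring)

theorem cform_apply (x y : B → ℝ) : cform M x y = canonicalForm M x y := rfl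

theorem cform_symm (x y : B → ℝ) : cform M x y = cform M y x := by
  simp only [cform_apply, canonicalForm]
  rw [Finset.sum_comm]
  refine Finset.sum_congr rfl fun s _ => Finset.sum_congr rfl fun t _ => ?_
  rw [formEntry_symm M s t]
  ring

omit [Fintype B] in
open Classical in
/-- The simple root `α_s`. -/
def simpleRoot (s : B) : B → ℝ := Pi.single s 1

omit [Fintype B] in
theorem simpleRoot_self (s : B) : simpleRoot s s = 1 := by simp [simpleRoot]

omit [Fintype B] in
theorem simpleRoot_of_ne {s t : B} (h : t ≠ s) : simpleRoot s t = 0 := by simp [simpleRoot, h]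

omit [Fintype B] in
theorem simpleRoot_nonneg (s t : B) : 0 ≤ simpleRoot s t := by
  by_cases h : t = s
  · subst h; rw [simpleRoot_self]; norm_num
  · rw [simpleRoot_of_ne h]

theorem eq_sum_smul_simpleRoot (x : B → ℝ) : x = ∑ s, x s • simpleRoot s := by
  classical
  funext t
  rw [Finset.sum_apply, Finset.sum_eq_single t]
  · simp [simpleRoot_self]
  · intro s _ hs
    simp [simpleRoot_of_ne hs.symm]
  · simp

theorem cform_simpleRoot_left (s : B) (x : B → ℝ) :
    cform M (simpleRoot s) x = ∑ t, x t * formEntry M s t := by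
  rw [cform_apply, canonicalForm, Finset.sum_eq_single s]
  · simp [simpleRoot_self]
  · intro t _ ht
    simp [simpleRoot_of_ne ht]
  · simp

theorem cform_simpleRoot (s t : B) :
    cform M (simpleRoot s) (simpleRoot t) = formEntry M s t := by
  rw [cform_simpleRoot_left, Finset.sum_eq_single t]
  · simp [simpleRoot_self]
  · intro i _ hi
    simp [simpleRoot_of_ne hi]
  · simp

variable {M} {W : Type*} [Group W] (cs : CoxeterSystem M W)

/-- The geometric representation of a Coxeter group. -/
def rep : W →* ((B → ℝ) ≃ₗ[ℝ] (B → ℝ)) :=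
  geomRep (cform M) cs (cform_symm M) simpleRoot (cform_simpleRoot M)

theorem rep_simple (s : B) (x : B → ℝ) :
    rep cs (cs.simple s) x = x - (2 * cform M (simpleRoot s) x) • simpleRoot s :=
  geomRep_simple _ _ _ _ _ _ _

theorem cform_rep (w : W) (x y : B → ℝ) : cform M (rep cs w x) (rep cs w y) = cform M x y :=
  geomRep_isometry _ _ _ _ _ _ _ _

theorem rep_mul (w w' : W) (x : B → ℝ) : rep cs (w * w') x = rep cs w (rep cs w' x) := by
  rw [map_mul]; rfl

theorem rep_one (x : B → ℝ) : rep cs 1 x = x := by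
  rw [map_one]; rfl

theorem rep_inv_rep (w : W) (x : B → ℝ) : rep cs w⁻¹ (rep cs w x) = x := by
  rw [← rep_mul, inv_mul_cancel, rep_one]

theorem rep_rep_inv (w : W) (x : B → ℝ) : rep cs w (rep cs w⁻¹ x) = x := by
  rw [← rep_mul, mul_inv_cancel, rep_one]

theorem rep_simple_self (s : B) : rep cs (cs.simple s) (simpleRoot s) = -simpleRoot s := by
  rw [rep_simple, cform_simpleRoot, formEntry_self]
  module

/-- The sequence `sin (n θ) / sin θ` for `c = cos θ`. -/
def chebSeq (c : ℝ) : ℕ → ℝ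
  | 0 => 0
  | 1 => 1
  | n + 2 => 2 * c * chebSeq c (n + 1) - chebSeq c n

theorem chebSeq_one (n : ℕ) : chebSeq 1 n = n := by
  induction n using Nat.twoStepInduction with
  | zero => simp [chebSeq]
  | one => simp [chebSeq]
  | more n h1 h2 =>
    rw [chebSeq, h1, h2]
    push_cast
    ring

theorem chebSeq_cos (θ : ℝ) (n : ℕ) :
    chebSeq (Real.cos θ) n * Real.sin θ = Real.sin (n * θ) := by
  induction n using Nat.twoStepInduction with
  | zero => simp [chebSeq]
  | one => simp [chebSeq]
  | more n h1 h2 =>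
    rw [chebSeq, sub_mul, mul_assoc, h1, h2]
    have e1 : ((n + 2 : ℕ) : ℝ) * θ = (n + 1 : ℕ) * θ + θ := by push_cast; ring
    have e2 : (n : ℝ) * θ = (n + 1 : ℕ) * θ - θ := by push_cast; ring
    rw [e1, e2, Real.sin_add, Real.sin_sub]
    ring

omit [Fintype B] in
theorem chebSeq_nonneg {s t : B} (hst : s ≠ t) {n : ℕ} (hn : M s t ≠ 0 → n ≤ M s t) :
    0 ≤ chebSeq (-formEntry M s t) n := by
  unfold formEntry
  split_ifs with h0
  · rw [neg_neg, chebSeq_one]; positivity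
  · rw [neg_neg]
    have h2 : (2 : ℝ) ≤ M s t := by exact_mod_cast two_le_of_ne M hst h0
    have hn' : (n : ℝ) ≤ M s t := by exact_mod_cast hn h0
    have hs : 0 < Real.sin (Real.pi / (M s t : ℝ)) := by
      apply Real.sin_pos_of_pos_of_lt_pi
      · have := Real.pi_pos
        positivity
      · rw [div_lt_iff₀ (by linarith)]
        nlinarith [Real.pi_pos]
    have h3 := chebSeq_cos (Real.pi / (M s t : ℝ)) n
    have h4 : 0 ≤ Real.sin (n * (Real.pi / (M s t : ℝ))) := by
      apply Real.sin_nonneg_of_nonneg_of_le_pi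
      · have := Real.pi_pos
        positivity
      · rw [← mul_div_assoc, div_le_iff₀ (by linarith), mul_comm]
        exact mul_le_mul_of_nonneg_left hn' Real.pi_pos.le
    rw [← h3] at h4
    exact nonneg_of_mul_nonneg_left h4 hs

theorem rep_alternatingWord (s t : B) (n : ℕ) :
    rep cs (cs.wordProd (CoxeterSystem.alternatingWord s t n)) (simpleRoot s) =
      if Even n then chebSeq (-formEntry M s t) (n + 1) • simpleRoot s
          + chebSeq (-formEntry M s t) n • simpleRoot t
        else chebSeq (-formEntry M s t) n • simpleRoot s
          + chebSeq (-formEntry M s t) (n + 1) • simpleRoot t := by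
  induction n with
  | zero => simp [CoxeterSystem.alternatingWord, chebSeq]
  | succ n ih =>
    rw [CoxeterSystem.alternatingWord_succ', CoxeterSystem.wordProd_cons, rep_mul, ih]
    have hts := formEntry_symm M t s
    by_cases h : Even n
    · have h' : ¬ Even (n + 1) := by simpa [Nat.even_add_one] using h
      simp only [h, h', if_true, if_false, rep_simple, map_add, map_smul, cform_simpleRoot,
        formEntry_self, hts, chebSeq]
      module
    · have h' : Even (n + 1) := by simpa [Nat.even_add_one] using h
      simp only [h, h', if_true, if_false, rep_simple, map_add, map_smul, cform_simpleRoot,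
        formEntry_self, chebSeq]
      module

theorem rep_simpleRoot_nonneg {w : W} {s : B} (h : ¬ cs.IsRightDescent w s) (i : B) :
    0 ≤ rep cs w (simpleRoot s) i := by
  induction hn : cs.length w using Nat.strong_induction_on generalizing w s with
  | _ n ih =>
  subst hn
  by_cases hw1 : w = 1
  · subst hw1
    rw [rep_one]
    exact simpleRoot_nonneg s i
  obtain ⟨t, ht⟩ := cs.exists_rightDescent_of_ne_one hw1
  have hst : s ≠ t := by rintro rfl; exact h ht
  let Q : ℕ → Prop := fun k => ∃ v, w = v * cs.wordProd (CoxeterSystem.alternatingWord s t k) ∧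
    cs.length w = cs.length v + k
  have hlen : ∀ s t k, cs.length (cs.wordProd (CoxeterSystem.alternatingWord s t k)) ≤ k := by
    intro s t k
    simpa using cs.length_wordProd_le (CoxeterSystem.alternatingWord s t k)
  have hQdown : ∀ k, Q (k + 1) → Q k := by
    rintro k ⟨v, hv, hl⟩
    rw [CoxeterSystem.alternatingWord_succ', CoxeterSystem.wordProd_cons, ← mul_assoc] at hv
    refine ⟨_, hv, ?_⟩
    have h1 := cs.length_mul_le (v * cs.simple (if Even k then t else s))
      (cs.wordProd (CoxeterSystem.alternatingWord s t k))
    have h2 := cs.length_mul_le v (cs.simple (if Even k then t else s))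
    rw [← hv] at h1
    rw [cs.length_simple] at h2
    have := hlen s t k
    omega
  have hQ1 : Q 1 := by
    refine ⟨w * cs.simple t, ?_, ?_⟩
    · simp [CoxeterSystem.alternatingWord]
    · exact (cs.isRightDescent_iff.1 ht).symm
  have hQle : ∀ k, Q k → k ≤ cs.length w := by
    rintro k ⟨v, -, hl⟩
    omega
  obtain ⟨k, hk, hkmax⟩ : ∃ k, Q k ∧ ¬ Q (k + 1) := by
    by_contra! hcon
    have : ∀ k, 1 ≤ k → Q k := fun k hk => Nat.le_induction hQ1 (fun k _ hk => hcon k hk) k hk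
    have := hQle _ (this (cs.length w + 1) (by omega))
    omega
  have hk1 : 1 ≤ k := by
    rcases Nat.eq_zero_or_pos k with rfl | h0
    · exact absurd hQ1 hkmax
    · exact h0
  have hkm : M s t ≠ 0 → k < M s t := by
    intro h0
    by_contra hle
    push Not at hle
    have hQm : Q (M s t) := Nat.decreasingInduction' (fun j _ _ hj => hQdown j hj) hle hk
    obtain ⟨v, hv, hl⟩ := hQm
    apply h
    obtain ⟨m, hm⟩ : ∃ m, M s t = m + 1 := ⟨M s t - 1, by omega⟩
    have hb : cs.wordProd (CoxeterSystem.alternatingWord s t (M s t)) =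
        cs.wordProd (CoxeterSystem.alternatingWord t s (M s t)) := by
      have := cs.wordProd_braidWord_eq s t
      rwa [CoxeterSystem.braidWord, CoxeterSystem.braidWord, M.symmetric t s] at this
    rw [hb, hm, CoxeterSystem.alternatingWord_succ, List.concat_eq_append,
      CoxeterSystem.wordProd_append, cs.wordProd_singleton, ← mul_assoc] at hv
    have h2 : w * cs.simple s = v * cs.wordProd (CoxeterSystem.alternatingWord s t m) := by
      rw [hv, mul_assoc, cs.simple_mul_simple_self, mul_one]
    unfold CoxeterSystem.IsRightDescent
    rw [h2]
    have h3 := cs.length_mul_le v (cs.wordProd (CoxeterSystem.alternatingWord s t m))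
    have := hlen s t m
    omega
  obtain ⟨v, hv, hl⟩ := hk
  have hx : ¬ cs.IsRightDescent v (if Even k then t else s) := by
    intro hd
    refine hkmax ⟨v * cs.simple (if Even k then t else s), ?_, ?_⟩
    · rw [CoxeterSystem.alternatingWord_succ', CoxeterSystem.wordProd_cons, ← mul_assoc,
        mul_assoc v, cs.simple_mul_simple_self, mul_one]
      exact hv
    · have := cs.isRightDescent_iff.1 hd
      omega
  have hy : ¬ cs.IsRightDescent v (if Even k then s else t) := by
    intro hd
    obtain ⟨m, rfl⟩ : ∃ m, k = m + 1 := ⟨k - 1, by omega⟩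
    have hpar : (if Even (m + 1) then s else t) = if Even m then t else s := by
      by_cases hm : Even m <;> simp [Nat.even_add_one, hm]
    rw [hpar] at hd
    rw [CoxeterSystem.alternatingWord_succ', CoxeterSystem.wordProd_cons, ← mul_assoc] at hv
    have h1 := cs.isRightDescent_iff.1 hd
    have h2 := cs.length_mul_le (v * cs.simple (if Even m then t else s))
      (cs.wordProd (CoxeterSystem.alternatingWord s t m))
    rw [← hv] at h2
    have := hlen s t m
    omega
  have hvs : 0 ≤ rep cs v (simpleRoot s) i ∧ 0 ≤ rep cs v (simpleRoot t) i := by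
    by_cases hp : Even k
    · simp only [hp, if_true] at hx hy
      exact ⟨ih _ (by omega) hy rfl, ih _ (by omega) hx rfl⟩
    · simp only [hp, if_false] at hx hy
      exact ⟨ih _ (by omega) hx rfl, ih _ (by omega) hy rfl⟩
  have c1 : 0 ≤ chebSeq (-formEntry M s t) k := chebSeq_nonneg hst fun h0 => (hkm h0).le
  have c2 : 0 ≤ chebSeq (-formEntry M s t) (k + 1) := chebSeq_nonneg hst fun h0 => hkm h0
  rw [hv, rep_mul, rep_alternatingWord]
  split_ifs with hp
  · simp only [map_add, map_smul, Pi.add_apply, Pi.smul_apply, smul_eq_mul]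
    exact add_nonneg (mul_nonneg c2 hvs.1) (mul_nonneg c1 hvs.2)
  · simp only [map_add, map_smul, Pi.add_apply, Pi.smul_apply, smul_eq_mul]
    exact add_nonneg (mul_nonneg c1 hvs.1) (mul_nonneg c2 hvs.2)

end Rep

section Roots

variable {B : Type*} [Fintype B] {M : CoxeterMatrix B} {W : Type*} [Group W]
  (cs : CoxeterSystem M W)

/-- The roots of a Coxeter system. -/
def IsRoot (x : B → ℝ) : Prop := ∃ w s, x = rep cs w (simpleRoot s)

variable {cs}

theorem isRoot_simpleRoot (s : B) : IsRoot cs (simpleRoot s) := ⟨1, s, (rep_one cs _).symm⟩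

theorem IsRoot.map_rep {x : B → ℝ} (hx : IsRoot cs x) (w : W) : IsRoot cs (rep cs w x) := by
  obtain ⟨v, s, rfl⟩ := hx
  exact ⟨w * v, s, (rep_mul cs _ _ _).symm⟩

theorem IsRoot.form_self {x : B → ℝ} (hx : IsRoot cs x) : cform M x x = 1 := by
  obtain ⟨v, s, rfl⟩ := hx
  rw [cform_rep, cform_simpleRoot, formEntry_self]

theorem IsRoot.ne_zero {x : B → ℝ} (hx : IsRoot cs x) : x ≠ 0 := by
  rintro rfl
  simpa using hx.form_self

theorem IsRoot.neg {x : B → ℝ} (hx : IsRoot cs x) : IsRoot cs (-x) := by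
  obtain ⟨v, s, rfl⟩ := hx
  exact ⟨v * cs.simple s, s, by rw [rep_mul, rep_simple_self, map_neg]⟩

theorem IsRoot.nonneg_or_nonpos {x : B → ℝ} (hx : IsRoot cs x) : 0 ≤ x ∨ x ≤ 0 := by
  obtain ⟨v, s, rfl⟩ := hx
  by_cases h : cs.IsRightDescent v s
  · right
    have h1 := (cs.isRightDescent_iff_not_isRightDescent_mul).1 h
    intro i
    have := rep_simpleRoot_nonneg cs h1 i
    rw [rep_mul, rep_simple_self, map_neg, Pi.neg_apply] at this
    simpa using this
  · left
    intro i
    exact rep_simpleRoot_nonneg cs h i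

theorem IsRoot.not_nonneg_and_nonpos {x : B → ℝ} (hx : IsRoot cs x) (h : 0 ≤ x) (h' : x ≤ 0) :
    False :=
  hx.ne_zero (le_antisymm h' h)

theorem IsRoot.nonneg_of_pos_coord {x : B → ℝ} (hx : IsRoot cs x) {i : B} (h : 0 < x i) :
    0 ≤ x := by
  rcases hx.nonneg_or_nonpos with h1 | h1
  · exact h1
  · exact absurd (h1 i) (not_le.2 h)

theorem IsRoot.nonpos_of_neg_coord {x : B → ℝ} (hx : IsRoot cs x) {i : B} (h : x i < 0) :
    x ≤ 0 := by
  rcases hx.nonneg_or_nonpos with h1 | h1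
  · exact absurd (h1 i) (not_le.2 h)
  · exact h1

theorem eq_one_of_rep_nonneg {w : W} (h : ∀ s, 0 ≤ rep cs w (simpleRoot s)) : w = 1 := by
  by_contra hw
  obtain ⟨s, hs⟩ := cs.exists_rightDescent_of_ne_one hw
  have h1 := (cs.isRightDescent_iff_not_isRightDescent_mul).1 hs
  refine ((isRoot_simpleRoot s).map_rep w).not_nonneg_and_nonpos (h s) fun i => ?_
  have := rep_simpleRoot_nonneg cs h1 i
  rw [rep_mul, rep_simple_self, map_neg, Pi.neg_apply] at this
  simpa using this

theorem eq_one_of_rep_eq {w : W} (h : ∀ s, rep cs w (simpleRoot s) = simpleRoot s) : w = 1 :=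
  eq_one_of_rep_nonneg fun s => by rw [h]; exact simpleRoot_nonneg s

theorem rep_ext {w w' : W} (h : ∀ x, rep cs w x = rep cs w' x) : w = w' := by
  have : w'⁻¹ * w = 1 := eq_one_of_rep_eq (cs := cs) fun s => by rw [rep_mul, h, rep_inv_rep]
  rw [inv_mul_eq_one] at this
  exact this.symm

theorem rep_conj_simple (w : W) (s : B) (x : B → ℝ) :
    rep cs (w * cs.simple s * w⁻¹) x =
      x - (2 * cform M (rep cs w (simpleRoot s)) x) • rep cs w (simpleRoot s) := by
  rw [rep_mul, rep_mul, rep_simple, map_sub, rep_rep_inv, map_smul]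
  conv_lhs => rw [← cform_rep cs w, rep_rep_inv]

theorem conj_eq_of_rep_eq {w w' : W} {s t : B}
    (h : rep cs w (simpleRoot s) = rep cs w' (simpleRoot t) ∨
      rep cs w (simpleRoot s) = -rep cs w' (simpleRoot t)) :
    w * cs.simple s * w⁻¹ = w' * cs.simple t * w'⁻¹ := by
  refine rep_ext (cs := cs) fun x => ?_
  rw [rep_conj_simple, rep_conj_simple]
  rcases h with h | h
  · rw [h]
  · rw [h, map_neg, LinearMap.neg_apply]
    module

theorem conj_eq_simple {w : W} {s : B} (h : rep cs w (simpleRoot s) = simpleRoot s ∨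
      rep cs w (simpleRoot s) = -simpleRoot s) : w * cs.simple s * w⁻¹ = cs.simple s := by
  have := conj_eq_of_rep_eq (cs := cs) (w := w) (w' := 1) (s := s) (t := s)
    (by simpa only [rep_one] using h)
  simpa using this

theorem eq_or_eq_neg_of_smul {x y : B → ℝ} (hx : IsRoot cs x) (hy : IsRoot cs y) {c : ℝ}
    (h : x = c • y) : x = y ∨ x = -y := by
  have h1 := hx.form_self
  rw [h] at h1
  simp only [map_smul, LinearMap.smul_apply, smul_eq_mul, hy.form_self] at h1
  have h2 : c = 1 ∨ c = -1 := by
    have : c ^ 2 = 1 := by simpa [sq] using h1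
    rcases mul_eq_zero.1 (show (c - 1) * (c + 1) = 0 by linear_combination this) with h2 | h2
    · left; linarith
    · right; linarith
  rcases h2 with rfl | rfl
  · left; rw [h, one_smul]
  · right; rw [h, neg_smul, one_smul]

theorem IsRoot.eq_simpleRoot_of_inversion {x : B → ℝ} (hx : IsRoot cs x) (h : 0 ≤ x) {s : B}
    (h' : rep cs (cs.simple s) x ≤ 0) : x = simpleRoot s := by
  have h0 : ∀ i, i ≠ s → x i = 0 := by
    intro i hi
    have := h' i
    rw [rep_simple] at this
    simp only [Pi.sub_apply, Pi.smul_apply, simpleRoot_of_ne hi, smul_zero, sub_zero] at this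
    exact le_antisymm this (h i)
  have h1 : x = x s • simpleRoot s := by
    funext i
    by_cases hi : i = s
    · subst hi; simp [simpleRoot_self]
    · simp [simpleRoot_of_ne hi, h0 i hi]
  rcases eq_or_eq_neg_of_smul hx (isRoot_simpleRoot s) h1 with h2 | h2
  · exact h2
  · exfalso
    refine hx.not_nonneg_and_nonpos h ?_
    rw [h2]
    intro i
    simpa using simpleRoot_nonneg s i

theorem finite_inversions (w : W) : {x | IsRoot cs x ∧ 0 ≤ x ∧ rep cs w x ≤ 0}.Finite := by
  induction w using cs.simple_induction_left with
  | one =>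
    convert Set.finite_empty
    rw [Set.eq_empty_iff_forall_notMem]
    rintro x ⟨hx, h1, h2⟩
    rw [rep_one] at h2
    exact hx.not_nonneg_and_nonpos h1 h2
  | mul_simple_left w s ih =>
    refine (ih.union (Set.finite_singleton (rep cs w⁻¹ (simpleRoot s)))).subset ?_
    rintro x ⟨hx, h1, h2⟩
    rcases (hx.map_rep w).nonneg_or_nonpos with h3 | h3
    · right
      rw [rep_mul] at h2
      rw [Set.mem_singleton_iff, ← (hx.map_rep w).eq_simpleRoot_of_inversion h3 h2, rep_inv_rep]
    · exact Or.inl ⟨hx, h1, h3⟩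

theorem finite_of_bounded (C : ℝ) :
    {w : W | ∀ s i, |rep cs w (simpleRoot s) i| ≤ C ∧ |rep cs w⁻¹ (simpleRoot s) i| ≤ C}.Finite := by
  classical
  set N : ℝ := Fintype.card B * |C| + 1 with hN
  have hNpos : 0 < N := by positivity
  let φ : W → B → B → ℤ := fun w s i => ⌊rep cs w (simpleRoot s) i * N⌋
  obtain ⟨K, hK⟩ := exists_nat_ge (|C| * N + 1)
  refine Set.Finite.of_finite_image (f := φ) ?_ ?_
  · refine (Set.finite_Icc (fun _ _ => -(K : ℤ)) (fun _ _ => (K : ℤ))).subset ?_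
    rintro _ ⟨w, hw, rfl⟩
    have h1 : ∀ s i, |rep cs w (simpleRoot s) i * N| ≤ |C| * N := by
      intro s i
      rw [abs_mul, abs_of_pos hNpos]
      exact mul_le_mul_of_nonneg_right ((hw s i).1.trans (le_abs_self C)) hNpos.le
    constructor
    · intro s i
      have := (abs_le.1 (h1 s i)).1
      apply Int.le_floor.2
      push_cast
      linarith
    · intro s i
      have h2 := (abs_le.1 (h1 s i)).2
      have h3 := Int.floor_le (rep cs w (simpleRoot s) i * N)
      have : ((φ w s i : ℤ) : ℝ) ≤ (K : ℤ) := by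
        push_cast
        linarith
      exact_mod_cast this
  · intro w hw w' hw' heq
    have hclose : ∀ s i, |rep cs w' (simpleRoot s) i - rep cs w (simpleRoot s) i| * N < 1 := by
      intro s i
      have h1 : φ w' s i = φ w s i := by rw [heq]
      have := Int.abs_sub_lt_one_of_floor_eq_floor h1
      rwa [← sub_mul, abs_mul, abs_of_pos hNpos] at this
    have h1 : w⁻¹ * w' = 1 := by
      refine eq_one_of_rep_nonneg (cs := cs) fun s => ?_
      refine ((isRoot_simpleRoot s).map_rep _).nonneg_of_pos_coord (i := s) ?_
      set δ : B → ℝ := rep cs w' (simpleRoot s) - rep cs w (simpleRoot s) with hδ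
      have e1 : rep cs (w⁻¹ * w') (simpleRoot s) = simpleRoot s + rep cs w⁻¹ δ := by
        rw [hδ, map_sub, rep_inv_rep, rep_mul]
        abel
      have e2 : rep cs w⁻¹ δ s = ∑ i, δ i * rep cs w⁻¹ (simpleRoot i) s := by
        conv_lhs => rw [eq_sum_smul_simpleRoot δ, map_sum, Finset.sum_apply]
        simp
      have e3 : |rep cs w⁻¹ δ s| * N < 1 * N := by
        rw [e2]
        calc |∑ i, δ i * rep cs w⁻¹ (simpleRoot i) s| * N
            ≤ (∑ i, |δ i * rep cs w⁻¹ (simpleRoot i) s|) * N :=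
              mul_le_mul_of_nonneg_right (Finset.abs_sum_le_sum_abs _ _) hNpos.le
          _ = ∑ i, (|δ i| * N) * |rep cs w⁻¹ (simpleRoot i) s| := by
              rw [Finset.sum_mul]
              exact Finset.sum_congr rfl fun i _ => by rw [abs_mul]; ring
          _ ≤ ∑ _i : B, 1 * |C| := by
              refine Finset.sum_le_sum fun i _ => ?_
              exact mul_le_mul (hclose s i).le ((hw i s).2.trans (le_abs_self C)) (abs_nonneg _)
                zero_le_one
          _ < 1 * N := by
              rw [hN]; simp
      have e4 : |rep cs w⁻¹ δ s| < 1 := lt_of_mul_lt_mul_right e3 hNpos.le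
      rw [e1, Pi.add_apply, simpleRoot_self]
      linarith [(abs_lt.1 e4).1]
    rw [inv_mul_eq_one] at h1
    exact h1

theorem isOfFinOrder_of_bounded {g : W}
    (h : ∀ s, ∃ C, ∀ n : ℤ, ∀ i, |rep cs (g ^ n) (simpleRoot s) i| ≤ C) : IsOfFinOrder g := by
  choose C hC using h
  have hfin := finite_of_bounded (cs := cs) (∑ s, |C s|)
  have hle : ∀ s, C s ≤ ∑ s, |C s| := fun s =>
    (le_abs_self _).trans (Finset.single_le_sum (f := fun s => |C s|)
      (fun _ _ => abs_nonneg _) (Finset.mem_univ s))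
  have hsub : Set.range (fun n : ℤ => g ^ n) ⊆ {w : W | ∀ s i,
      |rep cs w (simpleRoot s) i| ≤ ∑ s, |C s| ∧ |rep cs w⁻¹ (simpleRoot s) i| ≤ ∑ s, |C s|} := by
    rintro _ ⟨n, rfl⟩
    intro s i
    refine ⟨(hC s n i).trans (hle s), ?_⟩
    change |rep cs (g ^ n)⁻¹ (simpleRoot s) i| ≤ _
    rw [← zpow_neg]
    exact (hC s (-n) i).trans (hle s)
  have := hfin.subset hsub
  rw [isOfFinOrder_iff_pow_eq_one]
  by_contra hcon
  have hinj : Function.Injective (fun n : ℤ => g ^ n) := by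
    rw [← isOfFinOrder_iff_pow_eq_one] at hcon
    exact injective_zpow_iff_not_isOfFinOrder.2 hcon
  exact Set.infinite_range_of_injective hinj this

theorem isOfFinOrder_of_form_lt_one {w w' : W} {s t : B}
    (h : |cform M (rep cs w (simpleRoot s)) (rep cs w' (simpleRoot t))| < 1) :
    IsOfFinOrder (w * cs.simple s * w⁻¹ * (w' * cs.simple t * w'⁻¹)) := by
  set α := rep cs w (simpleRoot s) with hα
  set β := rep cs w' (simpleRoot t) with hβ
  have hαα : cform M α α = 1 := ((isRoot_simpleRoot s).map_rep w).form_self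
  have hββ : cform M β β = 1 := ((isRoot_simpleRoot t).map_rep w').form_self
  set c := cform M α β with hc
  have hβα : cform M β α = c := cform_symm _ _ _
  set g := w * cs.simple s * w⁻¹ * (w' * cs.simple t * w'⁻¹) with hg
  have hρα : ∀ x, rep cs (w * cs.simple s * w⁻¹) x = x - (2 * cform M α x) • α :=
    rep_conj_simple w s
  have hρβ : ∀ x, rep cs (w' * cs.simple t * w'⁻¹) x = x - (2 * cform M β x) • β :=
    rep_conj_simple w' t
  have hginv : g⁻¹ = w' * cs.simple t * w'⁻¹ * (w * cs.simple s * w⁻¹) := by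
    simp [hg, mul_assoc]
  have hgact : ∀ n : ℤ, ∀ x, ∃ y z : ℝ, rep cs (g ^ n) x = x + (y • α + z • β) := by
    have key : ∀ n : ℕ, ∀ x, (∃ y z : ℝ, rep cs (g ^ n) x = x + (y • α + z • β)) ∧
        (∃ y z : ℝ, rep cs (g⁻¹ ^ n) x = x + (y • α + z • β)) := by
      intro n
      induction n with
      | zero =>
        intro x
        exact ⟨⟨0, 0, by simp⟩, ⟨0, 0, by simp⟩⟩
      | succ n ih =>
        intro x
        obtain ⟨⟨y, z, h1⟩, ⟨y', z', h2⟩⟩ := ih x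
        constructor
        · rw [pow_succ', rep_mul, h1, hg, rep_mul, hρβ, hρα]
          refine ⟨y - 2 * cform M α (x + (y • α + z • β) - (2 * cform M β (x + (y • α + z • β))) • β),
            z - 2 * cform M β (x + (y • α + z • β)), ?_⟩
          module
        · rw [pow_succ', rep_mul, h2, hginv, rep_mul, hρα, hρβ]
          refine ⟨y' - 2 * cform M α (x + (y' • α + z' • β)), z' -
            2 * cform M β (x + (y' • α + z' • β) - (2 * cform M α (x + (y' • α + z' • β))) • α), ?_⟩
          module
    intro n x
    obtain ⟨m, rfl | rfl⟩ := n.eq_nat_or_neg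
    · simpa using (key m x).1
    · simpa using (key m x).2
  have hgfix : ∀ n : ℤ, ∀ x, cform M α x = 0 → cform M β x = 0 → rep cs (g ^ n) x = x := by
    intro n x h1 h2
    have hgx : rep cs g x = x := by
      rw [hg, rep_mul, hρβ, h2, mul_zero, zero_smul, sub_zero, hρα, h1, mul_zero, zero_smul, sub_zero]
    have hmem : g ∈ (MulAction.stabilizer ((B → ℝ) ≃ₗ[ℝ] (B → ℝ)) x).comap (rep cs) := hgx
    exact Subgroup.zpow_mem _ hmem n
  refine isOfFinOrder_of_bounded (cs := cs) fun u => ?_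
  have hc1 : c ^ 2 < 1 := by
    rw [← sq_abs]; exact (sq_lt_one_iff₀ (abs_nonneg _)).2 h
  have hd : 1 - c ^ 2 ≠ 0 := by linarith
  set e := simpleRoot (B := B) u
  set p₁ := (cform M α e - c * cform M β e) / (1 - c ^ 2) with hp₁
  set p₂ := (cform M β e - c * cform M α e) / (1 - c ^ 2) with hp₂
  set q := e - (p₁ • α + p₂ • β) with hq
  have hq1 : cform M α q = 0 := by
    simp only [hq, map_sub, map_add, map_smul, smul_eq_mul, hαα, ← hc]
    rw [hp₁, hp₂]; field_simp; ring
  have hq2 : cform M β q = 0 := by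
    simp only [hq, map_sub, map_add, map_smul, smul_eq_mul, hββ, hβα]
    rw [hp₁, hp₂]; field_simp; ring
  set p := p₁ • α + p₂ • β with hp
  set D := cform M p p / (1 - |c|) with hD
  refine ⟨(∑ i, |q i|) + (D + 1) * ∑ i, (|α i| + |β i|), fun n i => ?_⟩
  obtain ⟨y, z, hyz⟩ := hgact n p
  have e1 : rep cs (g ^ n) e = q + ((p₁ + y) • α + (p₂ + z) • β) := by
    have : e = q + p := by rw [hq]; abel
    rw [this, map_add, hgfix n q hq1 hq2, hyz, hp]
    module
  have e2 : rep cs (g ^ n) p = (p₁ + y) • α + (p₂ + z) • β := by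
    rw [hyz, hp]; module
  have e3 : cform M p p = (p₁ + y) ^ 2 + (p₂ + z) ^ 2 + 2 * c * ((p₁ + y) * (p₂ + z)) := by
    rw [← cform_rep cs (g ^ n), e2]
    simp only [map_add, map_smul, LinearMap.add_apply, LinearMap.smul_apply, smul_eq_mul, hαα,
      hββ, hβα, ← hc]
    ring
  set Y := p₁ + y
  set Z := p₂ + z
  have hpos : 0 < 1 - |c| := by linarith
  have e4 : Y ^ 2 + Z ^ 2 ≤ D := by
    rw [hD, le_div_iff₀ hpos, e3]
    have h1 : -(|c| * (Y ^ 2 + Z ^ 2)) ≤ 2 * c * (Y * Z) := by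
      have : |2 * c * (Y * Z)| ≤ |c| * (Y ^ 2 + Z ^ 2) := by
        rw [show 2 * c * (Y * Z) = c * (2 * (Y * Z)) by ring, abs_mul]
        refine mul_le_mul_of_nonneg_left ?_ (abs_nonneg c)
        rw [abs_le]
        constructor <;> nlinarith [sq_nonneg (Y + Z), sq_nonneg (Y - Z)]
      exact (abs_le.1 this).1
    linarith
  have hY : |Y| ≤ D + 1 := by
    rw [abs_le]; constructor <;> nlinarith [sq_nonneg (Y - 1), sq_nonneg (Y + 1), sq_nonneg Z]
  have hZ : |Z| ≤ D + 1 := by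
    rw [abs_le]; constructor <;> nlinarith [sq_nonneg (Z - 1), sq_nonneg (Z + 1), sq_nonneg Y]
  rw [e1]
  simp only [Pi.add_apply, Pi.smul_apply, smul_eq_mul]
  have h1 : |q i| ≤ ∑ i, |q i| :=
    Finset.single_le_sum (f := fun i => |q i|) (fun _ _ => abs_nonneg _) (Finset.mem_univ i)
  have h2 : |α i| + |β i| ≤ ∑ i, (|α i| + |β i|) :=
    Finset.single_le_sum (f := fun i => |α i| + |β i|) (fun _ _ => by positivity)
      (Finset.mem_univ i)
  have h0 : 0 ≤ D + 1 := (abs_nonneg _).trans hY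
  calc |q i + (Y * α i + Z * β i)| ≤ |q i| + (|Y * α i| + |Z * β i|) :=
        (abs_add_le _ _).trans (add_le_add le_rfl (abs_add_le _ _))
    _ ≤ |q i| + (D + 1) * (|α i| + |β i|) := by
        rw [abs_mul, abs_mul, mul_add]
        gcongr
    _ ≤ _ := by gcongr

end Roots

section Minkowski

theorem exists_one_add_pow {A : Type*} [Ring A] (y : A) (n : ℕ) :
    ∃ r, (1 + y) ^ n = 1 + n • y + y ^ 2 * r := by
  induction n with
  | zero => exact ⟨0, by simp⟩
  | succ n ih =>
    obtain ⟨r, hr⟩ := ih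
    refine ⟨n • 1 + r * (1 + y), ?_⟩
    rw [pow_succ, hr, succ_nsmul]
    simp only [mul_add, add_mul, one_mul, mul_one, smul_mul_assoc, mul_smul_comm, mul_assoc, sq]
    abel

/-- Minkowski's lemma: an element of prime order congruent to `1` modulo `3` is trivial. -/
theorem eq_one_of_pow_prime_eq_one {A : Type*} [Ring A] [Module.Free ℤ A] {p : ℕ} (hp : p.Prime)
    {x : A} (h : (1 + 3 * x) ^ p = 1) : x = 0 := by
  have hcancel : ∀ (n : ℕ) (y : A), (3 : ℤ) ^ n • y = 0 → y = 0 := fun n y hy =>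
    (smul_eq_zero.1 hy).resolve_left (by positivity)
  have hdiv : ∀ n : ℕ, ∃ y : A, x = (3 : ℤ) ^ n • y := by
    intro n
    induction n with
    | zero => exact ⟨x, by simp⟩
    | succ n ih =>
      obtain ⟨y, rfl⟩ := ih
      suffices ∃ z : A, y = (3 : ℤ) • z by
        obtain ⟨z, rfl⟩ := this
        exact ⟨z, by rw [pow_succ, mul_smul]⟩
      have h3 : (3 : A) * ((3 : ℤ) ^ n • y) = (3 : ℤ) ^ (n + 1) • y := by
        rw [pow_succ', mul_smul, zsmul_eq_mul ((3 : ℤ) ^ n • y)]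
        norm_num
      rw [h3] at h
      by_cases hp3 : p = 3
      · subst hp3
        have h4 : (3 : ℤ) ^ (n + 2) • (y + (3 : ℤ) • ((3 : ℤ) ^ n • y ^ 2 +
            (3 : ℤ) ^ (2 * n) • y ^ 3)) = 0 := by
          have e : (1 + (3 : ℤ) ^ (n + 1) • y) ^ 3 = 1 + ((3 : ℤ) * 3 ^ (n + 1)) • y +
              (3 * 3 ^ (n + 1) * 3 ^ (n + 1) : ℤ) • y ^ 2 +
              (3 ^ (n + 1) * 3 ^ (n + 1) * 3 ^ (n + 1) : ℤ) • y ^ 3 := by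
            simp only [pow_succ (_ : A), pow_zero, one_mul, add_mul, mul_add, mul_one,
              smul_mul_assoc, mul_smul_comm, smul_add]
            module
          rw [e] at h
          have h5 := sub_eq_zero.2 h
          rw [← h5]
          simp only [smul_add, smul_smul]
          module
        have h5 := hcancel _ _ h4
        exact ⟨-((3 : ℤ) ^ n • y ^ 2 + (3 : ℤ) ^ (2 * n) • y ^ 3), by
          rw [smul_neg]; exact eq_neg_of_add_eq_zero_left h5⟩
      · obtain ⟨r, hr⟩ := exists_one_add_pow ((3 : ℤ) ^ (n + 1) • y) p
        rw [hr] at h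
        have h4 : (3 : ℤ) ^ (n + 1) • ((p : ℤ) • y + (3 : ℤ) ^ (n + 1) • (y ^ 2 * r)) = 0 := by
          have h5 := sub_eq_zero.2 h
          rw [← h5, sq, sq]
          simp only [smul_mul_assoc, mul_smul_comm, smul_add, smul_smul]
          rw [← natCast_zsmul, smul_smul]
          module
        have h5 := hcancel _ _ h4
        have hcop : IsCoprime (p : ℤ) 3 := by
          rw [show (3 : ℤ) = ((3 : ℕ) : ℤ) by norm_num, Nat.isCoprime_iff_coprime]
          exact (Nat.coprime_primes hp Nat.prime_three).2 hp3
        obtain ⟨u, v, huv⟩ := hcop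
        refine ⟨v • y - u • (3 : ℤ) ^ n • (y ^ 2 * r), ?_⟩
        have h6 : (p : ℤ) • y = -((3 : ℤ) ^ (n + 1) • (y ^ 2 * r)) :=
          eq_neg_of_add_eq_zero_left h5
        calc y = (u * p + v * 3) • y := by rw [huv, one_smul]
          _ = u • ((p : ℤ) • y) + (v * 3) • y := by rw [add_smul, mul_smul]
          _ = _ := by rw [h6]; module
  let b := Module.Free.chooseBasis ℤ A
  refine b.repr.map_eq_zero_iff.1 (Finsupp.ext fun i => ?_)
  obtain ⟨y, hy⟩ := hdiv (b.repr x i).natAbs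
  refine Int.eq_zero_of_abs_lt_dvd (m := 3 ^ (b.repr x i).natAbs) ?_ ?_
  · refine ⟨b.repr y i, ?_⟩
    conv_lhs => rw [hy, map_smul, Finsupp.smul_apply, smul_eq_mul]
  · rw [Int.abs_eq_natAbs]
    exact_mod_cast Nat.lt_pow_self (by norm_num)

end Minkowski

section TorsionFree

/-- The ring generated by the numbers `2 ⟨α_s, α_t⟩`. -/
def entryRing {B : Type*} (M : CoxeterMatrix B) : Subalgebra ℤ ℝ :=
  Algebra.adjoin ℤ (Set.range fun p : B × B => 2 * formEntry M p.1 p.2)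

theorem two_mul_formEntry_mem {B : Type*} (M : CoxeterMatrix B) (s t : B) :
    2 * formEntry M s t ∈ entryRing M :=
  Algebra.subset_adjoin ⟨(s, t), rfl⟩

theorem isIntegral_two_mul_formEntry {B : Type*} (M : CoxeterMatrix B) (s t : B) :
    IsIntegral ℤ (2 * formEntry M s t) := by
  rw [formEntry]
  split_ifs with h
  · have : (2 * -1 : ℝ) = algebraMap ℤ ℝ (-2) := by norm_num
    rw [this]
    exact isIntegral_algebraMap
  · have h1 := Real.isIntegral_two_mul_cos_rat_mul_pi (1 / (M s t : ℚ))
    have : 2 * -Real.cos (Real.pi / (M s t : ℝ)) =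
        -(2 * Real.cos (((1 / (M s t : ℚ) : ℚ) : ℝ) * Real.pi)) := by
      push_cast
      rw [mul_neg, one_div_mul_eq_div]
    rw [this]
    exact h1.neg

theorem finite_entryRing {B : Type*} [Finite B] (M : CoxeterMatrix B) :
    Module.Finite ℤ (entryRing M) := by
  refine (Module.Finite.iff_fg (N := Subalgebra.toSubmodule (entryRing M))).2 ?_
  refine _root_.fg_adjoin_of_finite (Set.finite_range _) ?_
  rintro _ ⟨p, rfl⟩
  exact isIntegral_two_mul_formEntry M _ _

variable {B : Type*} [Fintype B] [DecidableEq B] {M : CoxeterMatrix B} {W : Type*} [Group W]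
  (cs : CoxeterSystem M W)

theorem exists_matrix (w : W) : ∃ A : Matrix B B (entryRing M),
    A.map (algebraMap (entryRing M) ℝ) = LinearMap.toMatrix' (rep cs w).toLinearMap := by
  induction w using cs.simple_induction_left with
  | one =>
    refine ⟨1, ?_⟩
    ext i j
    rw [LinearMap.toMatrix'_apply]
    simp [Matrix.one_apply, Pi.single_apply]
  | mul_simple_left w s ih =>
    obtain ⟨A, hA⟩ := ih
    refine ⟨(1 - Matrix.of fun i j => if i = s then ⟨_, two_mul_formEntry_mem M s j⟩ else 0) * A,
      ?_⟩
    rw [Matrix.map_mul, hA]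
    have : (rep cs (cs.simple s * w)).toLinearMap =
        (rep cs (cs.simple s)).toLinearMap ∘ₗ (rep cs w).toLinearMap := by
      exact LinearMap.ext fun x => rep_mul cs _ _ x
    rw [this, LinearMap.toMatrix'_comp]
    congr 1
    ext i j
    have hj : (Pi.single j 1 : B → ℝ) = simpleRoot j := by
      unfold simpleRoot
      congr!
    rw [LinearMap.toMatrix'_apply, hj, LinearEquiv.coe_coe, rep_simple, cform_simpleRoot]
    have hi : ∀ i j : B, simpleRoot j i = if i = j then (1 : ℝ) else 0 := by
      intro i j
      split_ifs with h
      · rw [h, simpleRoot_self]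
      · exact simpleRoot_of_ne h
    simp only [Pi.sub_apply, Pi.smul_apply, smul_eq_mul, hi, Matrix.map_apply, Matrix.sub_apply,
      Matrix.one_apply, Matrix.of_apply, map_sub]
    split_ifs <;> simp

/-- The geometric representation, written as matrices over the ring of entries. -/
def matrixRep : W →* Matrix B B (entryRing M) where
  toFun w := (exists_matrix cs w).choose
  map_one' := by
    apply Matrix.map_injective (FaithfulSMul.algebraMap_injective (entryRing M) ℝ)
    dsimp only
    rw [(exists_matrix cs 1).choose_spec]
    ext i j
    rw [LinearMap.toMatrix'_apply]
    simp [Matrix.one_apply, Pi.single_apply]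
  map_mul' v w := by
    apply Matrix.map_injective (FaithfulSMul.algebraMap_injective (entryRing M) ℝ)
    dsimp only
    rw [Matrix.map_mul, (exists_matrix cs _).choose_spec, (exists_matrix cs v).choose_spec,
      (exists_matrix cs w).choose_spec, ← LinearMap.toMatrix'_comp]
    congr 1
    exact LinearMap.ext fun x => rep_mul cs _ _ x

theorem matrixRep_injective : Function.Injective (matrixRep cs) := by
  intro v w h
  refine rep_ext (cs := cs) fun x => ?_
  have h1 : (matrixRep cs v).map (algebraMap (entryRing M) ℝ) =
      (matrixRep cs w).map (algebraMap (entryRing M) ℝ) := by rw [h]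
  have h2 := ((exists_matrix cs v).choose_spec.symm.trans h1).trans
    (exists_matrix cs w).choose_spec
  exact LinearMap.congr_fun (LinearMap.toMatrix'.injective h2) x

end TorsionFree

/-- A finitely generated Coxeter group is virtually torsion-free. -/
theorem exists_torsionFree_normal {B : Type*} [Fintype B] {M : CoxeterMatrix B} {W : Type*}
    [Group W] (cs : CoxeterSystem M W) :
    ∃ K : Subgroup W, K.Normal ∧ K.FiniteIndex ∧ ∀ x ∈ K, IsOfFinOrder x → x = 1 := by
  classical
  have := finite_entryRing M
  let I : Ideal (entryRing M) := Ideal.span {3}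
  have : Finite (entryRing M ⧸ I) := by
    have : Module.Finite ℤ (entryRing M ⧸ I) :=
      Module.Finite.of_surjective (Ideal.Quotient.mkₐ ℤ I).toLinearMap
        (Ideal.Quotient.mkₐ_surjective ℤ I)
    refine Module.finite_of_fg_torsion _ fun x => ?_
    refine ⟨⟨3, by simp⟩, ?_⟩
    obtain ⟨x, rfl⟩ := Ideal.Quotient.mk_surjective x
    change (3 : ℤ) • Ideal.Quotient.mk I x = 0
    rw [zsmul_eq_mul, ← map_intCast (Ideal.Quotient.mk I), ← map_mul]
    exact Ideal.Quotient.eq_zero_iff_mem.2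
      (Ideal.mul_mem_right _ _ (Ideal.subset_span (by simp)))
  let f : W →* Matrix B B (entryRing M ⧸ I) :=
    ((Ideal.Quotient.mk I).mapMatrix.toMonoidHom).comp (matrixRep cs)
  refine ⟨f.toHomUnits.ker, inferInstance, inferInstance, ?_⟩
  have key : ∀ x ∈ f.toHomUnits.ker, ∀ p : ℕ, p.Prime → x ^ p = 1 → x = 1 := by
    intro x hx p hp hxp
    have h1 : f x = 1 := by
      have := congrArg Units.val (MonoidHom.mem_ker.1 hx)
      simpa using this
    have h2 : ∀ i j, ∃ y : entryRing M, matrixRep cs x i j - (1 : Matrix B B (entryRing M)) i j =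
        3 * y := by
      intro i j
      have h3 := congrFun (congrFun h1 i) j
      have h4 : Ideal.Quotient.mk I (matrixRep cs x i j) =
          Ideal.Quotient.mk I ((1 : Matrix B B (entryRing M)) i j) := by
        rw [show Ideal.Quotient.mk I (matrixRep cs x i j) = f x i j from rfl, h3,
          Matrix.one_apply, Matrix.one_apply]
        split_ifs <;> simp
      obtain ⟨y, hy⟩ := Ideal.mem_span_singleton.1 (Ideal.Quotient.eq.1 h4)
      exact ⟨y, hy⟩
    choose Y hY using h2
    have h5 : matrixRep cs x = 1 + 3 * Matrix.of Y := by
      rw [← sub_eq_iff_eq_add']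
      ext i j : 2
      rw [Matrix.sub_apply, hY, show (3 : Matrix B B (entryRing M)) = (3 : ℕ) by norm_num,
        ← nsmul_eq_mul]
      simp
    have : Module.Free ℤ (entryRing M) := inferInstance
    have h6 := eq_one_of_pow_prime_eq_one hp (x := Matrix.of Y) (by
      rw [← h5, ← map_pow, hxp, map_one])
    apply matrixRep_injective cs
    rw [h5, h6, mul_zero, add_zero, map_one]
  intro x hx hfin
  by_contra hne
  have h0 : orderOf x ≠ 1 := fun h => hne (orderOf_eq_one_iff.1 h)
  obtain ⟨p, hp, m, hm⟩ := Nat.exists_prime_and_dvd h0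
  have h1 := key (x ^ m) (Subgroup.pow_mem _ hx m) p hp (by
    rw [← pow_mul, mul_comm, ← hm, pow_orderOf_eq_one])
  have hpos := hfin.orderOf_pos
  have h2 := Nat.le_of_dvd (by
    rcases Nat.eq_zero_or_pos m with rfl | h
    · exact absurd (hm.trans (mul_zero p)) hpos.ne'
    · exact h) (orderOf_dvd_of_pow_eq_one h1)
  have := hp.two_le
  nlinarith

section Extended

variable {B : Type*} [Fintype B] {M : CoxeterMatrix B} {W : Type*} [Group W]
  (cs : CoxeterSystem M W)

variable (M) in
/-- The canonical form, extended to a nondegenerate form on `V × V*`. -/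
def extForm : LinearMap.BilinForm ℝ ((B → ℝ) × (B → ℝ)) :=
  LinearMap.mk₂ ℝ (fun x y => cform M x.1 y.1 + (x.2 ⬝ᵥ y.1 + y.2 ⬝ᵥ x.1))
    (fun x x' y => by
      simp only [Prod.fst_add, Prod.snd_add, map_add, LinearMap.add_apply, add_dotProduct,
        dotProduct_add]; ring)
    (fun c x y => by
      simp only [Prod.smul_fst, Prod.smul_snd, map_smul, LinearMap.smul_apply, smul_dotProduct,
        dotProduct_smul, smul_eq_mul]; ring)
    (fun x y y' => by
      simp only [Prod.fst_add, Prod.snd_add, map_add, add_dotProduct, dotProduct_add]; ring)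
    (fun c x y => by
      simp only [Prod.smul_fst, Prod.smul_snd, map_smul, smul_dotProduct,
        dotProduct_smul, smul_eq_mul]; ring)

theorem extForm_apply (x y : (B → ℝ) × (B → ℝ)) :
    extForm M x y = cform M x.1 y.1 + (x.2 ⬝ᵥ y.1 + y.2 ⬝ᵥ x.1) := rfl

theorem extForm_symm (x y : (B → ℝ) × (B → ℝ)) : extForm M x y = extForm M y x := by
  rw [extForm_apply, extForm_apply, cform_symm, add_comm (x.2 ⬝ᵥ y.1)]

/-- The extension of the geometric representation to `V × V*`. -/
def extRep : W →* (((B → ℝ) × (B → ℝ)) ≃ₗ[ℝ] ((B → ℝ) × (B → ℝ))) :=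
  geomRep (extForm M) cs extForm_symm (fun s => (simpleRoot s, 0)) (fun s t => by
    rw [extForm_apply]; simp [cform_simpleRoot])

theorem extRep_inl (w : W) (x : B → ℝ) : extRep cs w (x, 0) = (rep cs w x, 0) := by
  induction w using cs.simple_induction_left with
  | one => simp
  | mul_simple_left w s ih =>
    rw [map_mul, LinearEquiv.mul_apply, ih, rep_mul, rep_simple, extRep, geomRep_simple,
      extForm_apply]
    ext i <;> simp

theorem extRep_conj_simple (w : W) (s : B) (f : B → ℝ) :
    extRep cs (w * cs.simple s * w⁻¹) (0, f) =
      (0, f) - (2 * (f ⬝ᵥ rep cs w (simpleRoot s))) • (rep cs w (simpleRoot s), 0) := by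
  have h1 : ∀ y, extRep cs w (extRep cs w⁻¹ y) = y := fun y => by
    rw [← LinearEquiv.mul_apply, ← map_mul, mul_inv_cancel, map_one]; rfl
  have h2 : extForm M (simpleRoot s, 0) (extRep cs w⁻¹ (0, f)) = f ⬝ᵥ rep cs w (simpleRoot s) := by
    have := geomRep_isometry (extForm M) cs extForm_symm (fun s => (simpleRoot s, 0))
      (fun s t => by rw [extForm_apply]; simp [cform_simpleRoot]) w (simpleRoot s, 0)
      (extRep cs w⁻¹ (0, f))
    rw [← this]
    change extForm M (extRep cs w _) (extRep cs w _) = _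
    rw [h1, extRep_inl, extForm_apply]
    simp
  have h3 : extRep cs (cs.simple s) (extRep cs w⁻¹ (0, f)) = extRep cs w⁻¹ (0, f) -
      (2 * (f ⬝ᵥ rep cs w (simpleRoot s))) • (simpleRoot s, 0) := by
    rw [← h2]
    exact geomRep_simple _ cs _ _ _ s _
  rw [map_mul, map_mul, LinearEquiv.mul_apply, LinearEquiv.mul_apply, h3, map_sub, h1, map_smul,
    extRep_inl]

variable {cs}

theorem exists_rep_eq_of_commute {w w' g : W} {s t : B}
    (h1 : rep cs w (simpleRoot s) ≠ rep cs w' (simpleRoot t))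
    (h2 : rep cs w (simpleRoot s) ≠ -rep cs w' (simpleRoot t))
    (hg : g * (w * cs.simple s * w⁻¹ * (w' * cs.simple t * w'⁻¹)) =
      (w * cs.simple s * w⁻¹ * (w' * cs.simple t * w'⁻¹)) * g) :
    ∃ y z : ℝ, rep cs g (rep cs w (simpleRoot s)) =
      y • rep cs w (simpleRoot s) + z • rep cs w' (simpleRoot t) := by
  have hg' : (g * w) * cs.simple s * (g * w)⁻¹ * ((g * w') * cs.simple t * (g * w')⁻¹) =
      w * cs.simple s * w⁻¹ * (w' * cs.simple t * w'⁻¹) := by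
    have : (g * w) * cs.simple s * (g * w)⁻¹ * ((g * w') * cs.simple t * (g * w')⁻¹) =
      (g * (w * cs.simple s * w⁻¹ * (w' * cs.simple t * w'⁻¹))) * g⁻¹ := by group
    rw [this, hg, mul_inv_cancel_right]
  have hnot : rep cs (g * w) (simpleRoot s) ∉ Submodule.span ℝ {rep cs (g * w') (simpleRoot t)} := by
    intro hmem
    obtain ⟨c, hc⟩ := Submodule.mem_span_singleton.1 hmem
    rw [rep_mul, rep_mul, ← map_smul] at hc
    have hc := (rep cs g).injective hc
    rcases eq_or_eq_neg_of_smul ((isRoot_simpleRoot s).map_rep w) ((isRoot_simpleRoot t).map_rep w')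
      hc.symm with h | h
    · exact h1 h
    · exact h2 h
  obtain ⟨φ, hφ1, hφ2⟩ := Submodule.exists_le_ker_of_notMem hnot
  have hφf : ∀ x, φ x = (fun i => φ (simpleRoot i)) ⬝ᵥ x := by
    intro x
    conv_lhs => rw [eq_sum_smul_simpleRoot x, map_sum]
    simp [dotProduct, mul_comm]
  set f : B → ℝ := fun i => φ (simpleRoot i)
  have hφ3 : f ⬝ᵥ rep cs (g * w') (simpleRoot t) = 0 := by
    rw [← hφf]; exact hφ2 (Submodule.mem_span_singleton_self _)
  rw [hφf] at hφ1
  have e := congrArg (fun u => (extRep cs u (0, f)).1) hg'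
  simp only [map_mul (extRep cs) (_ * _ * _) (_ * _ * _), LinearEquiv.mul_apply] at e
  rw [extRep_conj_simple, extRep_conj_simple, hφ3, mul_zero, zero_smul, sub_zero,
    extRep_conj_simple, map_sub, map_smul, extRep_conj_simple, extRep_inl, rep_conj_simple] at e
  simp only [Prod.fst_sub, Prod.smul_fst, zero_sub, rep_mul] at e
  rw [rep_mul] at hφ1
  set α := rep cs w (simpleRoot s)
  set β := rep cs w' (simpleRoot t)
  set p := f ⬝ᵥ rep cs g α
  refine ⟨(f ⬝ᵥ α) / p - 2 * (f ⬝ᵥ β) * cform M α β / p, (f ⬝ᵥ β) / p, ?_⟩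
  have e2 : rep cs g α = (1 / (2 * p)) • ((2 * p) • rep cs g α) := by
    rw [smul_smul, one_div, inv_mul_cancel₀ (by simpa using hφ1), one_smul]
  rw [e2, ← neg_neg ((2 * p) • rep cs g α), e]
  match_scalars <;> field_simp
  ring

end Extended

section Parabolic

variable {B : Type*} [Fintype B] {M : CoxeterMatrix B} {W : Type*} [Group W]
  {cs : CoxeterSystem M W}

omit [Fintype B] in
theorem simple_mem_standardParabolic {X : Set B} {s : B} (hs : s ∈ X) :
    cs.simple s ∈ standardParabolic cs X :=
  Subgroup.subset_closure ⟨s, hs, rfl⟩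

omit [Fintype B] in
theorem standardParabolic_induction {X : Set B} {p : W → Prop} (h1 : p 1)
    (hmul : ∀ s ∈ X, ∀ w ∈ standardParabolic cs X, p w → p (cs.simple s * w)) {w : W}
    (hw : w ∈ standardParabolic cs X) : p w := by
  unfold standardParabolic at hw
  induction hw using Subgroup.closure_induction_left with
  | one => exact h1
  | mul_left x hx y hy ih =>
    obtain ⟨s, hs, rfl⟩ := hx
    exact hmul s hs y hy ih
  | inv_mul_cancel x hx y hy ih =>
    obtain ⟨s, hs, rfl⟩ := hx
    rw [cs.inv_simple]
    exact hmul s hs y hy ih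

theorem rep_apply_of_notMem {X : Set B} {w : W} (hw : w ∈ standardParabolic cs X) (x : B → ℝ)
    {i : B} (hi : i ∉ X) : rep cs w x i = x i := by
  revert x
  refine standardParabolic_induction (p := fun w => ∀ x, rep cs w x i = x i) ?_ ?_ hw
  · intro x
    rw [rep_one]
  · intro s hs w _ ih x
    rw [rep_mul, rep_simple, Pi.sub_apply, ih, Pi.smul_apply,
      simpleRoot_of_ne (fun h : i = s => hi (h ▸ hs)), smul_zero, sub_zero]

theorem rep_eq_of_orthogonal {X : Set B} {w : W} (hw : w ∈ standardParabolic cs X) {x : B → ℝ}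
    (hx : ∀ s ∈ X, cform M (simpleRoot s) x = 0) : rep cs w x = x := by
  refine standardParabolic_induction (p := fun w => rep cs w x = x) (rep_one cs x) ?_ hw
  intro s hs w _ ih
  rw [rep_mul, ih, rep_simple, hx s hs, mul_zero, zero_smul, sub_zero]

theorem eq_one_of_rep_eq_on {c : (coxeterGraph M).ConnectedComponent} {w : W}
    (hw : w ∈ standardParabolic cs c.supp)
    (h : ∀ s ∈ c.supp, rep cs w (simpleRoot s) = simpleRoot s) : w = 1 := by
  refine eq_one_of_rep_eq (cs := cs) fun t => ?_
  by_cases ht : t ∈ c.supp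
  · exact h t ht
  · refine rep_eq_of_orthogonal hw fun s hs => ?_
    rw [cform_simpleRoot, formEntry_eq_zero_of_not_mem M hs ht]

theorem rep_eq_or_eq_neg_of_conj_eq {w w' : W} {s t : B}
    (h : w * cs.simple s * w⁻¹ = w' * cs.simple t * w'⁻¹) :
    rep cs w (simpleRoot s) = rep cs w' (simpleRoot t) ∨
      rep cs w (simpleRoot s) = -rep cs w' (simpleRoot t) := by
  have h1 := rep_conj_simple (cs := cs) w s (rep cs w (simpleRoot s))
  rw [h, rep_conj_simple, ((isRoot_simpleRoot s).map_rep w).form_self] at h1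
  refine eq_or_eq_neg_of_smul ((isRoot_simpleRoot s).map_rep w)
    ((isRoot_simpleRoot t).map_rep w')
    (c := cform M (rep cs w' (simpleRoot t)) (rep cs w (simpleRoot s))) ?_
  set α := rep cs w (simpleRoot s)
  set β := rep cs w' (simpleRoot t)
  have h2 : (2 : ℝ) • α = (2 : ℝ) • (cform M β α • β) := by
    rw [sub_right_inj, mul_one] at h1
    rw [← h1, mul_smul]
  have := congrArg (fun x => (1 / 2 : ℝ) • x) h2
  simpa [smul_smul] using this

end Parabolic

section PerronFrobenius

variable {B : Type*} [Fintype B] {M : CoxeterMatrix B}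
  {c : (coxeterGraph M).ConnectedComponent} {v : B → ℝ}

theorem pos_of_radical (hv : 0 ≤ v) (hsupp : Function.support v ⊆ c.supp) (hne : v ≠ 0)
    (hrad : ∀ s ∈ c.supp, cform M (simpleRoot s) v = 0) : ∀ s ∈ c.supp, 0 < v s := by
  obtain ⟨s₀, hs₀⟩ := Function.ne_iff.1 hne
  refine component_induction M (hsupp hs₀) _ (lt_of_le_of_ne (hv s₀) (Ne.symm hs₀)) ?_
  intro s t hs ht hst hadj hvs
  refine lt_of_le_of_ne (hv t) fun h0 => ?_
  have h1 := hrad t ht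
  rw [cform_simpleRoot_left] at h1
  have h2 : ∀ u ∈ Finset.univ, v u * formEntry M t u ≤ 0 := by
    intro u _
    by_cases hu : t = u
    · subst hu; rw [← h0]; simp
    · exact mul_nonpos_of_nonneg_of_nonpos (hv u) (formEntry_nonpos M hu)
  have h3 : v s * formEntry M t s = 0 := (Finset.sum_eq_zero_iff_of_nonpos h2).1 h1 s (Finset.mem_univ s)
  rcases mul_eq_zero.1 h3 with h | h
  · exact hvs.ne' h
  · exact hadj (by rw [formEntry_symm]; exact h)

theorem posSemidefOn_of_radical (hv : 0 ≤ v) (hsupp : Function.support v ⊆ c.supp) (hne : v ≠ 0)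
    (hrad : ∀ s ∈ c.supp, cform M (simpleRoot s) v = 0) : PosSemidefOn M c.supp := by
  intro x hx
  have hpos := pos_of_radical hv hsupp hne hrad
  have hx0 : ∀ i, i ∉ c.supp → x i = 0 := fun i hi => by
    by_contra h; exact hi (hx h)
  have hterm : ∀ i j, (x i ^ 2 / v i * (v j * formEntry M i j) +
      x j ^ 2 / v j * (v i * formEntry M j i)) / 2 ≤ x i * x j * formEntry M i j := by
    intro i j
    rw [formEntry_symm M j i]
    by_cases hi : i ∈ c.supp
    swap
    · have : v i = 0 := by by_contra h; exact hi (hsupp h)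
      simp [hx0 i hi, this]
    by_cases hj : j ∈ c.supp
    swap
    · have : v j = 0 := by by_contra h; exact hj (hsupp h)
      simp [hx0 j hj, this]
    have pi := hpos i hi
    have pj := hpos j hj
    by_cases hij : i = j
    · subst hij
      apply le_of_eq
      field_simp
      ring
    · have h1 := formEntry_nonpos M hij
      have h2 : x i * x j ≤ (x i ^ 2 / v i * v j + x j ^ 2 / v j * v i) / 2 := by
        have : (x i ^ 2 / v i * v j + x j ^ 2 / v j * v i) / 2 - x i * x j =
            (x i * v j - x j * v i) ^ 2 / (2 * v i * v j) := by
          field_simp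
          ring
        have h3 : 0 ≤ (x i * v j - x j * v i) ^ 2 / (2 * v i * v j) := by positivity
        linarith
      calc _ = (x i ^ 2 / v i * v j + x j ^ 2 / v j * v i) / 2 * formEntry M i j := by ring
        _ ≤ _ := mul_le_mul_of_nonpos_right h2 h1
  have hrow : ∀ i, ∑ j, x i ^ 2 / v i * (v j * formEntry M i j) = 0 := by
    intro i
    rw [← Finset.mul_sum]
    by_cases hi : i ∈ c.supp
    · have := hrad i hi
      rw [cform_simpleRoot_left] at this
      rw [this, mul_zero]
    · simp [hx0 i hi]
  calc (0 : ℝ) = ∑ i, ∑ j, (x i ^ 2 / v i * (v j * formEntry M i j) +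
      x j ^ 2 / v j * (v i * formEntry M j i)) / 2 := by
        simp_rw [← Finset.sum_div, Finset.sum_add_distrib]
        rw [Finset.sum_comm (f := fun i j => x j ^ 2 / v j * (v i * formEntry M j i))]
        simp [hrow]
    _ ≤ _ := Finset.sum_le_sum fun i _ => Finset.sum_le_sum fun j _ => hterm i j

end PerronFrobenius

section PlaneAlgebra

variable {V : Type*} [AddCommGroup V] [Module ℝ V]

theorem span_pair_eq_of_mem {u w x y : V} (hx : x ∈ Submodule.span ℝ {u, w})
    (hy : y ∈ Submodule.span ℝ {u, w}) (hx0 : x ≠ 0) (hyx : ∀ μ : ℝ, y ≠ μ • x) :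
    Submodule.span ℝ {x, y} = Submodule.span ℝ {u, w} := by
  classical
  have hle : Submodule.span ℝ {x, y} ≤ Submodule.span ℝ {u, w} := by
    rw [Submodule.span_le]
    rintro z (rfl | rfl)
    · exact hx
    · exact hy
  have : FiniteDimensional ℝ (Submodule.span ℝ {u, w}) :=
    FiniteDimensional.span_of_finite ℝ (by simp)
  refine Submodule.eq_of_le_of_finrank_le hle ?_
  have h1 : Module.finrank ℝ (Submodule.span ℝ ({u, w} : Set V)) ≤ 2 := by
    have := finrank_span_finset_le_card (R := ℝ) ({u, w} : Finset V)
    rw [Finset.coe_pair] at this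
    exact this.trans Finset.card_le_two
  have hli : LinearIndependent ℝ ![x, y] := by
    rw [LinearIndependent.pair_iff' hx0]
    intro μ h
    exact hyx μ h.symm
  have h2 := finrank_span_eq_card hli
  rw [Matrix.range_cons, Matrix.range_cons, Matrix.range_empty, Set.union_empty,
    Set.singleton_union] at h2
  rw [h2]
  simpa using h1

variable {b : LinearMap.BilinForm ℝ V} {α β : V}

theorem eq_zero_of_fixed_of_reflections (hind : ∀ s t : ℝ, s • α + t • β = 0 → s = 0 ∧ t = 0) {x : V}
    (h : x - (2 * b β x) • β - (2 * b α (x - (2 * b β x) • β)) • α = x) :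
    b α x = 0 ∧ b β x = 0 := by
  have h1 : (-(2 * b α (x - (2 * b β x) • β))) • α + (-(2 * b β x)) • β = 0 := by
    rw [← sub_eq_zero] at h
    rw [← h]
    module
  obtain ⟨h2, h3⟩ := hind _ _ h1
  have h4 : b β x = 0 := by linarith
  rw [h4] at h2
  simp at h2
  exact ⟨h2, h4⟩

theorem eq_zero_of_negated_by_reflections (hβ : b β β = 1) (hs : b α β = b β α)
    (hc : b α β ≠ 0) {x : V}
    (h : x - (2 * b β x) • β - (2 * b α (x - (2 * b β x) • β)) • α = -x) : x = 0 := by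
  set p := b α (x - (2 * b β x) • β) with hp
  have h1 : x = p • α + b β x • β := by
    have : (2 : ℝ) • x = (2 : ℝ) • (p • α + b β x • β) := by
      rw [← sub_eq_zero] at h ⊢
      rw [← h]
      module
    have := congrArg (fun x => (1 / 2 : ℝ) • x) this
    simpa [smul_smul] using this
  have h2 : b β x = p * b α β + b β x := by
    conv_lhs => rw [h1]
    simp [hβ, hs]
  have h3 : p = 0 := by
    have : p * b α β = 0 := by linarith
    exact (mul_eq_zero.1 this).resolve_right hc
  have h4 : b α x = b β x * b α β := by
    conv_lhs => rw [h1, h3]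
    simp
  rw [h3, map_sub, map_smul, smul_eq_mul, h4] at hp
  have h5 : b β x = 0 := by
    have : b β x * b α β = 0 := by linarith
    exact (mul_eq_zero.1 this).resolve_right hc
  rw [h1, h3, h5]
  simp

end PlaneAlgebra

section CommutingPair

variable {B : Type*} [Fintype B] {M : CoxeterMatrix B} {W : Type*} [Group W]
  {cs : CoxeterSystem M W} {c : (coxeterGraph M).ConnectedComponent}

theorem IsRoot.pair_independent {x y : B → ℝ} (hx : IsRoot cs x) (hy : IsRoot cs y) (h1 : y ≠ x)
    (h2 : y ≠ -x) (s t : ℝ) (h : s • x + t • y = 0) : s = 0 ∧ t = 0 := by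
  have ht : t = 0 := by
    by_contra ht
    have : y = (-(s / t)) • x := by
      have h3 : t⁻¹ • (s • x + t • y) = 0 := by rw [h, smul_zero]
      rw [smul_add, smul_smul, smul_smul, inv_mul_cancel₀ ht, one_smul] at h3
      rw [neg_smul, eq_neg_iff_add_eq_zero, add_comm, ← h3, div_eq_inv_mul]
    rcases eq_or_eq_neg_of_smul hy hx this with h4 | h4
    · exact h1 h4
    · exact h2 h4
  refine ⟨?_, ht⟩
  rw [ht, zero_smul, add_zero] at h
  exact (smul_eq_zero.1 h).resolve_right hx.ne_zero

theorem rep_simple_conj (a : W) (s : B) (x : B → ℝ) :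
    rep cs (cs.simple s * (a * cs.simple s * a⁻¹)) x =
      x - (2 * cform M (rep cs a (simpleRoot s)) x) • rep cs a (simpleRoot s) -
        (2 * cform M (simpleRoot s) (x - (2 * cform M (rep cs a (simpleRoot s)) x) •
          rep cs a (simpleRoot s))) • simpleRoot s := by
  rw [rep_mul, rep_conj_simple, rep_simple]

variable (cs c) in
/-- A torsion-free subgroup of a standard parabolic subgroup, normalized by it. -/
structure IsTFNormal (A : Subgroup W) : Prop where
  le : A ≤ standardParabolic cs c.supp
  conj_mem : ∀ s ∈ c.supp, ∀ a ∈ A, cs.simple s * a * cs.simple s ∈ A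
  eq_one : ∀ x ∈ A, IsOfFinOrder x → x = 1

variable {A A' : Subgroup W}

omit [Fintype B] in
theorem IsTFNormal.mul_conj_mem (hA : IsTFNormal cs c A) {s : B} (hs : s ∈ c.supp) {a : W}
    (ha : a ∈ A) : cs.simple s * (a * cs.simple s * a⁻¹) ∈ A := by
  have := A.mul_mem (hA.conj_mem s hs a ha) (A.inv_mem ha)
  simpa only [mul_assoc] using this

theorem IsTFNormal.eq_bot_of_fixed (hA : IsTFNormal cs c A) {s : B} (hs : s ∈ c.supp)
    (h : ∀ a ∈ A, rep cs a (simpleRoot s) = simpleRoot s ∨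
      rep cs a (simpleRoot s) = -simpleRoot s) : A = ⊥ := by
  have h0 : ∀ a ∈ A, rep cs (a * a) (simpleRoot s) = simpleRoot s := by
    intro a ha
    rcases h a ha with h1 | h1
    · rw [rep_mul, h1, h1]
    · rw [rep_mul, h1, map_neg, h1, neg_neg]
  have h2 : ∀ t ∈ c.supp, ∀ a ∈ A, rep cs (a * a) (simpleRoot t) = simpleRoot t := by
    refine component_induction M hs _ h0 ?_
    intro s t _ ht _ hst ih a ha
    have h3 : rep cs (a * a) (rep cs (cs.simple t) (simpleRoot s)) =
        rep cs (cs.simple t) (simpleRoot s) := by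
      have h4 : a * a * cs.simple t = cs.simple t *
          ((cs.simple t * a * cs.simple t) * (cs.simple t * a * cs.simple t)) := by
        simp [mul_assoc]
      rw [← rep_mul, h4, rep_mul, ih _ (hA.conj_mem t ht a ha)]
    rw [rep_simple, map_sub, ih a ha, sub_right_inj, map_smul, cform_simpleRoot] at h3
    refine smul_right_injective _ (r := 2 * formEntry M t s) ?_ h3
    rw [formEntry_symm M t s]
    simpa using hst
  rw [Subgroup.eq_bot_iff_forall]
  intro a ha
  have h3 : a * a = 1 := eq_one_of_rep_eq_on (cs := cs) (c := c)
    (mul_mem (hA.le ha) (hA.le ha)) fun t ht => h2 t ht a ha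
  exact hA.eq_one a ha (isOfFinOrder_iff_pow_eq_one.2 ⟨2, by norm_num, by rw [sq, h3]⟩)

theorem IsTFNormal.exists_moved (hA : IsTFNormal cs c A) (hne : A ≠ ⊥) {s : B}
    (hs : s ∈ c.supp) : ∃ a ∈ A, rep cs a (simpleRoot s) ≠ simpleRoot s ∧
      rep cs a (simpleRoot s) ≠ -simpleRoot s := by
  by_contra hcon
  refine hne (hA.eq_bot_of_fixed hs fun a ha => ?_)
  by_contra h
  rw [not_or] at h
  exact hcon ⟨a, ha, h⟩

theorem IsTFNormal.form_ne_zero (hA : IsTFNormal cs c A) {s : B}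
    (hs : s ∈ c.supp) {a : W} (ha : a ∈ A) (h1 : rep cs a (simpleRoot s) ≠ simpleRoot s)
    (h2 : rep cs a (simpleRoot s) ≠ -simpleRoot s) :
    cform M (simpleRoot s) (rep cs a (simpleRoot s)) ≠ 0 := by
  intro h0
  have h3 := isOfFinOrder_of_form_lt_one (cs := cs) (w := 1) (w' := a) (s := s) (t := s) (by
    rw [rep_one, h0]; simp)
  simp only [one_mul, inv_one, mul_one] at h3
  have h4 := hA.eq_one _ (hA.mul_conj_mem hs ha) h3
  rw [mul_eq_one_iff_eq_inv, ← cs.inv_simple, inv_inj] at h4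
  have h5 : a * cs.simple s * a⁻¹ = 1 * cs.simple s * 1⁻¹ := by
    rw [cs.inv_simple] at h4
    rw [← h4]; simp
  rcases rep_eq_or_eq_neg_of_conj_eq (cs := cs) h5 with h | h
  · exact h1 (by rw [h, rep_one])
  · exact h2 (by rw [h, rep_one])

theorem IsTFNormal.rep_mem_plane (hA : IsTFNormal cs c A) {s : B}
    (hs : s ∈ c.supp) {a : W} (ha : a ∈ A) (h1 : rep cs a (simpleRoot s) ≠ simpleRoot s)
    (h2 : rep cs a (simpleRoot s) ≠ -simpleRoot s) {b : W} (hb : ∀ a ∈ A, b * a = a * b)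
    {x : B → ℝ} (hx : x ∈ Submodule.span ℝ {simpleRoot s, rep cs a (simpleRoot s)}) :
    rep cs b x ∈ Submodule.span ℝ {simpleRoot s, rep cs a (simpleRoot s)} := by
  have hr := hA.mul_conj_mem hs ha
  obtain ⟨p, q, rfl⟩ := Submodule.mem_span_pair.1 hx
  rw [map_add, map_smul, map_smul]
  refine add_mem (Submodule.smul_mem _ _ ?_) (Submodule.smul_mem _ _ ?_)
  · obtain ⟨y, z, h⟩ := exists_rep_eq_of_commute (cs := cs) (w := 1) (w' := a) (g := b) (s := s)
      (t := s) (by rw [rep_one]; exact h1.symm)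
      (by rw [rep_one]; intro h; exact h2 (neg_eq_iff_eq_neg.2 h).symm)
      (by simpa using hb _ hr)
    rw [rep_one] at h
    exact Submodule.mem_span_pair.2 ⟨y, z, h.symm⟩
  · obtain ⟨y, z, h⟩ := exists_rep_eq_of_commute (cs := cs) (w := a) (w' := 1) (g := b) (s := s)
      (t := s) (by rw [rep_one]; exact h1)
      (by rw [rep_one]; exact h2)
      (by
        have := hb _ (A.inv_mem hr)
        simpa [mul_assoc] using this)
    rw [rep_one] at h
    exact Submodule.mem_span_pair.2 ⟨z, y, by rw [h, add_comm]⟩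

/-- The planes spanned by a simple root and its image under `A` are stable under `A`. -/
theorem IsTFNormal.exists_plane (hA : IsTFNormal cs c A) (hA' : IsTFNormal cs c A')
    (hcomm : ∀ a ∈ A, ∀ b ∈ A', a * b = b * a) (hne : A ≠ ⊥) (hne' : A' ≠ ⊥) (s : B)
    (hs : s ∈ c.supp) : ∃ a ∈ A, rep cs a (simpleRoot s) ≠ simpleRoot s ∧
      rep cs a (simpleRoot s) ≠ -simpleRoot s ∧
      ∀ g ∈ A, ∀ x ∈ Submodule.span ℝ {simpleRoot s, rep cs a (simpleRoot s)},
        rep cs g x ∈ Submodule.span ℝ {simpleRoot s, rep cs a (simpleRoot s)} := by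
  obtain ⟨a, ha, h1, h2⟩ := hA.exists_moved hne hs
  obtain ⟨b, hb, h3, h4⟩ := hA'.exists_moved hne' hs
  refine ⟨a, ha, h1, h2, ?_⟩
  have heq : Submodule.span ℝ {simpleRoot s, rep cs b (simpleRoot s)} =
      Submodule.span ℝ {simpleRoot s, rep cs a (simpleRoot s)} := by
    have hs0 : simpleRoot s ∈ Submodule.span ℝ {simpleRoot s, rep cs a (simpleRoot s)} :=
      Submodule.subset_span (by simp)
    refine span_pair_eq_of_mem hs0 ?_ (isRoot_simpleRoot (cs := cs) s).ne_zero ?_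
    · exact hA.rep_mem_plane hs ha h1 h2 (fun a ha => (hcomm a ha b hb).symm) hs0
    · intro μ hμ
      rcases eq_or_eq_neg_of_smul ((isRoot_simpleRoot s).map_rep b)
        (isRoot_simpleRoot (cs := cs) s) hμ with h | h
      · exact h3 h
      · exact h4 h
  intro g hg x hx
  rw [← heq] at hx ⊢
  exact hA'.rep_mem_plane hs hb h3 h4 (fun b hb => hcomm g hg b hb) hx

end CommutingPair

section CommutingPair

variable {B : Type*} [Fintype B] {M : CoxeterMatrix B} {W : Type*} [Group W]
  {cs : CoxeterSystem M W} {c : (coxeterGraph M).ConnectedComponent} {A A' : Subgroup W}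

theorem IsTFNormal.exists_isotropic_aux (hA : IsTFNormal cs c A) {i j : B} (hi : i ∈ c.supp)
    (hij : formEntry M i j ≠ 0) {a : W} (ha : a ∈ A)
    (h1 : rep cs a (simpleRoot i) ≠ simpleRoot i) (h2 : rep cs a (simpleRoot i) ≠ -simpleRoot i)
    {P Q : Submodule ℝ (B → ℝ)} (hP : P = Submodule.span ℝ {simpleRoot i, rep cs a (simpleRoot i)})
    (hPA : ∀ g ∈ A, ∀ x ∈ P, rep cs g x ∈ P) (hQA : ∀ g ∈ A, ∀ x ∈ Q, rep cs g x ∈ Q)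
    (hj : simpleRoot j ∈ Q) (hline : ∀ x ∈ P ⊓ Q, ∀ y ∈ P ⊓ Q, x ≠ 0 → ∃ μ : ℝ, y = μ • x) :
    ∃ v ∈ P ⊓ Q, v ≠ 0 ∧ cform M v v = 0 ∧ cform M (simpleRoot j) v = 0 := by
  set r := cs.simple i * (a * cs.simple i * a⁻¹) with hr
  have hrA : r ∈ A := hA.mul_conj_mem hi ha
  have hform := rep_simple_conj (cs := cs) a i
  rw [← hr] at hform
  set α : B → ℝ := simpleRoot i with hα
  set β := rep cs a α with hβ
  have hind : ∀ s t : ℝ, s • α + t • β = 0 → s = 0 ∧ t = 0 :=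
    (isRoot_simpleRoot (cs := cs) i).pair_independent ((isRoot_simpleRoot i).map_rep a) h1 h2
  have hc : cform M α β ≠ 0 := hA.form_ne_zero hi ha h1 h2
  have hββ : cform M β β = 1 := ((isRoot_simpleRoot i).map_rep a).form_self
  have hαP : α ∈ P := by rw [hP]; exact Submodule.subset_span (by simp)
  have hβP : β ∈ P := by rw [hP]; exact Submodule.subset_span (by simp)
  set v := rep cs r (simpleRoot j) - simpleRoot j with hv
  have hvP : v ∈ P := by
    rw [hv, hform, show ∀ x y z : B → ℝ, x - y - z - x = -(y + z) by intros; abel]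
    exact neg_mem (add_mem (Submodule.smul_mem _ _ hβP) (Submodule.smul_mem _ _ hαP))
  have hvQ : v ∈ Q := sub_mem (hQA r hrA _ hj) hj
  have hv0 : v ≠ 0 := by
    intro h0
    have := sub_eq_zero.1 (hv.symm.trans h0)
    rw [hform] at this
    have := (eq_zero_of_fixed_of_reflections hind this).1
    rw [cform_simpleRoot] at this
    exact hij this
  have hvv : cform M v v = 0 := by
    by_contra hne
    obtain ⟨μ, hμ⟩ := hline v ⟨hvP, hvQ⟩ (rep cs r v) ⟨hPA r hrA v hvP, hQA r hrA v hvQ⟩ hv0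
    have h3 := cform_rep cs r v v
    rw [hμ] at h3
    simp only [map_smul, LinearMap.smul_apply, smul_eq_mul] at h3
    have h4 : (μ - 1) * (μ + 1) = 0 := by
      have : ((μ - 1) * (μ + 1)) * cform M v v = 0 := by linear_combination h3
      exact (mul_eq_zero.1 this).resolve_right hne
    rw [hform] at hμ
    rcases mul_eq_zero.1 h4 with h5 | h5
    · rw [sub_eq_zero.1 h5, one_smul] at hμ
      obtain ⟨h6, h7⟩ := eq_zero_of_fixed_of_reflections hind hμ
      rw [hP] at hvP
      obtain ⟨y, z, hyz⟩ := Submodule.mem_span_pair.1 hvP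
      apply hne
      nth_rewrite 1 [← hyz]
      rw [map_add, LinearMap.add_apply, map_smul, map_smul, LinearMap.smul_apply,
        LinearMap.smul_apply, h6, h7]
      simp
    · rw [eq_neg_of_add_eq_zero_left h5, neg_smul, one_smul] at hμ
      exact hv0 (eq_zero_of_negated_by_reflections hββ (cform_symm _ _ _) hc hμ)
  refine ⟨v, ⟨hvP, hvQ⟩, hv0, hvv, ?_⟩
  have h3 := cform_rep cs r (simpleRoot j) (simpleRoot j)
  rw [show rep cs r (simpleRoot j) = simpleRoot j + v by rw [hv]; abel] at h3
  simp only [map_add, LinearMap.add_apply, hvv, cform_symm M v (simpleRoot j)] at h3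
  linarith

theorem IsTFNormal.exists_isotropic (hA : IsTFNormal cs c A) {i j : B} (hi : i ∈ c.supp)
    (hj : j ∈ c.supp) (hij : formEntry M i j ≠ 0) {a a' : W} (ha : a ∈ A) (ha' : a' ∈ A)
    (h1 : rep cs a (simpleRoot i) ≠ simpleRoot i) (h2 : rep cs a (simpleRoot i) ≠ -simpleRoot i)
    (h1' : rep cs a' (simpleRoot j) ≠ simpleRoot j)
    (h2' : rep cs a' (simpleRoot j) ≠ -simpleRoot j)
    {P Q : Submodule ℝ (B → ℝ)} (hP : P = Submodule.span ℝ {simpleRoot i, rep cs a (simpleRoot i)})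
    (hQ : Q = Submodule.span ℝ {simpleRoot j, rep cs a' (simpleRoot j)})
    (hPA : ∀ g ∈ A, ∀ x ∈ P, rep cs g x ∈ P) (hQA : ∀ g ∈ A, ∀ x ∈ Q, rep cs g x ∈ Q)
    (hPQ : P ≠ Q) :
    ∃ v, v ∈ P ∧ v ∈ Q ∧ v ≠ 0 ∧ cform M v v = 0 ∧ cform M (simpleRoot i) v = 0 ∧
      cform M (simpleRoot j) v = 0 := by
  have hline : ∀ x ∈ P ⊓ Q, ∀ y ∈ P ⊓ Q, x ≠ 0 → ∃ μ : ℝ, y = μ • x := by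
    intro x hx y hy hx0
    by_contra! hcon
    apply hPQ
    have e1 := span_pair_eq_of_mem (hP ▸ hx.1) (hP ▸ hy.1) hx0 hcon
    have e2 := span_pair_eq_of_mem (hQ ▸ hx.2) (hQ ▸ hy.2) hx0 hcon
    rw [hP, hQ, ← e1, ← e2]
  obtain ⟨v, hv, hv0, hvv, hvj⟩ := hA.exists_isotropic_aux hi hij ha h1 h2 hP hPA hQA
    (by rw [hQ]; exact Submodule.subset_span (by simp)) hline
  obtain ⟨v', hv', hv0', -, hvi⟩ := hA.exists_isotropic_aux hj (by rwa [formEntry_symm]) ha' h1' h2'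
    hQ hQA hPA (by rw [hP]; exact Submodule.subset_span (by simp))
    (by rw [inf_comm]; exact hline)
  obtain ⟨μ, hμ⟩ := hline v' hv'.symm v hv hv0'
  exact ⟨v, hv.1, hv.2, hv0, hvv, by rw [hμ, map_smul, hvi, smul_zero], hvj⟩

theorem posSemidefOn_of_subset_pair {X : Set B} {i j : B} (hX : X ⊆ {i, j}) :
    PosSemidefOn M X := by
  intro x hx
  have hx0 : ∀ k, k ≠ i → k ≠ j → x k = 0 := by
    intro k h1 h2
    by_contra h
    rcases hX (hx h) with h | h
    · exact h1 h
    · exact h2 h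
  rw [← cform_apply]
  by_cases hij : i = j
  · subst hij
    have : x = x i • simpleRoot i := by
      funext k
      by_cases hk : k = i
      · subst hk; simp [simpleRoot_self]
      · simp [simpleRoot_of_ne hk, hx0 k hk hk]
    rw [this]
    simp only [map_smul, LinearMap.smul_apply, smul_eq_mul, cform_simpleRoot, formEntry_self,
      mul_one]
    exact mul_self_nonneg _
  · have : x = x i • simpleRoot i + x j • simpleRoot j := by
      funext k
      by_cases hk : k = i
      · subst hk; simp [simpleRoot_self, simpleRoot_of_ne hij]
      · by_cases hk' : k = j
        · subst hk'; simp [simpleRoot_self, simpleRoot_of_ne hk]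
        · simp [simpleRoot_of_ne hk, simpleRoot_of_ne hk', hx0 k hk hk']
    rw [this]
    simp only [map_add, LinearMap.add_apply, map_smul, LinearMap.smul_apply, smul_eq_mul,
      cform_simpleRoot, formEntry_self, mul_one, formEntry_symm M j i]
    have h1 := neg_one_le_formEntry M i j
    have h2 := formEntry_nonpos M hij
    nlinarith [mul_nonneg (show 0 ≤ 1 + formEntry M i j by linarith)
      (add_nonneg (sq_nonneg (x i)) (sq_nonneg (x j))),
      mul_nonneg (neg_nonneg.2 h2) (sq_nonneg (x i - x j))]

theorem subset_pair_of_mem_span {X : Set B} {i : B} (hi : i ∈ X) {β : B → ℝ}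
    (h : ∀ k ∈ X, simpleRoot k ∈ Submodule.span ℝ {simpleRoot i, β}) : ∃ j, X ⊆ {i, j} := by
  by_cases hX : ∃ j ∈ X, j ≠ i
  · obtain ⟨j, hj, hji⟩ := hX
    refine ⟨j, fun k hk => ?_⟩
    by_contra hkn
    rw [Set.mem_insert_iff, Set.mem_singleton_iff, not_or] at hkn
    have heq := span_pair_eq_of_mem (h i hi) (h j hj) (x := simpleRoot i) (y := simpleRoot j)
      (by
        intro h0
        have := congrFun h0 i
        rw [simpleRoot_self] at this
        exact one_ne_zero this)
      (by
        intro μ h0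
        have := congrFun h0 j
        rw [simpleRoot_self, Pi.smul_apply, simpleRoot_of_ne hji, smul_zero] at this
        exact one_ne_zero this)
    have hk' := h k hk
    rw [← heq] at hk'
    obtain ⟨y, z, hyz⟩ := Submodule.mem_span_pair.1 hk'
    have := congrFun hyz k
    simp [simpleRoot_self, simpleRoot_of_ne hkn.1, simpleRoot_of_ne hkn.2] at this
  · push Not at hX
    exact ⟨i, fun k hk => by simp [hX k hk]⟩

theorem IsTFNormal.posSemidefOn_of_radical (hA : IsTFNormal cs c A) {s : B} (hs : s ∈ c.supp)
    {a : W} (ha : a ∈ A) (h1 : rep cs a (simpleRoot s) ≠ simpleRoot s)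
    (h2 : rep cs a (simpleRoot s) ≠ -simpleRoot s) {v : B → ℝ}
    (hvP : v ∈ Submodule.span ℝ {simpleRoot s, rep cs a (simpleRoot s)}) (hv0 : v ≠ 0)
    (hvv : cform M v v = 0) (hrad : ∀ t ∈ c.supp, cform M (simpleRoot t) v = 0) :
    PosSemidefOn M c.supp := by
  set α : B → ℝ := simpleRoot s with hα
  set β := rep cs a α with hβ
  have hββ : cform M β β = 1 := ((isRoot_simpleRoot s).map_rep a).form_self
  have hαα : cform M α α = 1 := (isRoot_simpleRoot (cs := cs) s).form_self
  have hαP : α ∈ Submodule.span ℝ {α, β} := Submodule.subset_span (by simp)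
  have hβP : β ∈ Submodule.span ℝ {α, β} := Submodule.subset_span (by simp)
  have hsupp : Function.support v ⊆ c.supp := by
    intro i hi
    by_contra hic
    obtain ⟨y, z, hyz⟩ := Submodule.mem_span_pair.1 hvP
    apply hi
    have h3 : i ≠ s := fun h => hic (h ▸ hs)
    rw [← hyz, Pi.add_apply, Pi.smul_apply, Pi.smul_apply, hβ,
      rep_apply_of_notMem (hA.le ha) _ hic, hα, simpleRoot_of_ne h3]
    simp
  have hαv : cform M α v = 0 := hrad s hs
  have hfix : ∀ g ∈ A, rep cs g v = v := fun g hg => rep_eq_of_orthogonal (hA.le hg) hrad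
  have heq : Submodule.span ℝ {α, v} = Submodule.span ℝ {α, β} := by
    rw [Set.pair_comm]
    rw [Set.pair_comm α β, Set.pair_comm β α]
    refine span_pair_eq_of_mem hvP hαP hv0 fun μ h => ?_
    have := hαα
    rw [h] at this
    simp [hvv] at this
  rw [← heq] at hβP
  obtain ⟨x, z, hxz⟩ := Submodule.mem_span_pair.1 hβP
  have hx2 : x * x = 1 := by
    rw [← hxz] at hββ
    simpa [hαα, hvv, hαv, cform_symm M v α] using hββ
  have hz : z ≠ 0 := by
    rintro rfl
    rw [zero_smul, add_zero] at hxz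
    rcases mul_self_eq_one_iff.1 hx2 with h | h
    · exact h1 (by rw [← hxz, h, one_smul])
    · exact h2 (by rw [← hxz, h, neg_smul, one_smul])
  set r := cs.simple s * (a * cs.simple s * a⁻¹) with hr
  have hrA : r ∈ A := hA.mul_conj_mem hs ha
  set u : B → ℝ := (-2 * x * z) • v with hu
  have hrα : rep cs r α = α + u := by
    rw [hr, rep_simple_conj, ← hα, ← hβ, ← hxz]
    simp only [map_add, map_sub, map_smul, LinearMap.add_apply, LinearMap.smul_apply, smul_eq_mul,
      hαα, hαv, cform_symm M v α]
    have e : ∀ y : ℝ, y * x * x = y := fun y => by rw [mul_assoc, hx2, mul_one]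
    rw [hu]
    match_scalars
    · ring_nf
      linear_combination 2 * hx2
    · ring
  have hru : rep cs r u = u := by rw [hu, map_smul, hfix r hrA]
  have hpow : ∀ n : ℕ, rep cs (r ^ n) α = α + (n : ℝ) • u := by
    intro n
    induction n with
    | zero => simp
    | succ n ih =>
      rw [pow_succ', rep_mul, ih, map_add, map_smul, hru, hrα]
      push_cast
      module
  have hu0 : u ≠ 0 := by
    rw [hu]
    refine smul_ne_zero ?_ hv0
    have : x ≠ 0 := by rintro rfl; simp at hx2
    simp [this, hz]
  have husupp : Function.support u ⊆ c.supp := by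
    intro i hi
    apply hsupp
    intro h
    apply hi
    rw [hu, Pi.smul_apply, h, smul_zero]
  have hurad : ∀ t ∈ c.supp, cform M (simpleRoot t) u = 0 := fun t ht => by
    rw [hu, map_smul, hrad t ht, smul_zero]
  have hsign : 0 ≤ u ∨ 0 ≤ -u := by
    by_contra! hcon
    obtain ⟨hc1, hc2⟩ := hcon
    obtain ⟨i, hi⟩ := not_forall.1 (fun h => hc1 (Pi.le_def.2 h))
    obtain ⟨j, hj⟩ := not_forall.1 (fun h => hc2 (Pi.le_def.2 h))
    simp only [Pi.zero_apply, Pi.neg_apply, not_le, Left.neg_neg_iff] at hi hj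
    obtain ⟨n, hn⟩ := exists_nat_gt (α i / (-u i))
    rw [div_lt_iff₀ (by linarith)] at hn
    have hroot : IsRoot cs (α + ((n : ℝ) + 1) • u) := by
      have := (isRoot_simpleRoot (cs := cs) s).map_rep (r ^ (n + 1))
      rw [← hα, hpow] at this
      simpa using this
    have hneg := hroot.nonpos_of_neg_coord (i := i) (by
      simp only [Pi.add_apply, Pi.smul_apply, smul_eq_mul]
      linarith)
    have := hneg j
    simp only [Pi.add_apply, Pi.smul_apply, smul_eq_mul, Pi.zero_apply] at this
    have h3 : 0 ≤ α j := simpleRoot_nonneg s j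
    have h4 : 0 < ((n : ℝ) + 1) * u j := by positivity
    linarith
  rcases hsign with h | h
  · exact CoxeterPaper.posSemidefOn_of_radical h husupp hu0 hurad
  · refine CoxeterPaper.posSemidefOn_of_radical h ?_ (neg_ne_zero.2 hu0) ?_
    · rwa [Function.support_neg]
    · intro t ht
      rw [map_neg, hurad t ht, neg_zero]

/-- Commuting normal torsion-free subgroups of a non-affine infinite irreducible Coxeter group. -/
theorem eq_bot_or_eq_bot_of_commute (hX : ¬ PosSemidefOn M c.supp) (hA : IsTFNormal cs c A)
    (hA' : IsTFNormal cs c A') (hcomm : ∀ a ∈ A, ∀ b ∈ A', a * b = b * a) : A = ⊥ ∨ A' = ⊥ := by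
  by_contra! hne
  apply hX
  have hpl := hA.exists_plane hA' hcomm hne.1 hne.2
  choose! f hfA hf1 hf2 hfP using hpl
  set P : B → Submodule ℝ (B → ℝ) := fun s =>
    Submodule.span ℝ {simpleRoot s, rep cs (f s) (simpleRoot s)} with hP
  have hmem : ∀ s, simpleRoot s ∈ P s := fun s => Submodule.subset_span (by simp)
  obtain ⟨s₀, hs₀⟩ := c.nonempty_supp
  by_cases hall : ∀ s t, s ∈ c.supp → t ∈ c.supp → s ≠ t → formEntry M s t ≠ 0 → P s = P t
  · have h1 : ∀ t ∈ c.supp, P t = P s₀ :=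
      component_induction M hs₀ _ rfl fun s t hs ht hst h ih => by rw [← hall s t hs ht hst h, ih]
    obtain ⟨j, hj⟩ := subset_pair_of_mem_span (X := c.supp) hs₀
      (β := rep cs (f s₀) (simpleRoot s₀)) fun k hk => by
        have := hmem k
        rwa [h1 k hk] at this
    exact posSemidefOn_of_subset_pair hj
  · push Not at hall
    obtain ⟨i, j, hi, hj, -, hij, hPij⟩ := hall
    obtain ⟨v, hvi, hvj, hv0, hvv, hiv, hjv⟩ := hA.exists_isotropic hi hj hij (hfA i hi)
      (hfA j hj) (hf1 i hi) (hf2 i hi) (hf1 j hj) (hf2 j hj) rfl rfl (hfP i hi) (hfP j hj) hPij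
    have hbasis : ∀ k ∈ c.supp, ∀ w ∈ P k, w ≠ 0 → cform M w w = 0 →
        Submodule.span ℝ {simpleRoot k, w} = P k := by
      intro k hk w hw hw0 hww
      rw [Set.pair_comm]
      refine span_pair_eq_of_mem hw (hmem k) hw0 fun μ h => ?_
      have := (isRoot_simpleRoot (cs := cs) k).form_self
      rw [h] at this
      simp [hww] at this
    have hQ : ∀ k ∈ c.supp, v ∈ P k ∧ cform M (simpleRoot k) v = 0 := by
      refine component_induction M hi _ ⟨hvi, hiv⟩ ?_
      rintro k l hk hl - hkl ⟨ih1, ih2⟩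
      by_cases hPkl : P k = P l
      · refine ⟨hPkl ▸ ih1, ?_⟩
        have h3 : simpleRoot l ∈ Submodule.span ℝ {simpleRoot k, v} := by
          rw [hbasis k hk v ih1 hv0 hvv, hPkl]
          exact hmem l
        obtain ⟨y, z, hyz⟩ := Submodule.mem_span_pair.1 h3
        rw [← hyz]
        simp [ih2, hvv]
      · obtain ⟨w, hwk, hwl, hw0, hww, hkw, hlw⟩ := hA.exists_isotropic hk hl hkl (hfA k hk)
          (hfA l hl) (hf1 k hk) (hf2 k hk) (hf1 l hl) (hf2 l hl) rfl rfl (hfP k hk) (hfP l hl) hPkl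
        have h3 : v ∈ Submodule.span ℝ {simpleRoot k, w} := by
          rw [hbasis k hk w hwk hw0 hww]
          exact ih1
        obtain ⟨y, z, hyz⟩ := Submodule.mem_span_pair.1 h3
        have hy : y = 0 := by
          rw [← hyz, map_add, map_smul, map_smul, hkw, cform_simpleRoot, formEntry_self] at ih2
          simpa using ih2
        rw [← hyz, hy, zero_smul, zero_add]
        exact ⟨Submodule.smul_mem _ _ hwl, by rw [map_smul, hlw, smul_zero]⟩
    exact hA.posSemidefOn_of_radical hi (hfA i hi) (hf1 i hi) (hf2 i hi) hvi hv0 hvv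
      fun t ht => (hQ t ht).2

end CommutingPair

section OrderedGroup

variable {G : Type*} [Group G] {le : G → G → Prop}

theorem exists_generator_of_order (hinv : ∀ k g h, le g h → le (k * g) (k * h))
    (htot : ∀ g h, le g h ∨ le h g) (hanti : ∀ g h, le g h → le h g → g = h)
    (htrans : ∀ g h k, le g h → le h k → le g k) (hfin : ∀ g, {h | le 1 h ∧ le h g}.Finite) :
    ∃ t : G, ∀ h, h ∈ Subgroup.zpowers t := by
  by_cases htriv : ∀ g : G, g = 1
  · exact ⟨1, fun h => by rw [htriv h]; exact one_mem _⟩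
  push Not at htriv
  have hrefl : ∀ g, le g g := fun g => (htot g g).elim id id
  have hinv1 : ∀ g, le g 1 → le 1 g⁻¹ := fun g hg => by simpa using hinv g⁻¹ g 1 hg
  obtain ⟨g, hg1, hg⟩ : ∃ g : G, g ≠ 1 ∧ le 1 g := by
    obtain ⟨g, hg⟩ := htriv
    rcases htot 1 g with h | h
    · exact ⟨g, hg, h⟩
    · exact ⟨g⁻¹, inv_ne_one.2 hg, hinv1 g h⟩
  obtain ⟨t, ⟨ht1, ht⟩, hmin⟩ : ∃ t : G, (t ≠ 1 ∧ le 1 t) ∧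
      ∀ x, (x ≠ 1 ∧ le 1 x) → {h | le 1 h ∧ le h t}.ncard ≤ {h | le 1 h ∧ le h x}.ncard :=
    exists_minimalFor_of_wellFoundedLT (fun x : G => x ≠ 1 ∧ le 1 x)
      (fun x => {h | le 1 h ∧ le h x}.ncard) ⟨g, hg1, hg⟩ |>.imp fun t h =>
        ⟨h.1, fun x hx => (le_total _ _).elim id fun h' => h.2 hx h'⟩
  have hstep : ∀ x, x ≠ 1 → le 1 x → le t x := by
    intro x hx1 hx
    rcases htot t x with h | h
    · exact h
    · have hsub : {h | le 1 h ∧ le h x} ⊆ {h | le 1 h ∧ le h t} := fun y hy =>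
        ⟨hy.1, htrans _ _ _ hy.2 h⟩
      have heq := Set.eq_of_subset_of_ncard_le hsub (hmin x ⟨hx1, hx⟩) (hfin t)
      have : t ∈ {h | le 1 h ∧ le h x} := by rw [heq]; exact ⟨ht, hrefl t⟩
      exact this.2
  have hpos : ∀ n : ℕ, ∀ h, le 1 h → {x | le 1 x ∧ le x h}.ncard ≤ n →
      h ∈ Subgroup.zpowers t := by
    intro n
    induction n with
    | zero =>
      intro h h1 hc
      have := (Set.ncard_eq_zero (hfin h)).1 (Nat.le_zero.1 hc)
      exact absurd (show h ∈ {x | le 1 x ∧ le x h} from ⟨h1, hrefl h⟩) (by rw [this]; exact id)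
    | succ n ih =>
      intro h h1 hc
      by_cases hh : h = 1
      · rw [hh]; exact one_mem _
      have h2 : le 1 (t⁻¹ * h) := by simpa using hinv t⁻¹ _ _ (hstep h hh h1)
      have h3 : {x | le 1 x ∧ le x (t⁻¹ * h)}.ncard < {x | le 1 x ∧ le x h}.ncard := by
        rw [← Set.ncard_image_of_injective _ (mul_right_injective t)]
        refine Set.ncard_lt_ncard (Set.ssubset_iff_subset_ne.2 ⟨?_, ?_⟩) (hfin h)
        · rintro _ ⟨x, ⟨hx1, hx2⟩, rfl⟩
          exact ⟨htrans _ _ _ ht (by simpa using hinv t _ _ hx1), by simpa using hinv t _ _ hx2⟩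
        · intro heq
          have : (1 : G) ∈ {x | le 1 x ∧ le x h} := ⟨hrefl 1, h1⟩
          rw [← heq] at this
          obtain ⟨x, ⟨hx1, -⟩, hx⟩ := this
          exact ht1 (hanti _ _ (by simpa [hx] using hinv t _ _ hx1) ht)
      have h4 := ih (t⁻¹ * h) h2 (by omega)
      simpa using mul_mem (Subgroup.mem_zpowers t) h4
  refine ⟨t, fun h => ?_⟩
  rcases htot 1 h with h1 | h1
  · exact hpos _ h h1 le_rfl
  · exact inv_mem_iff.1 (hpos _ h⁻¹ (hinv1 h h1) le_rfl)

theorem commute_of_order (hinv : ∀ k g h, le g h → le (k * g) (k * h))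
    (htot : ∀ g h, le g h ∨ le h g) (hanti : ∀ g h, le g h → le h g → g = h)
    (htrans : ∀ g h k, le g h → le h k → le g k) (hfin : ∀ g, {h | le 1 h ∧ le h g}.Finite)
    (x y : G) : x * y = y * x := by
  obtain ⟨t, ht⟩ := exists_generator_of_order hinv htot hanti htrans hfin
  obtain ⟨m, rfl⟩ := ht x
  obtain ⟨n, rfl⟩ := ht y
  exact (Commute.refl t).zpow_zpow m n

end OrderedGroup

section SignChange

variable {B : Type*} {β : ℕ → B → ℝ} {k : ℝ}

theorem nonpos_of_sign_change (hk : 1 ≤ k) (hrec : ∀ n, β (n + 2) + β n = (2 * k) • β (n + 1))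
    (n : ℕ) (h0 : 0 ≤ β n) (h1 : β (n + 1) ≤ 0) (m : ℕ) :
    β (n + 1 + m) ≤ 0 := by
  suffices h : β (n + 1 + m) ≤ 0 ∧ β (n + 1 + m) ≤ β (n + m) from h.1
  induction m with
  | zero => exact ⟨h1, h1.trans h0⟩
  | succ m ih =>
    obtain ⟨ih1, ih2⟩ := ih
    rw [show n + 1 + m = n + m + 1 by ring] at ih1 ih2
    rw [show n + 1 + (m + 1) = n + m + 2 by ring, show n + (m + 1) = n + m + 1 by ring]
    have key : ∀ i, β (n + m + 2) i ≤ β (n + m + 1) i := by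
      intro i
      have h2 := congrFun (hrec (n + m)) i
      simp only [Pi.add_apply, Pi.smul_apply, smul_eq_mul] at h2
      have h3 : β (n + m + 1) i ≤ 0 := ih1 i
      have h4 : β (n + m + 1) i ≤ β (n + m) i := ih2 i
      nlinarith
    exact ⟨fun i => (key i).trans (ih1 i), key⟩

theorem eventually_sign (hk : 1 ≤ k) (hrec : ∀ n, β (n + 2) + β n = (2 * k) • β (n + 1))
    (hβ : ∀ n, 0 ≤ β n ∨ β n ≤ 0) :
    ∃ N, (∀ n, 0 ≤ β (N + n)) ∨ ∀ n, β (N + n) ≤ 0 := by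
  by_cases h : ∃ n, 0 ≤ β n ∧ β (n + 1) ≤ 0
  · obtain ⟨n, h0, h1⟩ := h
    exact ⟨n + 1, Or.inr (nonpos_of_sign_change hk hrec n h0 h1)⟩
  push Not at h
  by_cases h2 : ∀ n, β n ≤ 0
  · exact ⟨0, Or.inr fun n => h2 _⟩
  push Not at h2
  obtain ⟨N, hN⟩ := h2
  refine ⟨N, Or.inl fun n => ?_⟩
  induction n with
  | zero => exact (hβ N).resolve_right hN
  | succ n ih => exact (hβ (N + n + 1)).resolve_right (h _ ih)

end SignChange

section Swap

variable {B : Type*} [Fintype B] {M : CoxeterMatrix B} {W : Type*} [Group W]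
  {cs : CoxeterSystem M W} {D : Subgroup W} {s : B}

/-- A torsion-free subgroup commuting with its conjugate by a simple reflection `s` and meeting it
trivially. -/
structure IsSwapped (cs : CoxeterSystem M W) (s : B) (D : Subgroup W) : Prop where
  comm : ∀ u ∈ D, ∀ v ∈ D, u * (cs.simple s * v * cs.simple s) = (cs.simple s * v * cs.simple s) * u
  disjoint : ∀ u ∈ D, cs.simple s * u * cs.simple s ∈ D → u = 1
  eq_one : ∀ u ∈ D, IsOfFinOrder u → u = 1
  simple_mul_conj_eq_one : ∀ u ∈ D, IsOfFinOrder (cs.simple s * u * cs.simple s * u⁻¹) →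
    cs.simple s * u * cs.simple s * u⁻¹ = 1

theorem IsSwapped.eq_one_of_rep (hD : IsSwapped cs s D) {u : W} (hu : u ∈ D)
    (h : rep cs u (simpleRoot s) = simpleRoot s ∨ rep cs u (simpleRoot s) = -simpleRoot s) :
    u = 1 := by
  have h1 := conj_eq_simple h
  refine hD.disjoint u hu ?_
  have : cs.simple s * u * cs.simple s = u := by
    rw [mul_inv_eq_iff_eq_mul] at h1
    rw [mul_assoc, h1, ← mul_assoc, cs.simple_mul_simple_self, one_mul]
  rwa [this]

theorem IsSwapped.one_le_abs_form (hD : IsSwapped cs s D) {u : W} (hu : u ∈ D) (hu1 : u ≠ 1) :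
    1 ≤ |cform M (simpleRoot s) (rep cs u (simpleRoot s))| := by
  by_contra! h
  have h1 : IsOfFinOrder (cs.simple s * (u * cs.simple s * u⁻¹)) := by
    have := isOfFinOrder_of_form_lt_one (cs := cs) (w := 1) (w' := u) (s := s) (t := s)
      (by rwa [rep_one])
    simpa using this
  have h2 : cs.simple s * u * cs.simple s * u⁻¹ = cs.simple s * (u * cs.simple s * u⁻¹) := by
    simp only [mul_assoc]
  rw [← h2] at h1
  have h3 := hD.simple_mul_conj_eq_one u hu h1
  rw [mul_inv_eq_one] at h3
  exact hu1 (hD.disjoint u hu (by rwa [h3]))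

theorem IsSwapped.rep_add_rep_inv (hD : IsSwapped cs s D) {u : W} (hu : u ∈ D) :
    rep cs u (simpleRoot s) + rep cs u⁻¹ (simpleRoot s) =
      (2 * cform M (simpleRoot s) (rep cs u (simpleRoot s))) • simpleRoot s := by
  by_cases hu1 : u = 1
  · rw [hu1, inv_one, rep_one, cform_simpleRoot, formEntry_self]
    module
  set c := cform M (simpleRoot s) (rep cs u (simpleRoot s)) with hc
  have hc0 : c ≠ 0 := by
    intro h
    have := hD.one_le_abs_form hu hu1
    rw [← hc, h, abs_zero] at this
    linarith
  have h1 := rep_simple_conj (cs := cs) u s (simpleRoot s)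
  have h2 : cs.simple s * (u * cs.simple s * u⁻¹) = u⁻¹ * (cs.simple s * (u * cs.simple s)) := by
    have := hD.comm _ (inv_mem hu) u hu
    simp only [mul_assoc] at this ⊢
    exact this.symm
  rw [h2, rep_mul, rep_mul, rep_mul, rep_simple_self, map_neg, map_neg, rep_simple, map_neg,
    map_sub, rep_inv_rep, map_smul, ← hc, map_sub, map_smul, ← hc, cform_symm M _ (simpleRoot s),
    ← hc, cform_simpleRoot, formEntry_self] at h1
  have h3 : (2 * c) • (rep cs u (simpleRoot s) + rep cs u⁻¹ (simpleRoot s)) =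
      (2 * c) • ((2 * c) • simpleRoot s) := by
    rw [← sub_eq_zero] at h1 ⊢
    rw [← h1]
    simp only [smul_eq_mul]
    module
  exact smul_right_injective _ (mul_ne_zero two_ne_zero hc0) h3

theorem IsSwapped.rep_recurrence (hD : IsSwapped cs s D) {u : W} (hu : u ∈ D) (w : W) (n : ℕ) :
    rep cs (w * u ^ (n + 2)) (simpleRoot s) + rep cs (w * u ^ n) (simpleRoot s) =
      (2 * cform M (simpleRoot s) (rep cs u (simpleRoot s))) •
        rep cs (w * u ^ (n + 1)) (simpleRoot s) := by
  rw [← map_smul, ← hD.rep_add_rep_inv hu, map_add, ← rep_mul, ← rep_mul]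
  congr 3
  · rw [mul_assoc, ← pow_succ]
  · rw [pow_succ]; group

theorem IsSwapped.eq_of_rep (hD : IsSwapped cs s D) {u v : W} (hu : u ∈ D) (hv : v ∈ D)
    (h : rep cs u (simpleRoot s) = rep cs v (simpleRoot s) ∨
      rep cs u (simpleRoot s) = -rep cs v (simpleRoot s)) : u = v := by
  have : v⁻¹ * u = 1 := by
    refine hD.eq_one_of_rep (mul_mem (inv_mem hv) hu) ?_
    rw [rep_mul]
    rcases h with h | h
    · left; rw [h, rep_inv_rep]
    · right; rw [h, map_neg, rep_inv_rep]
  rw [inv_mul_eq_one] at this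
  exact this.symm

omit [Fintype B] in
theorem IsSwapped.pow_injective (hD : IsSwapped cs s D) {u : W} (hu : u ∈ D) (hu1 : u ≠ 1) :
    Function.Injective fun n : ℕ => u ^ n :=
  injective_pow_iff_not_isOfFinOrder.2 fun h => hu1 (hD.eq_one u hu h)

/-- A group element inverts only finitely many of the roots in an orbit of a swapped subgroup. -/
theorem IsSwapped.not_inverts_forall (hD : IsSwapped cs s D) {u : W} (hu : u ∈ D) (hu1 : u ≠ 1)
    (w w' : W) (N : ℕ) (h : ∀ n, 0 ≤ rep cs (w * u ^ (N + n)) (simpleRoot s))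
    (h' : ∀ n, rep cs (w' * u ^ (N + n)) (simpleRoot s) ≤ 0) : False := by
  have hfin := finite_inversions (cs := cs) (w' * w⁻¹)
  have hinj : Function.Injective fun n : ℕ => rep cs (w * u ^ (N + n)) (simpleRoot s) := by
    intro n m hnm
    have h2 : rep cs (u ^ (N + n)) (simpleRoot s) = rep cs (u ^ (N + m)) (simpleRoot s) := by
      have := congrArg (rep cs w⁻¹) hnm
      simpa only [rep_mul, rep_inv_rep] using this
    have h3 := hD.eq_of_rep (pow_mem hu _) (pow_mem hu _) (Or.inl h2)
    have := hD.pow_injective hu hu1 h3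
    omega
  refine Set.infinite_range_of_injective hinj (hfin.subset ?_)
  rintro _ ⟨n, rfl⟩
  refine ⟨(isRoot_simpleRoot s).map_rep _, h n, ?_⟩
  rw [← rep_mul, ← mul_assoc, inv_mul_cancel_right]
  exact h' n

theorem IsSwapped.one_le_form (hD : IsSwapped cs s D) {u : W} (hu : u ∈ D) :
    1 ≤ cform M (simpleRoot s) (rep cs u (simpleRoot s)) := by
  by_cases hu1 : u = 1
  · rw [hu1, rep_one, cform_simpleRoot, formEntry_self]
  rcases le_abs.1 (hD.one_le_abs_form hu hu1) with h | h
  · exact h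
  exfalso
  set c := cform M (simpleRoot s) (rep cs u (simpleRoot s)) with hc
  have hfin := finite_inversions (cs := cs) u
  set β : ℕ → B → ℝ := fun n => ((-1 : ℝ) ^ n) • rep cs (1 * u ^ n) (simpleRoot s) with hβ
  have hroot : ∀ n, IsRoot cs (β n) := by
    intro n
    have := (isRoot_simpleRoot (cs := cs) s).map_rep (1 * u ^ n)
    rcases neg_one_pow_eq_or ℝ n with h1 | h1
    · simpa only [hβ, h1, one_smul] using this
    · simpa only [hβ, h1, neg_smul, one_smul] using this.neg
  have hrec : ∀ n, β (n + 2) + β n = (2 * (-c)) • β (n + 1) := by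
    intro n
    have := congrArg (fun x => ((-1 : ℝ) ^ n) • x) (hD.rep_recurrence hu 1 n)
    simp only [← hc] at this
    simp only [hβ, pow_add, pow_one, neg_one_sq, mul_one]
    rw [smul_add] at this
    simp only [pow_add, pow_one] at this
    rw [this]
    module
  have hinj : Function.Injective β := by
    intro n m hnm
    refine hD.pow_injective hu hu1 (hD.eq_of_rep (pow_mem hu n) (pow_mem hu m) ?_)
    simp only [hβ, one_mul] at hnm
    rcases neg_one_pow_eq_or ℝ n with h1 | h1 <;> rcases neg_one_pow_eq_or ℝ m with h2 | h2 <;>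
      simp only [h1, h2, one_smul, neg_smul, neg_inj] at hnm
    · exact Or.inl hnm
    · exact Or.inr hnm
    · exact Or.inr (neg_eq_iff_eq_neg.1 hnm)
    · exact Or.inl hnm
  have hu : ∀ n, rep cs u (β n) = -β (n + 1) := by
    intro n
    simp only [hβ, map_smul, ← rep_mul, one_mul, ← pow_succ', pow_succ (-1 : ℝ)]
    module
  obtain ⟨N, hN⟩ := eventually_sign h hrec fun n => (hroot n).nonneg_or_nonpos
  rcases hN with hN | hN
  · refine Set.infinite_range_of_injective (hinj.comp (add_right_injective N)) (hfin.subset ?_)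
    rintro _ ⟨n, rfl⟩
    refine ⟨hroot _, hN n, ?_⟩
    rw [Function.comp_apply, hu]
    exact neg_nonpos.2 (hN (n + 1))
  · refine Set.infinite_range_of_injective
      (neg_injective.comp (hinj.comp (add_right_injective N))) (hfin.subset ?_)
    rintro _ ⟨n, rfl⟩
    refine ⟨(hroot _).neg, neg_nonneg.2 (hN n), ?_⟩
    rw [Function.comp_apply, Function.comp_apply, map_neg, hu, neg_neg]
    exact hN (n + 1)

/-- The order on a swapped subgroup given by inclusion of the corresponding half-spaces. -/
def halfSpaceLE (cs : CoxeterSystem M W) (s : B) (g h : W) : Prop :=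
  ∀ w, 0 ≤ rep cs (w * g) (simpleRoot s) → 0 ≤ rep cs (w * h) (simpleRoot s)

theorem IsSwapped.halfSpaceLE_total (hD : IsSwapped cs s D) {u : W} (hu : u ∈ D) :
    halfSpaceLE cs s 1 u ∨ halfSpaceLE cs s u 1 := by
  by_cases hu1 : u = 1
  · rw [hu1]; exact Or.inl fun w => id
  by_contra! hcon
  unfold halfSpaceLE at hcon
  push Not at hcon
  obtain ⟨⟨w, h1, h2⟩, w', h3, h4⟩ := hcon
  rw [mul_one] at h1 h4
  have h2' := ((isRoot_simpleRoot (cs := cs) s).map_rep (w * u)).nonneg_or_nonpos.resolve_left h2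
  have h4' := ((isRoot_simpleRoot (cs := cs) s).map_rep w').nonneg_or_nonpos.resolve_left h4
  have hc := hD.one_le_form hu
  refine hD.not_inverts_forall hu hu1 w' w 1 (fun n => ?_) (fun n => ?_)
  · have := nonpos_of_sign_change (β := fun n => -rep cs (w' * u ^ n) (simpleRoot s)) hc
      (fun n => by rw [smul_neg, ← hD.rep_recurrence hu w' n]; abel) 0
      (by simpa using h4') (by simpa using h3) n
    rw [zero_add] at this
    exact neg_nonpos.1 this
  · have := nonpos_of_sign_change (β := fun n => rep cs (w * u ^ n) (simpleRoot s)) hc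
      (fun n => hD.rep_recurrence hu w n) 0 (by simpa using h1) (by simpa using h2') n
    rwa [zero_add] at this

theorem IsSwapped.commute (hD : IsSwapped cs s D) {u v : W} (hu : u ∈ D) (hv : v ∈ D) :
    u * v = v * u := by
  have hpos1 : (0 : B → ℝ) ≤ rep cs 1 (simpleRoot s) := by
    rw [rep_one]; exact simpleRoot_nonneg s
  have hle1 : ∀ {h : W}, halfSpaceLE cs s 1 h → 0 ≤ rep cs h (simpleRoot s) := by
    intro h hh
    have := hh 1 (by rwa [one_mul])
    rwa [one_mul] at this
  have hinv : ∀ k g h : W, halfSpaceLE cs s g h → halfSpaceLE cs s (k * g) (k * h) := by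
    intro k g h hgh w hw
    rw [← mul_assoc] at hw ⊢
    exact hgh _ hw
  have hanti : ∀ h ∈ D, halfSpaceLE cs s 1 h → halfSpaceLE cs s h 1 → h = 1 := by
    intro h hh h1 h2
    refine hD.eq_one_of_rep hh (Or.inl ?_)
    refine ((isRoot_simpleRoot s).map_rep h).eq_simpleRoot_of_inversion (hle1 h1) ?_
    by_contra h3
    have h4 := ((isRoot_simpleRoot (cs := cs) s).map_rep (cs.simple s * h)).nonneg_or_nonpos
    rw [rep_mul] at h4
    have h5 := h2 (cs.simple s) (by rw [rep_mul]; exact h4.resolve_right h3)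
    rw [mul_one, rep_simple_self] at h5
    exact (isRoot_simpleRoot (cs := cs) s).not_nonneg_and_nonpos (simpleRoot_nonneg s)
      (neg_nonneg.1 h5)
  have key := commute_of_order (G := D) (le := fun g h => halfSpaceLE cs s g h)
    (fun k g h hgh => hinv k g h hgh)
    (fun g h => by
      have := hD.halfSpaceLE_total (mul_mem (inv_mem g.2) h.2)
      refine this.imp (fun h1 => ?_) (fun h1 => ?_)
      · simpa using hinv g _ _ h1
      · simpa using hinv g _ _ h1)
    (fun g h hgh hhg => by
      have h1 := hanti (g⁻¹ * h : W) (mul_mem (inv_mem g.2) h.2)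
        (by simpa using hinv (g : W)⁻¹ _ _ hgh) (by simpa using hinv (g : W)⁻¹ _ _ hhg)
      exact Subtype.ext (inv_mul_eq_one.1 h1))
    (fun g h k hgh hhk w hw => hhk w (hgh w hw))
    (fun g => by
      have hfin := finite_inversions (cs := cs) (cs.simple s * (g : W)⁻¹)
      refine Set.Finite.of_finite_image (f := fun h : D => rep cs (h : W) (simpleRoot s))
        (hfin.subset ?_) ?_
      · rintro _ ⟨h, ⟨h1, h2⟩, rfl⟩
        refine ⟨(isRoot_simpleRoot s).map_rep _, hle1 h1, ?_⟩
        have h3 := ((isRoot_simpleRoot (cs := cs) s).map_rep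
          (cs.simple s * (g : W)⁻¹ * h)).nonneg_or_nonpos
        rw [← rep_mul]
        refine h3.resolve_left fun h4 => ?_
        have h5 := h2 _ h4
        rw [inv_mul_cancel_right, rep_simple_self] at h5
        exact (isRoot_simpleRoot (cs := cs) s).not_nonneg_and_nonpos (simpleRoot_nonneg s)
          (neg_nonneg.1 h5)
      · intro h _ h' _ hh
        exact Subtype.ext (hD.eq_of_rep h.2 h'.2 (Or.inl hh)))
  exact congrArg Subtype.val (key ⟨u, hu⟩ ⟨v, hv⟩)

end Swap

section Combination

open scoped Pointwise

variable {G : Type*} [Group G]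

theorem mem_conj_smul {D : Subgroup G} {g x : G} : x ∈ MulAut.conj g • D ↔ g⁻¹ * x * g ∈ D := by
  rw [Subgroup.mem_pointwise_smul_iff_inv_smul_mem, ← map_inv, MulAut.smul_def, MulAut.conj_apply,
    inv_inv]

theorem conj_mul_mem_conj_smul {D : Subgroup G} {g x : G} (hx : x ∈ D) :
    g * x * g⁻¹ ∈ MulAut.conj g • D := by
  rw [mem_conj_smul]
  simpa [mul_assoc] using hx

/-- The nontrivial intersections of conjugates of a subgroup have a minimal element. -/
theorem exists_minimal_inf_conj {N B : Subgroup G} [hN : N.FiniteIndex]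
    (hNorm : ∀ n ∈ N, ∀ x ∈ B, n * x * n⁻¹ ∈ B) (hB : B ≠ ⊥) :
    ∃ D : Subgroup G, D ≠ ⊥ ∧ (∃ I : Set G, I.Nonempty ∧ D = ⨅ g ∈ I, MulAut.conj g • B) ∧
      ∀ g : G, D ⊓ MulAut.conj g • D = ⊥ ∨ MulAut.conj g • D = D := by
  set f : Set G → Subgroup G := fun I => ⨅ g ∈ I, MulAut.conj g • B with hf
  set F : Set (Subgroup G) := f '' {I | I.Nonempty} with hF
  have hmem : ∀ I x, x ∈ f I ↔ ∀ g ∈ I, g⁻¹ * x * g ∈ B := by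
    intro I x
    simp only [hf, Subgroup.mem_iInf, mem_conj_smul]
  have hfin : F.Finite := by
    have hconj : (Set.range fun g : G => MulAut.conj g • B).Finite := by
      have h1 : ∀ a b : G, a⁻¹ * b ∈ N → MulAut.conj a • B = MulAut.conj b • B := by
        intro a b hab
        ext x
        rw [mem_conj_smul, mem_conj_smul]
        constructor
        · intro h
          have := hNorm _ (inv_mem hab) _ h
          simpa [mul_assoc] using this
        · intro h
          have := hNorm _ hab _ h
          simpa [mul_assoc] using this
      have h2 : (Set.range fun q : G ⧸ N => Quotient.liftOn' q (fun g : G => MulAut.conj g • B)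
          fun a b hab => h1 a b (QuotientGroup.leftRel_apply.1 hab)).Finite := Set.finite_range _
      refine h2.subset ?_
      rintro _ ⟨g, rfl⟩
      exact ⟨(g : G ⧸ N), rfl⟩
    refine (hconj.finite_subsets.image sInf).subset ?_
    rintro _ ⟨I, -, rfl⟩
    refine ⟨(fun g : G => MulAut.conj g • B) '' I, Set.image_subset_range _ _, ?_⟩
    rw [sInf_image]
  have hBF : B ∈ F := ⟨{1}, ⟨1, rfl⟩, by ext x; rw [hmem]; simp⟩
  obtain ⟨D, ⟨hDF, hD0⟩, hmin⟩ : ∃ D, Minimal (fun D => D ∈ F ∧ D ≠ ⊥) D :=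
    (hfin.subset (fun D hD => hD.1 : {D | D ∈ F ∧ D ≠ ⊥} ⊆ F)).exists_minimal ⟨B, hBF, hB⟩
  have hinf : ∀ D ∈ F, ∀ E ∈ F, D ⊓ E ∈ F := by
    rintro _ ⟨I, hI, rfl⟩ _ ⟨J, hJ, rfl⟩
    refine ⟨I ∪ J, hI.mono Set.subset_union_left, ?_⟩
    ext x
    simp only [hmem, Subgroup.mem_inf, Set.mem_union, or_imp, forall_and]
  have hconj : ∀ g : G, ∀ D ∈ F, MulAut.conj g • D ∈ F := by
    rintro g _ ⟨I, hI, rfl⟩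
    refine ⟨(g * ·) '' I, hI.image _, ?_⟩
    ext x
    rw [mem_conj_smul, hmem, hmem]
    simp only [Set.forall_mem_image]
    exact forall₂_congr fun k _ => by rw [mul_inv_rev]; simp only [mul_assoc]
  have hne : ∀ g : G, MulAut.conj g • D ≠ ⊥ := fun g h => hD0 (by
    rw [← Subgroup.smul_bot (MulAut.conj g)] at h
    exact smul_left_cancel _ h)
  have hle : ∀ g : G, D ⊓ MulAut.conj g • D ≠ ⊥ → D ≤ MulAut.conj g • D := fun g h =>
    (hmin ⟨hinf _ hDF _ (hconj g _ hDF), h⟩ inf_le_left).trans inf_le_right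
  refine ⟨D, hD0, ?_, fun g => ?_⟩
  · obtain ⟨I, hI, rfl⟩ := hDF
    exact ⟨I, hI, rfl⟩
  · by_cases h : D ⊓ MulAut.conj g • D = ⊥
    · exact Or.inl h
    · right
      have h1 := hle g h
      have h2 : MulAut.conj g⁻¹ • D ≤ D := by
        intro x hx
        rw [mem_conj_smul] at hx
        have := h1 hx
        rw [mem_conj_smul] at this
        simpa [mul_assoc] using this
      have h3 := hmin ⟨hconj g⁻¹ _ hDF, hne _⟩ h2
      refine le_antisymm (fun x hx => ?_) h1
      rw [mem_conj_smul] at hx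
      have := h3 hx
      rw [mem_conj_smul] at this
      simpa [mul_assoc] using this

theorem commute_of_mem_closure {S : Set G} (hS : ∀ x ∈ S, ∀ y ∈ S, x * y = y * x) {x y : G}
    (hx : x ∈ Subgroup.closure S) (hy : y ∈ Subgroup.closure S) : x * y = y * x := by
  have h1 : Subgroup.closure S ≤ Subgroup.centralizer S :=
    (Subgroup.closure_le _).2 fun x hx y hy => hS y hy x hx
  have h2 : Subgroup.closure S ≤ Subgroup.centralizer (Subgroup.closure S : Set G) :=
    (Subgroup.closure_le _).2 fun y hy x hx => (h1 hx y hy).symm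
  exact (h2 hx y hy).symm

theorem inf_ne_bot_of_torsionFree {B N : Subgroup G} [hN : N.FiniteIndex]
    (htf : ∀ x ∈ B, IsOfFinOrder x → x = 1) (hB : B ≠ ⊥) : B ⊓ N ≠ ⊥ := by
  intro h
  refine hB ((Subgroup.eq_bot_iff_forall _).2 fun x hx => htf x hx ?_)
  obtain ⟨n, hn, -, hxn⟩ := Subgroup.exists_pow_mem_of_index_ne_zero hN.index_ne_zero x
  have : x ^ n ∈ B ⊓ N := ⟨pow_mem hx n, hxn⟩
  rw [h, Subgroup.mem_bot] at this
  exact isOfFinOrder_iff_pow_eq_one.2 ⟨n, hn, this⟩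

theorem eq_bot_or_eq_bot_of_finiteIndex {S : Set G} (hS : Subgroup.closure S = ⊤) {K : Subgroup G}
    (hKn : K.Normal) (hKf : K.FiniteIndex) (hK : ∀ x ∈ K, IsOfFinOrder x → x = 1)
    (hnormal : ∀ A B : Subgroup G, A.Normal → B.Normal → A ≤ K → B ≤ K →
      (∀ a ∈ A, ∀ b ∈ B, a * b = b * a) → A = ⊥ ∨ B = ⊥)
    (hswap : ∀ s ∈ S, ∀ D ≤ K, (∀ u ∈ D, ∀ v ∈ D, u * (s * v * s⁻¹) = (s * v * s⁻¹) * u) →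
      (∀ u ∈ D, s * u * s⁻¹ ∈ D → u = 1) → ∀ u ∈ D, ∀ v ∈ D, u * v = v * u)
    {H A B : Subgroup G} (hH : H.FiniteIndex) (hA : A ≤ K) (hB : B ≤ K)
    (hBH : ∀ h ∈ H, ∀ x ∈ B, h * x * h⁻¹ ∈ B) (hAB : ∀ a ∈ A, ∀ b ∈ B, a * b = b * a) :
    A = ⊥ ∨ B = ⊥ := by
  by_contra! hne
  obtain ⟨hA0, hB0⟩ := hne
  set N := H.normalCore ⊓ K with hN
  have hNK : N ≤ K := inf_le_right
  have hNn : N.Normal := inferInstance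
  have hNf : N.FiniteIndex := inferInstance
  have hBN0 : B ⊓ N ≠ ⊥ := inf_ne_bot_of_torsionFree (fun x hx => hK x (hB hx)) hB0
  have hBN : ∀ n ∈ N, ∀ x ∈ B ⊓ N, n * x * n⁻¹ ∈ B ⊓ N := fun n hn x hx =>
    ⟨hBH n (H.normalCore_le hn.1) x hx.1, hNn.conj_mem x hx.2 n⟩
  obtain ⟨D, hD0, ⟨I, ⟨g₀, hg₀⟩, hI⟩, hDg⟩ := exists_minimal_inf_conj hBN hBN0
  have hmem : ∀ x, x ∈ D ↔ ∀ g ∈ I, g⁻¹ * x * g ∈ B ⊓ N := by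
    intro x
    rw [hI]
    simp only [Subgroup.mem_iInf, mem_conj_smul]
  have hDN : D ≤ N := fun x hx => by
    have := hNn.conj_mem _ ((hmem x).1 hx g₀ hg₀).2 g₀
    simpa [mul_assoc] using this
  have hDnorm : ∀ n ∈ N, ∀ x ∈ D, n * x * n⁻¹ ∈ D := by
    intro n hn x hx
    rw [hmem] at hx ⊢
    intro g hg
    have := hBN _ (hNn.conj_mem n hn g⁻¹) _ (hx g hg)
    simpa [mul_assoc] using this
  have hcommconj : ∀ g : G, D ⊓ MulAut.conj g • D = ⊥ → ∀ u ∈ D, ∀ v ∈ MulAut.conj g • D,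
      u * v = v * u := by
    intro g hg u hu v hv
    rw [mem_conj_smul] at hv
    have hvN : v ∈ N := by
      have := hNn.conj_mem _ (hDN hv) g
      simpa [mul_assoc] using this
    have h1 : u * v * u⁻¹ * v⁻¹ ∈ D ⊓ MulAut.conj g • D := by
      refine Subgroup.mem_inf.2 ⟨?_, ?_⟩
      · have := mul_mem hu (hDnorm v hvN _ (inv_mem hu))
        simpa [mul_assoc] using this
      · refine mul_mem ?_ ?_
        · rw [mem_conj_smul]
          have := hDnorm _ (hNn.conj_mem u (hDN hu) g⁻¹) _ hv
          simpa [mul_assoc] using this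
        · rw [inv_mem_iff, mem_conj_smul]
          exact hv
    rw [hg, Subgroup.mem_bot] at h1
    rw [mul_inv_eq_one, mul_inv_eq_iff_eq_mul] at h1
    exact h1
  by_cases hall : ∀ s ∈ S, MulAut.conj s • D = D
  · have hstab : ∀ g : G, MulAut.conj g • D = D := by
      have h1 : Subgroup.closure S ≤
          (MulAction.stabilizer (MulAut G) D).comap (MulAut.conj : G →* MulAut G) :=
        (Subgroup.closure_le _).2 fun s hs => hall s hs
      intro g
      have : g ∈ Subgroup.closure S := by rw [hS]; trivial
      exact h1 this
    have hDnormal : D.Normal := ⟨fun x hx g => by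
      rw [← hstab g]; exact conj_mul_mem_conj_smul hx⟩
    have hC : (Subgroup.centralizer (D : Set G) ⊓ K).Normal := inferInstance
    rcases hnormal _ D hC hDnormal inf_le_right (hDN.trans hNK)
      (fun a ha b hb => (ha.1 b hb).symm) with h | h
    · refine hA0 ((Subgroup.eq_bot_iff_forall _).2 fun a ha => ?_)
      have h2 : g₀ * a * g₀⁻¹ ∈ Subgroup.centralizer (D : Set G) ⊓ K := by
        refine ⟨?_, hKn.conj_mem a (hA ha) g₀⟩
        intro x hx
        have h3 := hAB a ha _ ((hmem x).1 hx g₀ hg₀).1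
        calc x * (g₀ * a * g₀⁻¹) = g₀ * (g₀⁻¹ * x * g₀ * a) * g₀⁻¹ := by group
          _ = g₀ * a * g₀⁻¹ * x := by rw [← h3]; group
      rw [h, Subgroup.mem_bot, conj_eq_one_iff] at h2
      exact h2
    · exact hD0 h
  · push Not at hall
    obtain ⟨s, hs, hsD⟩ := hall
    have hsD' := (hDg s).resolve_right hsD
    have hDcomm : ∀ u ∈ D, ∀ v ∈ D, u * v = v * u := by
      refine hswap s hs D (hDN.trans hNK)
        (fun u hu v hv => hcommconj s hsD' u hu _ (conj_mul_mem_conj_smul hv)) fun u hu hsu => ?_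
      have : s * u * s⁻¹ ∈ D ⊓ MulAut.conj s • D := ⟨hsu, conj_mul_mem_conj_smul hu⟩
      rw [hsD', Subgroup.mem_bot, conj_eq_one_iff] at this
      exact this
    have hcomm1 : ∀ g : G, ∀ u ∈ D, ∀ v ∈ MulAut.conj g • D, u * v = v * u := by
      intro g u hu v hv
      rcases hDg g with h | h
      · exact hcommconj g h u hu v hv
      · rw [h] at hv
        exact hDcomm u hu v hv
    have hcommS : ∀ x ∈ Group.conjugatesOfSet (D : Set G), ∀ y ∈ Group.conjugatesOfSet (D : Set G),
        x * y = y * x := by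
      intro x hx y hy
      obtain ⟨u, hu, hux⟩ := Group.mem_conjugatesOfSet_iff.1 hx
      obtain ⟨v, hv, hvy⟩ := Group.mem_conjugatesOfSet_iff.1 hy
      obtain ⟨g, rfl⟩ := isConj_iff.1 hux
      obtain ⟨k, rfl⟩ := isConj_iff.1 hvy
      have h1 := hcomm1 (g⁻¹ * k) u hu ((g⁻¹ * k) * v * (g⁻¹ * k)⁻¹) (conj_mul_mem_conj_smul hv)
      calc g * u * g⁻¹ * (k * v * k⁻¹)
          = g * (u * ((g⁻¹ * k) * v * (g⁻¹ * k)⁻¹)) * g⁻¹ := by group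
        _ = k * v * k⁻¹ * (g * u * g⁻¹) := by rw [h1]; group
    have hMK : Subgroup.normalClosure (D : Set G) ≤ K :=
      Subgroup.normalClosure_le_normal (hDN.trans hNK)
    have hM := hnormal _ _ Subgroup.normalClosure_normal Subgroup.normalClosure_normal hMK hMK
      fun a ha b hb => commute_of_mem_closure hcommS ha hb
    rw [or_self] at hM
    refine hD0 (le_bot_iff.1 ?_)
    rw [← hM]
    exact Subgroup.subset_normalClosure

end Combination

section FiniteType

variable {B : Type*} [Fintype B] {M : CoxeterMatrix B} {W : Type*} [Group W]
  {cs : CoxeterSystem M W} {c : (coxeterGraph M).ConnectedComponent}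

/-- The standard scalar product averaged over a finite subgroup. -/
def avgForm (cs : CoxeterSystem M W) (P : Subgroup W) [Fintype P] :
    (B → ℝ) →ₗ[ℝ] (B → ℝ) →ₗ[ℝ] ℝ :=
  LinearMap.mk₂ ℝ (fun x y => ∑ w : P, ∑ i, rep cs w x i * rep cs w y i)
    (fun x x' y => by
      simp only [map_add, Pi.add_apply, add_mul, Finset.sum_add_distrib])
    (fun k x y => by
      simp only [map_smul, Pi.smul_apply, smul_eq_mul, Finset.mul_sum, mul_assoc])
    (fun x y y' => by
      simp only [map_add, Pi.add_apply, mul_add, Finset.sum_add_distrib])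
    (fun k x y => by
      simp only [map_smul, Pi.smul_apply, smul_eq_mul, Finset.mul_sum, mul_left_comm])

theorem avgForm_apply (P : Subgroup W) [Fintype P] (x y : B → ℝ) :
    avgForm cs P x y = ∑ w : P, ∑ i, rep cs w x i * rep cs w y i := rfl

theorem avgForm_symm (P : Subgroup W) [Fintype P] (x y : B → ℝ) :
    avgForm cs P x y = avgForm cs P y x := by
  simp only [avgForm_apply, mul_comm]

theorem avgForm_rep (P : Subgroup W) [Fintype P] {g : W} (hg : g ∈ P) (x y : B → ℝ) :
    avgForm cs P (rep cs g x) (rep cs g y) = avgForm cs P x y := by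
  simp only [avgForm_apply, ← rep_mul]
  exact Equiv.sum_comp (Equiv.mulRight (⟨g, hg⟩ : P))
    (fun w : P => ∑ i, rep cs (w : W) x i * rep cs (w : W) y i)

theorem avgForm_pos (P : Subgroup W) [Fintype P] {x : B → ℝ} (hx : x ≠ 0) :
    0 < avgForm cs P x x := by
  rw [avgForm_apply]
  have hnn : ∀ w : P, 0 ≤ ∑ i, rep cs (w : W) x i * rep cs (w : W) x i := fun w =>
    Finset.sum_nonneg fun i _ => mul_self_nonneg _
  refine Finset.sum_pos' (fun w _ => hnn w) ⟨1, Finset.mem_univ _, ?_⟩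
  obtain ⟨i, hi⟩ := Function.ne_iff.1 hx
  refine Finset.sum_pos' (fun i _ => mul_self_nonneg _) ⟨i, Finset.mem_univ _, ?_⟩
  rw [OneMemClass.coe_one, rep_one]
  exact mul_self_pos.2 hi

theorem posDefOn_of_finite (hfin : Finite (standardParabolic cs c.supp)) :
    PosDefOn M c.supp := by
  have := Fintype.ofFinite (standardParabolic cs c.supp)
  set b₀ := avgForm cs (standardParabolic cs c.supp) with hb₀
  have h1 : ∀ s ∈ c.supp, ∀ y, b₀ (simpleRoot s) y =
      cform M (simpleRoot s) y * b₀ (simpleRoot s) (simpleRoot s) := by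
    intro s hs y
    have h2 := avgForm_rep (cs := cs) _ (simple_mem_standardParabolic (cs := cs) hs)
      (simpleRoot s) y
    rw [rep_simple_self, rep_simple, ← hb₀] at h2
    simp only [map_neg, LinearMap.neg_apply, map_sub, map_smul, smul_eq_mul] at h2
    linarith
  obtain ⟨s₀, hs₀⟩ := c.nonempty_supp
  set k := b₀ (simpleRoot s₀) (simpleRoot s₀) with hk
  have hk0 : 0 < k := avgForm_pos _ (isRoot_simpleRoot (cs := cs) s₀).ne_zero
  have h2 : ∀ s ∈ c.supp, b₀ (simpleRoot s) (simpleRoot s) = k := by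
    refine component_induction M hs₀ _ rfl ?_
    intro s t hs ht _ hst ih
    have h3 := h1 s hs (simpleRoot t)
    rw [avgForm_symm, ← hb₀, h1 t ht, cform_symm, ih, cform_simpleRoot] at h3
    exact mul_left_cancel₀ hst h3
  intro x hx hx0
  have h3 : b₀ x x = k * cform M x x := by
    have hl : ∀ b : (B → ℝ) →ₗ[ℝ] (B → ℝ) →ₗ[ℝ] ℝ, b x x = ∑ s, x s * b (simpleRoot s) x := by
      intro b
      have := congrArg (fun y => b y x) (eq_sum_smul_simpleRoot x)
      simpa only [map_sum, LinearMap.sum_apply, map_smul, LinearMap.smul_apply, smul_eq_mul]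
        using this
    rw [hl, hl (cform M), Finset.mul_sum]
    refine Finset.sum_congr rfl fun s _ => ?_
    by_cases hs : s ∈ c.supp
    · rw [h1 s hs, h2 s hs]; ring
    · have : x s = 0 := by by_contra h; exact hs (hx h)
      simp [this]
  have h4 : 0 < b₀ x x := avgForm_pos _ hx0
  rw [h3] at h4
  exact (pos_iff_pos_of_mul_pos h4).1 hk0

theorem PosDefOn.posSemidefOn {X : Set B} (h : PosDefOn M X) : PosSemidefOn M X := by
  intro x hx
  by_cases hx0 : x = 0
  · subst hx0; simp [canonicalForm]
  · exact (h x hx hx0).le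

theorem exists_mem_ne_one_of_infinite {G : Type*} [Group G] [Infinite G] (K : Subgroup G)
    [hK : K.FiniteIndex] : ∃ x ∈ K, x ≠ 1 := by
  by_contra! h
  have h1 : K = ⊥ := (Subgroup.eq_bot_iff_forall _).2 h
  have h2 := hK.index_ne_zero
  rw [h1, Subgroup.index_bot] at h2
  exact h2 Nat.card_eq_zero_of_infinite

/-- A torsion-free normal subgroup of finite index of an irreducible component which is neither
spherical nor affine has no finite index subgroup normalizing two commuting nontrivial subgroups. -/
theorem isPrimeGroup_subgroupOf {K : Subgroup W} (hKn : K.Normal) (hKf : K.FiniteIndex)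
    (hK : ∀ x ∈ K, IsOfFinOrder x → x = 1) (hX : ¬ PosSemidefOn M c.supp) :
    IsPrimeGroup (K.subgroupOf (standardParabolic cs c.supp)) := by
  set P := standardParabolic cs c.supp with hP
  have : Infinite P := by
    rw [← not_finite_iff_infinite]
    exact fun h => hX (posDefOn_of_finite h).posSemidefOn
  have hval : ∀ x : P, IsOfFinOrder x → IsOfFinOrder (x : W) := fun x hx =>
    MonoidHom.isOfFinOrder P.subtype hx
  have hK' : ∀ x ∈ K.subgroupOf P, IsOfFinOrder x → x = 1 := fun x hx hfin =>
    Subtype.ext (hK x hx (hval x hfin))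
  set S : Set P := {g | ∃ s ∈ c.supp, (g : W) = cs.simple s} with hS
  have hSgen : Subgroup.closure S = ⊤ := by
    rw [eq_top_iff]
    rintro ⟨g, hg⟩ -
    have : ∀ h : g ∈ P, (⟨g, h⟩ : P) ∈ Subgroup.closure S := by
      refine standardParabolic_induction (p := fun g => ∀ h : g ∈ P, (⟨g, h⟩ : P) ∈
        Subgroup.closure S) (fun _ => one_mem _) ?_ hg
      intro s hs w hw ih _
      exact mul_mem (Subgroup.subset_closure (show (⟨cs.simple s,
        simple_mem_standardParabolic hs⟩ : P) ∈ S from ⟨s, hs, rfl⟩)) (ih hw)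
    exact this hg
  have htf : ∀ A : Subgroup P, A.Normal → A ≤ K.subgroupOf P → IsTFNormal cs c (A.map P.subtype) := by
    intro A hA hAK
    refine ⟨Subgroup.map_subtype_le A, ?_, ?_⟩
    · rintro s hs _ ⟨a, ha, rfl⟩
      have := hA.conj_mem a ha ⟨cs.simple s, simple_mem_standardParabolic hs⟩
      exact ⟨_, this, by simp⟩
    · rintro _ ⟨a, ha, rfl⟩ hfin
      exact hK _ (hAK ha) hfin
  have hbot : ∀ A : Subgroup P, A.map P.subtype = ⊥ → A = ⊥ := fun A hA =>
    (Subgroup.map_eq_bot_iff_of_injective _ P.subtype_injective).1 hA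
  have hnormal : ∀ A A' : Subgroup P, A.Normal → A'.Normal → A ≤ K.subgroupOf P →
      A' ≤ K.subgroupOf P → (∀ a ∈ A, ∀ b ∈ A', a * b = b * a) → A = ⊥ ∨ A' = ⊥ := by
    intro A A' hA hA' hAK hAK' hcomm
    refine (eq_bot_or_eq_bot_of_commute hX (htf A hA hAK) (htf A' hA' hAK') ?_).imp (hbot A)
      (hbot A')
    rintro _ ⟨a, ha, rfl⟩ _ ⟨b, hb, rfl⟩
    exact congrArg Subtype.val (hcomm a ha b hb)
  have hswap : ∀ s ∈ S, ∀ D ≤ K.subgroupOf P,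
      (∀ u ∈ D, ∀ v ∈ D, u * (s * v * s⁻¹) = (s * v * s⁻¹) * u) →
      (∀ u ∈ D, s * u * s⁻¹ ∈ D → u = 1) → ∀ u ∈ D, ∀ v ∈ D, u * v = v * u := by
    rintro ⟨_, hsP⟩ ⟨s, hs, rfl⟩ D hDK h1 h2 u hu v hv
    have hsw : IsSwapped cs s (D.map P.subtype) := by
      refine ⟨?_, ?_, ?_, ?_⟩
      · rintro _ ⟨u, hu, rfl⟩ _ ⟨v, hv, rfl⟩
        simpa using congrArg Subtype.val (h1 u hu v hv)
      · rintro _ ⟨u, hu, rfl⟩ ⟨v, hv, huv⟩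
        have : v = (⟨cs.simple s, hsP⟩ : P) * u * (⟨cs.simple s, hsP⟩ : P)⁻¹ :=
          Subtype.ext (by simpa using huv)
        rw [h2 u hu (this ▸ hv)]
        rfl
      · rintro _ ⟨u, hu, rfl⟩ hfin
        exact hK _ (hDK hu) hfin
      · rintro _ ⟨u, hu, rfl⟩ hfin
        refine hK _ (mul_mem ?_ (inv_mem (hDK hu))) hfin
        simpa using hKn.conj_mem _ (hDK hu) (cs.simple s)
    exact Subtype.ext (hsw.commute ⟨u, hu, rfl⟩ ⟨v, hv, rfl⟩)
  refine ⟨?_, ?_, ?_⟩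
  · intro x hx
    exact Subtype.ext (hK' x x.2 (MonoidHom.isOfFinOrder (K.subgroupOf P).subtype hx))
  · obtain ⟨x, hx, hx1⟩ := exists_mem_ne_one_of_infinite (K.subgroupOf P)
    exact ⟨⟨x, hx⟩, fun h => hx1 (congrArg Subtype.val h)⟩
  · intro H hH A A' hA hA' hcomm
    have hbot' : ∀ A : Subgroup (K.subgroupOf P), A.map (K.subgroupOf P).subtype = ⊥ → A = ⊥ :=
      fun A hA => (Subgroup.map_eq_bot_iff_of_injective _ (K.subgroupOf P).subtype_injective).1 hA
    refine (eq_bot_or_eq_bot_of_finiteIndex hSgen (K := K.subgroupOf P) inferInstance inferInstance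
      hK' hnormal hswap (H := H.map (K.subgroupOf P).subtype) ?_ (Subgroup.map_subtype_le A)
      (Subgroup.map_subtype_le A') ?_ ?_).imp (hbot' A) (hbot' A')
    · refine ⟨?_⟩
      rw [Subgroup.index_map_subtype]
      exact mul_ne_zero hH.index_ne_zero Subgroup.FiniteIndex.index_ne_zero
    · rintro _ ⟨h, hh, rfl⟩ _ ⟨x, hx, rfl⟩
      exact ⟨_, hA' h hh x hx, by simp⟩
    · rintro _ ⟨a, ha, rfl⟩ _ ⟨b, hb, rfl⟩
      exact congrArg Subtype.val (hcomm a ha b hb)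

end FiniteType

section FiniteValues

variable {B : Type*} [Fintype B] {M : CoxeterMatrix B} {W : Type*} [Group W]
  {cs : CoxeterSystem M W} {c : (coxeterGraph M).ConnectedComponent}

theorem exists_exponent_of_finOrder (cs : CoxeterSystem M W) :
    ∃ m : ℕ, m ≠ 0 ∧ ∀ x : W, IsOfFinOrder x → x ^ m = 1 := by
  obtain ⟨K, hn, hf, hK⟩ := exists_torsionFree_normal cs
  exact ⟨K.index, hf.index_ne_zero, fun x hx => hK _ (K.pow_index_mem x) hx.pow⟩

theorem form_rep_pow {w w' : W} {s t : B} {θ : ℝ}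
    (hθ : cform M (rep cs w (simpleRoot s)) (rep cs w' (simpleRoot t)) = Real.cos θ) (n : ℕ) :
    cform M (rep cs w (simpleRoot s)) (rep cs
      ((w * cs.simple s * w⁻¹ * (w' * cs.simple t * w'⁻¹)) ^ n) (rep cs w (simpleRoot s))) =
        Real.cos (2 * n * θ) := by
  set α := rep cs w (simpleRoot s) with hα
  set β := rep cs w' (simpleRoot t) with hβ
  set r := w * cs.simple s * w⁻¹ * (w' * cs.simple t * w'⁻¹) with hr
  have hαα : cform M α α = 1 := ((isRoot_simpleRoot s).map_rep w).form_self
  have hββ : cform M β β = 1 := ((isRoot_simpleRoot t).map_rep w').form_self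
  have hrx : ∀ x, rep cs r x = x - (2 * cform M β x) • β -
      (2 * cform M α (x - (2 * cform M β x) • β)) • α := by
    intro x
    rw [hr, rep_mul, rep_conj_simple, rep_conj_simple]
  have hrα : rep cs r α = (4 * Real.cos θ ^ 2 - 1) • α - (2 * Real.cos θ) • β := by
    rw [hrx]
    simp only [map_sub, map_smul, smul_eq_mul, hαα, cform_symm M β α, hθ]
    module
  have hrβ : rep cs r β = (2 * Real.cos θ) • α - β := by
    rw [hrx]
    simp only [map_sub, map_smul, smul_eq_mul, hββ, hθ]
    module
  have hrec : rep cs r (rep cs r α) + α = (2 * (2 * Real.cos θ ^ 2 - 1)) • rep cs r α := by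
    rw [hrα, map_sub, map_smul, map_smul, hrα, hrβ]
    module
  have hpow : ∀ n, rep cs (r ^ (n + 2)) α + rep cs (r ^ n) α =
      (2 * (2 * Real.cos θ ^ 2 - 1)) • rep cs (r ^ (n + 1)) α := by
    intro n
    rw [pow_add, rep_mul, ← map_add, pow_two, rep_mul, hrec, map_smul, ← rep_mul, ← pow_succ]
  induction n using Nat.twoStepInduction with
  | zero => simp [hαα]
  | one =>
    rw [pow_one, hrα]
    simp only [map_sub, map_smul, smul_eq_mul, hαα, hθ]
    rw [Nat.cast_one, show (2 : ℝ) * 1 * θ = 2 * θ by ring, Real.cos_two_mul]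
    ring
  | more n ih1 ih2 =>
    have := congrArg (cform M α) (hpow n)
    rw [map_add, map_smul, ih1, ih2, ← Real.cos_two_mul] at this
    push_cast at this ⊢
    rw [eq_sub_of_add_eq this, smul_eq_mul, show 2 * ((n : ℝ) + 2) * θ = 2 * (n + 1) * θ + 2 * θ by ring,
      show 2 * (n : ℝ) * θ = 2 * (n + 1) * θ - 2 * θ by ring, Real.cos_add, Real.cos_sub]
    ring

theorem form_eq_cos {m : ℕ} (hm0 : m ≠ 0) (hm : ∀ x : W, IsOfFinOrder x → x ^ m = 1) {w w' : W}
    {s t : B} (h : |cform M (rep cs w (simpleRoot s)) (rep cs w' (simpleRoot t))| < 1) :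
    ∃ k ≤ m, cform M (rep cs w (simpleRoot s)) (rep cs w' (simpleRoot t)) =
      Real.cos (k * Real.pi / m) := by
  have h1 := hm _ (isOfFinOrder_of_form_lt_one h)
  set b := cform M (rep cs w (simpleRoot s)) (rep cs w' (simpleRoot t)) with hb
  have hcos : b = Real.cos (Real.arccos b) :=
    (Real.cos_arccos (neg_le_of_abs_le h.le) (le_of_abs_le h.le)).symm
  have h2 := form_rep_pow (cs := cs) (hb.symm.trans hcos) m
  rw [h1, rep_one, ((isRoot_simpleRoot s).map_rep w).form_self] at h2
  obtain ⟨k, hk⟩ := (Real.cos_eq_one_iff _).1 h2.symm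
  have hm' : (0 : ℝ) < m := by positivity
  have hkθ : Real.arccos b = k * Real.pi / m := by
    field_simp
    linarith
  have hπ := Real.pi_pos
  have hk0 : 0 ≤ k := by
    have h3 := Real.arccos_nonneg b
    rw [hkθ, le_div_iff₀ hm', zero_mul] at h3
    exact_mod_cast nonneg_of_mul_nonneg_left h3 hπ
  have hkm : k ≤ m := by
    have h3 := Real.arccos_le_pi b
    rw [hkθ, div_le_iff₀ hm', mul_comm Real.pi] at h3
    exact_mod_cast le_of_mul_le_mul_right h3 hπ
  lift k to ℕ using hk0
  refine ⟨k, by exact_mod_cast hkm, ?_⟩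
  rw [hcos, hkθ]
  norm_cast

theorem support_rep_subset {w : W} (hw : w ∈ standardParabolic cs c.supp) {s : B}
    (hs : s ∈ c.supp) : Function.support (rep cs w (simpleRoot s)) ⊆ c.supp := by
  intro i hi
  by_contra hic
  apply hi
  rw [rep_apply_of_notMem hw _ hic]
  exact simpleRoot_of_ne fun h => hic (h ▸ hs)

theorem abs_form_le_one (hX : PosSemidefOn M c.supp) {w w' : W}
    (hw : w ∈ standardParabolic cs c.supp) (hw' : w' ∈ standardParabolic cs c.supp) {s t : B}
    (hs : s ∈ c.supp) (ht : t ∈ c.supp) :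
    |cform M (rep cs w (simpleRoot s)) (rep cs w' (simpleRoot t))| ≤ 1 := by
  have h1 := support_rep_subset hw hs
  have h2 := support_rep_subset hw' ht
  have hα := ((isRoot_simpleRoot (cs := cs) s).map_rep w).form_self
  have hβ := ((isRoot_simpleRoot (cs := cs) t).map_rep w').form_self
  set α := rep cs w (simpleRoot s)
  set β := rep cs w' (simpleRoot t)
  have h3 := hX (α + β) ((Function.support_add _ _).trans (Set.union_subset h1 h2))
  have h4 := hX (α - β) ((Function.support_sub _ _).trans (Set.union_subset h1 h2))
  rw [← cform_apply] at h3 h4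
  simp only [map_add, map_sub, LinearMap.add_apply, LinearMap.sub_apply, hα, hβ,
    cform_symm M β α] at h3 h4
  rw [abs_le]
  constructor <;> linarith

theorem finite_form_values (hX : PosSemidefOn M c.supp) :
    {x : ℝ | ∃ w ∈ standardParabolic cs c.supp, ∃ s ∈ c.supp, ∃ t ∈ c.supp,
      x = cform M (rep cs w (simpleRoot s)) (simpleRoot t)}.Finite := by
  obtain ⟨m, hm0, hm⟩ := exists_exponent_of_finOrder cs
  refine (((Set.finite_le_nat m).image fun k : ℕ => Real.cos (k * Real.pi / m)).union
    (Set.toFinite {1, -1})).subset ?_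
  rintro _ ⟨w, hw, s, hs, t, ht, rfl⟩
  have h1 := abs_form_le_one hX hw (one_mem _) hs ht
  rcases lt_or_eq_of_le h1 with h2 | h2
  · obtain ⟨k, hk, h3⟩ := form_eq_cos hm0 hm h2
    rw [rep_one] at h3
    exact Or.inl ⟨k, hk, h3.symm⟩
  · rw [rep_one] at h2
    right
    rcases eq_or_eq_neg_of_abs_eq h2 with h | h <;> simp [h]

end FiniteValues

section Translations

variable {B : Type*} [Fintype B] {M : CoxeterMatrix B} {W : Type*} [Group W]
  {cs : CoxeterSystem M W} {c : (coxeterGraph M).ConnectedComponent}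

theorem form_eq_zero_of_isotropic {X : Set B} (hX : PosSemidefOn M X) {x : B → ℝ}
    (hx : Function.support x ⊆ X) (hxx : cform M x x = 0) {y : B → ℝ}
    (hy : Function.support y ⊆ X) : cform M x y = 0 := by
  have key : ∀ t : ℝ, 0 ≤ 2 * t * cform M x y + cform M y y * t ^ 2 := by
    intro t
    have h := hX (x + t • y) ((Function.support_add _ _).trans
      (Set.union_subset hx ((Function.support_const_smul_subset t y).trans hy)))
    rw [← cform_apply] at h
    simp only [map_add, LinearMap.add_apply, map_smul, LinearMap.smul_apply, smul_eq_mul, hxx,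
      cform_symm M y x] at h
    linarith
  have hyy : 0 ≤ cform M y y := hX y hy
  set p := cform M x y
  set q := cform M y y
  by_contra hp
  have h1 := key (-p / (q + 1))
  have h2 : 2 * (-p / (q + 1)) * p + q * (-p / (q + 1)) ^ 2 = -(p ^ 2 * (q + 2)) / (q + 1) ^ 2 := by
    field_simp
    ring
  rw [h2] at h1
  have h3 : 0 < p ^ 2 * (q + 2) / (q + 1) ^ 2 := by positivity
  rw [neg_div] at h1
  linarith

omit [Fintype B] in
theorem support_simpleRoot_subset {X : Set B} {s : B} (hs : s ∈ X) :
    Function.support (simpleRoot s) ⊆ X := by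
  intro i hi
  by_contra hic
  exact hi (simpleRoot_of_ne fun h => hic (h ▸ hs))

end Translations

section Radical

variable {B : Type*} [Fintype B] {M : CoxeterMatrix B} {W : Type*} [Group W]
  {cs : CoxeterSystem M W} {c : (coxeterGraph M).ConnectedComponent}

theorem cform_abs_le (x : B → ℝ) : cform M |x| |x| ≤ cform M x x := by
  rw [cform_apply, cform_apply]
  refine Finset.sum_le_sum fun i _ => Finset.sum_le_sum fun j _ => ?_
  simp only [Pi.abs_apply]
  rw [← abs_mul]
  by_cases hij : i = j
  · subst hij
    rw [abs_mul_self]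
  · exact mul_le_mul_of_nonpos_right (le_abs_self _) (formEntry_nonpos M hij)

omit [Fintype B] in
theorem support_abs_subset {X : Set B} {x : B → ℝ} (hx : Function.support x ⊆ X) :
    Function.support |x| ⊆ X := fun i hi => hx fun h => hi (by rw [Pi.abs_apply, h, abs_zero])

theorem abs_pos_of_isotropic (hX : PosSemidefOn M c.supp) {x : B → ℝ}
    (hx : Function.support x ⊆ c.supp) (hne : x ≠ 0) (hxx : cform M x x = 0) :
    (∀ s ∈ c.supp, cform M (simpleRoot s) |x| = 0) ∧ ∀ s ∈ c.supp, 0 < |x| s := by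
  have hsupp := support_abs_subset hx
  have h0 : cform M |x| |x| = 0 :=
    le_antisymm ((cform_abs_le x).trans_eq hxx) (hX _ hsupp)
  have hrad : ∀ s ∈ c.supp, cform M (simpleRoot s) |x| = 0 := fun s hs => by
    rw [cform_symm]
    exact form_eq_zero_of_isotropic hX hsupp h0 (support_simpleRoot_subset hs)
  exact ⟨hrad, pos_of_radical (abs_nonneg x) hsupp (by simpa using hne) hrad⟩

/-- A positive vector spanning the radical of the form on the span of `{α_s : s ∈ c}`. -/
structure IsRadicalVector (M : CoxeterMatrix B) (c : (coxeterGraph M).ConnectedComponent)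
    (v : B → ℝ) : Prop where
  support_subset : Function.support v ⊆ c.supp
  form_eq_zero : ∀ s ∈ c.supp, cform M (simpleRoot s) v = 0
  pos : ∀ s ∈ c.supp, 0 < v s

theorem exists_isRadicalVector (hc : IsAffineComponent M c) : ∃ v, IsRadicalVector M c v := by
  obtain ⟨hX, hnd⟩ := hc
  unfold PosDefOn at hnd
  push Not at hnd
  obtain ⟨x, hx, hne, hxx⟩ := hnd
  obtain ⟨h1, h2⟩ := abs_pos_of_isotropic hX hx hne (le_antisymm hxx (hX x hx))
  exact ⟨|x|, support_abs_subset hx, h1, h2⟩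

theorem IsRadicalVector.cform_eq_zero {v : B → ℝ} (hv : IsRadicalVector M c v) {x : B → ℝ}
    (hx : Function.support x ⊆ c.supp) : cform M x v = 0 := by
  rw [eq_sum_smul_simpleRoot x, map_sum, LinearMap.sum_apply]
  refine Finset.sum_eq_zero fun s _ => ?_
  rw [map_smul, LinearMap.smul_apply]
  by_cases hs : s ∈ c.supp
  · rw [hv.form_eq_zero s hs, smul_zero]
  · rw [show x s = 0 from by_contra fun h => hs (hx h), zero_smul]

theorem IsRadicalVector.eq_smul_of_isotropic {v : B → ℝ} (hv : IsRadicalVector M c v)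
    (hX : PosSemidefOn M c.supp) {y : B → ℝ} (hy : Function.support y ⊆ c.supp)
    (hyy : cform M y y = 0) : ∃ r : ℝ, y = r • v := by
  obtain ⟨s₀, hs₀⟩ := c.nonempty_supp
  have hpos := hv.pos s₀ hs₀
  refine ⟨y s₀ / v s₀, ?_⟩
  by_contra hne
  set z := y - (y s₀ / v s₀) • v with hz
  have hzs : Function.support z ⊆ c.supp := (Function.support_sub _ _).trans
    (Set.union_subset hy ((Function.support_const_smul_subset _ v).trans hv.support_subset))
  have hzz : cform M z z = 0 := by
    have h1 : cform M z z = cform M z y - (y s₀ / v s₀) * cform M z v := by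
      rw [← smul_eq_mul, ← map_smul, ← map_sub]
    rw [h1, hv.cform_eq_zero hzs, hz, map_sub, map_smul, LinearMap.sub_apply,
      LinearMap.smul_apply, hyy, cform_symm M v y, hv.cform_eq_zero hy]
    simp
  have h2 := (abs_pos_of_isotropic hX hzs (sub_ne_zero.2 hne) hzz).2 s₀ hs₀
  have h3 : z s₀ = 0 := by
    rw [hz, Pi.sub_apply, Pi.smul_apply, smul_eq_mul, div_mul_cancel₀ _ hpos.ne', sub_self]
  rw [Pi.abs_apply, h3, abs_zero] at h2
  exact lt_irrefl _ h2

theorem IsRadicalVector.rep_eq {v : B → ℝ} (hv : IsRadicalVector M c v) {w : W}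
    (hw : w ∈ standardParabolic cs c.supp) : rep cs w v = v :=
  rep_eq_of_orthogonal hw hv.form_eq_zero

theorem finiteIndex_of_isotropic (hX : PosSemidefOn M c.supp)
    (T : Subgroup (standardParabolic cs c.supp))
    (hT : ∀ w w' : standardParabolic cs c.supp,
      (∀ s ∈ c.supp, cform M (rep cs w (simpleRoot s) - rep cs w' (simpleRoot s))
        (rep cs w (simpleRoot s) - rep cs w' (simpleRoot s)) = 0) → w⁻¹ * w' ∈ T) :
    T.FiniteIndex := by
  classical
  have hfin := finite_form_values (cs := cs) hX
  let F : standardParabolic cs c.supp → c.supp → c.supp →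
      {x : ℝ | ∃ w ∈ standardParabolic cs c.supp, ∃ s ∈ c.supp, ∃ t ∈ c.supp,
        x = cform M (rep cs w (simpleRoot s)) (simpleRoot t)} := fun w s t =>
    ⟨cform M (rep cs w (simpleRoot s)) (simpleRoot t), w, w.2, s, s.2, t, t.2, rfl⟩
  have := hfin.to_subtype
  have hF : Function.Injective fun q : (standardParabolic cs c.supp) ⧸ T => F q.out := by
    intro q q' h
    rw [← QuotientGroup.out_eq' q, ← QuotientGroup.out_eq' q', QuotientGroup.eq]
    refine hT _ _ fun s hs => ?_
    have hsub : Function.support (rep cs (q.out : standardParabolic cs c.supp) (simpleRoot s) -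
        rep cs (q'.out : standardParabolic cs c.supp) (simpleRoot s)) ⊆ c.supp :=
      (Function.support_sub _ _).trans (Set.union_subset
        (support_rep_subset (q.out).2 hs) (support_rep_subset (q'.out).2 hs))
    set z := rep cs (q.out : standardParabolic cs c.supp) (simpleRoot s) -
        rep cs (q'.out : standardParabolic cs c.supp) (simpleRoot s) with hz
    have h1 : ∀ t ∈ c.supp, cform M z (simpleRoot t) = 0 := by
      intro t ht
      have := congrArg Subtype.val (congrFun (congrFun h ⟨s, hs⟩) ⟨t, ht⟩)
      rw [hz, map_sub, LinearMap.sub_apply, sub_eq_zero]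
      exact this
    nth_rewrite 2 [eq_sum_smul_simpleRoot z]
    rw [map_sum]
    refine Finset.sum_eq_zero fun t _ => ?_
    rw [map_smul]
    by_cases ht : t ∈ c.supp
    · rw [h1 t ht, smul_zero]
    · rw [show z t = 0 from by_contra fun h => ht (hsub h), zero_smul]
  have := Finite.of_injective _ hF
  exact Subgroup.finiteIndex_of_finite_quotient

theorem finite_of_posDefOn (hX : PosDefOn M c.supp) : Finite (standardParabolic cs c.supp) := by
  have hbot : (⊥ : Subgroup (standardParabolic cs c.supp)).FiniteIndex := by
    refine finiteIndex_of_isotropic hX.posSemidefOn _ fun w w' h => ?_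
    rw [Subgroup.mem_bot]
    refine Subtype.ext (eq_one_of_rep_eq_on (w⁻¹ * w').2 fun s hs => ?_)
    have h1 := h s hs
    have h2 : rep cs w (simpleRoot s) - rep cs w' (simpleRoot s) = 0 := by
      by_contra hne
      exact (hX _ ((Function.support_sub _ _).trans (Set.union_subset
        (support_rep_subset w.2 hs) (support_rep_subset w'.2 hs))) hne).ne' h1
    rw [Subgroup.coe_mul, Subgroup.coe_inv, rep_mul, ← sub_eq_zero.1 h2, rep_inv_rep]
  exact (Subgroup.finite_iff_finite_and_finiteIndex (H := (⊥ : Subgroup _))).2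
    ⟨inferInstance, hbot⟩

end Radical

section Translations

variable {B : Type*} [Fintype B] {M : CoxeterMatrix B} {W : Type*} [Group W]
  {cs : CoxeterSystem M W} {c : (coxeterGraph M).ConnectedComponent} {v : B → ℝ}

/-- The elements of an irreducible component acting trivially modulo the vector `v` of the
radical. -/
def translations (cs : CoxeterSystem M W) (hv : IsRadicalVector M c v) :
    Subgroup (standardParabolic cs c.supp) where
  carrier := {w | ∀ s : c.supp, ∃ r : ℝ, rep cs w (simpleRoot s.1) = simpleRoot s.1 + r • v}
  one_mem' s := ⟨0, by simp⟩
  mul_mem' := by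
    intro w w' hw hw' s
    obtain ⟨r, hr⟩ := hw s
    obtain ⟨r', hr'⟩ := hw' s
    refine ⟨r + r', ?_⟩
    rw [Subgroup.coe_mul, rep_mul, hr', map_add, map_smul, hv.rep_eq w.2, hr]
    module
  inv_mem' := by
    intro w hw s
    obtain ⟨r, hr⟩ := hw s
    refine ⟨-r, ?_⟩
    have h := congrArg (rep cs (w : W)⁻¹) hr
    rw [rep_inv_rep, map_add, map_smul, hv.rep_eq (inv_mem w.2)] at h
    rw [Subgroup.coe_inv, eq_comm, neg_smul, ← sub_eq_add_neg, sub_eq_iff_eq_add]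
    exact h

variable (hv : IsRadicalVector M c v)

/-- The coordinates of a translation. -/
def translationCoord (w : translations cs hv) (s : c.supp) : ℝ := (w.2 s).choose

theorem rep_translation (w : translations cs hv) (s : c.supp) :
    rep cs (w : standardParabolic cs c.supp) (simpleRoot s.1) =
      simpleRoot s.1 + translationCoord hv w s • v := (w.2 s).choose_spec

include hv in
theorem IsRadicalVector.ne_zero : v ≠ 0 := by
  obtain ⟨s₀, hs₀⟩ := c.nonempty_supp
  exact fun h => (hv.pos s₀ hs₀).ne' (congrFun h s₀)

theorem translationCoord_eq (w : translations cs hv) {s : c.supp} {r : ℝ}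
    (h : rep cs (w : standardParabolic cs c.supp) (simpleRoot s.1) = simpleRoot s.1 + r • v) :
    translationCoord hv w s = r := by
  rw [rep_translation] at h
  exact smul_left_injective ℝ hv.ne_zero (add_left_cancel h)

/-- The coordinates of translations as an additive homomorphism. -/
def translationHom (cs : CoxeterSystem M W) (hv : IsRadicalVector M c v) :
    Additive (translations cs hv) →+ (c.supp → ℝ) where
  toFun w := translationCoord hv w.toMul
  map_zero' := by
    funext s
    refine translationCoord_eq hv _ ?_
    simp
  map_add' w w' := by
    funext s
    refine translationCoord_eq hv _ ?_
    rw [toMul_add, Subgroup.coe_mul, Subgroup.coe_mul, rep_mul, rep_translation, map_add, map_smul,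
      hv.rep_eq w.toMul.1.2, rep_translation, Pi.add_apply]
    module

theorem translationHom_injective : Function.Injective (translationHom cs hv) := by
  rw [injective_iff_map_eq_zero]
  intro w hw
  have h1 : ∀ s, translationCoord hv w.toMul s = 0 := congrFun hw
  refine Additive.toMul.injective (Subtype.ext (Subtype.ext (eq_one_of_rep_eq_on w.toMul.1.2 ?_)))
  intro s hs
  rw [rep_translation hv w.toMul ⟨s, hs⟩, h1, zero_smul, add_zero]

theorem finiteIndex_translations (hX : PosSemidefOn M c.supp) :
    (translations cs hv).FiniteIndex := by
  refine finiteIndex_of_isotropic hX _ fun w w' h s => ?_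
  obtain ⟨r, hr⟩ := hv.eq_smul_of_isotropic hX ((Function.support_sub _ _).trans
    (Set.union_subset (support_rep_subset w.2 s.2) (support_rep_subset w'.2 s.2))) (h s s.2)
  refine ⟨-r, ?_⟩
  rw [Subgroup.coe_mul, Subgroup.coe_inv, rep_mul, show rep cs w' (simpleRoot s.1) =
    rep cs w (simpleRoot s.1) - r • v from (sub_eq_of_eq_add' (sub_eq_iff_eq_add.1 hr)).symm, map_sub, map_smul, rep_inv_rep,
    hv.rep_eq (inv_mem w.2)]
  module

include hv in
theorem IsRadicalVector.eq_sum [Fintype c.supp] : v = ∑ s : c.supp, v s • simpleRoot s.1 := by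
  classical
  conv_lhs => rw [eq_sum_smul_simpleRoot v]
  rw [← Finset.sum_subtype (Finset.univ.filter (· ∈ c.supp)) (p := fun s => s ∈ c.supp)
    (by simp) (fun s : B => v s • (simpleRoot s : B → ℝ)), Finset.sum_filter]
  refine Finset.sum_congr rfl fun s _ => ?_
  split_ifs with h
  · rfl
  · rw [show v s = 0 from by_contra fun h' => h (hv.support_subset h'), zero_smul]

theorem sum_mul_translationCoord [Fintype c.supp] (w : translations cs hv) :
    ∑ s : c.supp, v s * translationCoord hv w s = 0 := by
  have h2 := hv.rep_eq (cs := cs) w.1.2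
  have h3 : rep cs (w : standardParabolic cs c.supp) (∑ s : c.supp, v s • simpleRoot s.1) =
      (∑ s : c.supp, v s • simpleRoot s.1) +
        (∑ s : c.supp, v s * translationCoord hv w s) • v := by
    rw [map_sum, Finset.sum_smul, ← Finset.sum_add_distrib]
    refine Finset.sum_congr rfl fun s _ => ?_
    rw [map_smul, rep_translation, smul_add, smul_smul]
  rw [← hv.eq_sum, h2, left_eq_add] at h3
  exact (smul_eq_zero.1 h3).resolve_right hv.ne_zero

theorem finite_translations_bounded (C : ℝ) :
    {w : translations cs hv | ∀ s, |translationCoord hv w s| ≤ C}.Finite := by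
  have h := finite_of_bounded (cs := cs) (1 + |C| * ∑ i, |v i|)
  refine Set.Finite.of_finite_image (f := fun w => ((w : standardParabolic cs c.supp) : W))
    (h.subset ?_) (fun x _ y _ hxy => Subtype.ext (Subtype.ext hxy))
  rintro _ ⟨w, hw, rfl⟩ s i
  have hvi : |v i| ≤ ∑ i, |v i| :=
    Finset.single_le_sum (f := fun i => |v i|) (fun _ _ => abs_nonneg _) (Finset.mem_univ i)
  have hs1 : |(simpleRoot s : B → ℝ) i| ≤ 1 := by
    by_cases his : i = s
    · rw [his, simpleRoot_self, abs_one]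
    · rw [simpleRoot_of_ne his, abs_zero]; exact zero_le_one
  have key : ∀ u : translations cs hv, (∀ s, |translationCoord hv u s| ≤ C) →
      |rep cs (u : standardParabolic cs c.supp) (simpleRoot s) i| ≤ 1 + |C| * ∑ i, |v i| := by
    intro u hu
    by_cases hs : s ∈ c.supp
    · rw [rep_translation hv u ⟨s, hs⟩, Pi.add_apply, Pi.smul_apply, smul_eq_mul]
      refine (abs_add_le _ _).trans (add_le_add hs1 ?_)
      rw [abs_mul]
      exact mul_le_mul ((hu _).trans (le_abs_self C)) hvi (abs_nonneg _) (abs_nonneg _)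
    · rw [rep_eq_of_orthogonal u.1.2 fun t ht => by
        rw [cform_simpleRoot, formEntry_eq_zero_of_not_mem M ht hs]]
      exact hs1.trans (le_add_of_nonneg_right (by positivity))
  refine ⟨key w hw, ?_⟩
  have := key w⁻¹ fun s => by
    have : translationCoord hv w⁻¹ = -translationCoord hv w :=
      map_neg (translationHom cs hv) (Additive.ofMul w)
    rw [this, Pi.neg_apply, abs_neg]
    exact hw s
  exact this

/-- The lattice of coordinates of translations. -/
def translationLattice (cs : CoxeterSystem M W) (hv : IsRadicalVector M c v) :
    Submodule ℤ (c.supp → ℝ) :=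
  AddSubgroup.toIntSubmodule (translationHom cs hv).range

end Translations

section Lattice

variable {B : Type*} [Fintype B] {M : CoxeterMatrix B} {W : Type*} [Group W]
  {cs : CoxeterSystem M W} {c : (coxeterGraph M).ConnectedComponent} {v : B → ℝ}
  (hv : IsRadicalVector M c v)

theorem translationCoord_mem (w : translations cs hv) :
    translationCoord hv w ∈ translationLattice cs hv := ⟨Additive.ofMul w, rfl⟩

theorem exists_translationCoord_eq {x : c.supp → ℝ} (hx : x ∈ translationLattice cs hv) :
    ∃ w : translations cs hv, translationCoord hv w = x := by
  obtain ⟨w, hw⟩ := hx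
  exact ⟨w.toMul, hw⟩

theorem discreteTopology_translationLattice [Fintype c.supp] :
    DiscreteTopology (translationLattice cs hv) := by
  rw [discreteTopology_iff_isOpen_singleton_zero]
  have hfin : (Metric.ball (0 : translationLattice cs hv) 1).Finite := by
    refine ((finite_translations_bounded hv 1).image
      fun w => (⟨_, translationCoord_mem hv w⟩ : translationLattice cs hv)).subset ?_
    intro x hx
    obtain ⟨w, hw⟩ := exists_translationCoord_eq hv x.2
    refine ⟨w, fun s => ?_, Subtype.ext hw⟩
    rw [hw, ← Real.norm_eq_abs]
    rw [mem_ball_zero_iff] at hx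
    exact (norm_le_pi_norm (x : c.supp → ℝ) s).trans hx.le
  have h0 : ({0} : Set (translationLattice cs hv)) =
      Metric.ball 0 1 \ (Metric.ball 0 1 \ {0}) := by
    ext x
    by_cases hx : x = 0 <;> simp [hx]
  rw [h0]
  exact Metric.isOpen_ball.sdiff (hfin.subset Set.sdiff_subset).isClosed

theorem exists_conj_simple (w : translations cs hv) (s : c.supp) :
    ∃ w' : translations cs hv, ∀ k, translationCoord hv w' k =
      translationCoord hv w k - 2 * translationCoord hv w s * formEntry M s k := by
  have hs := simple_mem_standardParabolic (cs := cs) s.2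
  have key : ∀ k : c.supp, rep cs (cs.simple s * w.1 * cs.simple s) (simpleRoot k.1) =
      simpleRoot k.1 + (translationCoord hv w k -
        2 * translationCoord hv w s * formEntry M s k) • v := by
    intro k
    rw [rep_mul, rep_mul, rep_simple cs s (simpleRoot k.1), cform_simpleRoot, map_sub, map_smul,
      rep_translation, rep_translation, map_sub, map_add, map_smul, map_smul, map_add, map_smul,
      hv.rep_eq hs, rep_simple_self, rep_simple, cform_simpleRoot]
    module
  let u : standardParabolic cs c.supp := ⟨cs.simple s, hs⟩ * w.1 * ⟨cs.simple s, hs⟩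
  have hu : (u : W) = cs.simple s * (w.1 : W) * cs.simple s := rfl
  have hmem : u ∈ translations cs hv := fun k => ⟨_, by rw [hu]; exact key k⟩
  refine ⟨⟨u, hmem⟩, fun k => translationCoord_eq hv _ ?_⟩
  rw [← key k, ← hu]

theorem row_mem_span {w : translations cs hv} {s : c.supp} (h : translationCoord hv w s ≠ 0) :
    (fun k : c.supp => formEntry M s k) ∈
      Submodule.span ℝ (translationLattice cs hv : Set (c.supp → ℝ)) := by
  obtain ⟨w', hw'⟩ := exists_conj_simple hv w s
  have h1 : (fun k : c.supp => formEntry M s k) = (2 * translationCoord hv w s)⁻¹ •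
      (translationCoord hv w - translationCoord hv w') := by
    funext k
    rw [Pi.smul_apply, Pi.sub_apply, hw', smul_eq_mul, sub_sub_cancel,
      inv_mul_cancel_left₀ (mul_ne_zero two_ne_zero h)]
  rw [h1]
  exact Submodule.smul_mem _ _ (Submodule.sub_mem _
    (Submodule.subset_span (translationCoord_mem hv w))
    (Submodule.subset_span (translationCoord_mem hv w')))

theorem exists_translationCoord_ne_zero (hc : IsAffineComponent M c) (s : c.supp) :
    ∃ w : translations cs hv, translationCoord hv w s ≠ 0 := by
  have h0 : ∃ s : c.supp, ∃ w : translations cs hv, translationCoord hv w s ≠ 0 := by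
    by_contra! hall
    refine hc.2 (posDefOn_of_finite (cs := cs) ?_)
    have hsub : Subsingleton (translations cs hv) := ⟨fun x y =>
      Additive.ofMul.injective (translationHom_injective hv (funext fun s =>
        (hall s x).trans (hall s y).symm))⟩
    exact (Subgroup.finite_iff_finite_and_finiteIndex (translations cs hv)).2
      ⟨inferInstance, finiteIndex_translations hv hc.1⟩
  obtain ⟨s₀, w₀, h0⟩ := h0
  refine (component_induction M s₀.2 (fun s => ∀ hs : s ∈ c.supp, ∃ w : translations cs hv,
    translationCoord hv w ⟨s, hs⟩ ≠ 0) (fun _ => ⟨w₀, h0⟩) ?_ s s.2) s.2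
  intro s t hs ht _ hst ih _
  obtain ⟨w, hw⟩ := ih hs
  by_contra! hall
  have h1 := row_mem_span hv hw
  have h2 : Submodule.span ℝ (translationLattice cs hv : Set (c.supp → ℝ)) ≤
      LinearMap.ker (LinearMap.proj (R := ℝ) (φ := fun _ : c.supp => ℝ) ⟨t, ht⟩) := by
    rw [Submodule.span_le]
    intro x hx
    obtain ⟨u, rfl⟩ := exists_translationCoord_eq hv hx
    exact hall u
  exact hst (h2 h1)

theorem card_le_finrank_span (hc : IsAffineComponent M c) :
    Nat.card c.supp ≤
      Module.finrank ℝ (Submodule.span ℝ (translationLattice cs hv : Set (c.supp → ℝ))) + 1 := by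
  classical
  have := Fintype.ofFinite c.supp
  let R : (c.supp → ℝ) →ₗ[ℝ] (c.supp → ℝ) :=
    Fintype.linearCombination ℝ fun s k : c.supp => formEntry M s k
  have hR : ∀ x k, R x k = ∑ s, x s * formEntry M s k := fun x k => by
    simp [R, Fintype.linearCombination_apply, Finset.sum_apply]
  have hrange : LinearMap.range R ≤
      Submodule.span ℝ (translationLattice cs hv : Set (c.supp → ℝ)) := by
    rintro _ ⟨x, rfl⟩
    rw [Fintype.linearCombination_apply]
    refine Submodule.sum_mem _ fun s _ => Submodule.smul_mem _ _ ?_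
    obtain ⟨w, hw⟩ := exists_translationCoord_ne_zero (cs := cs) hv hc s
    exact row_mem_span hv hw
  have hker : Module.finrank ℝ (LinearMap.ker R) ≤ 1 := by
    have hle : LinearMap.ker R ≤ Submodule.span ℝ {fun s : c.supp => v s} := by
      intro x hx
      set y : B → ℝ := ∑ s : c.supp, x s • simpleRoot s.1 with hy
      have hsupp : Function.support y ⊆ c.supp := by
        intro i hi
        by_contra hic
        apply hi
        rw [hy, Finset.sum_apply]
        refine Finset.sum_eq_zero fun s _ => ?_
        rw [Pi.smul_apply, simpleRoot_of_ne (fun h : i = s => hic (h ▸ s.2)), smul_zero]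
      have hys : ∀ s : c.supp, y s = x s := by
        intro s
        rw [hy, Finset.sum_apply, Finset.sum_eq_single s]
        · rw [Pi.smul_apply, simpleRoot_self, smul_eq_mul, mul_one]
        · intro t _ hts
          rw [Pi.smul_apply, simpleRoot_of_ne (fun h => hts (Subtype.ext h.symm)), smul_zero]
        · exact fun h => absurd (Finset.mem_univ s) h
      have hyk : ∀ k : c.supp, cform M y (simpleRoot k.1) = 0 := by
        intro k
        rw [hy, map_sum, LinearMap.sum_apply]
        simp only [map_smul, LinearMap.smul_apply, cform_simpleRoot, smul_eq_mul]
        rw [← hR, LinearMap.mem_ker.1 hx, Pi.zero_apply]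
      have hyy : cform M y y = 0 := by
        nth_rewrite 2 [hy]
        rw [map_sum]
        exact Finset.sum_eq_zero fun s _ => by rw [map_smul, hyk, smul_zero]
      obtain ⟨r, hr⟩ := hv.eq_smul_of_isotropic hc.1 hsupp hyy
      refine Submodule.mem_span_singleton.2 ⟨r, funext fun s => ?_⟩
      rw [← hys, hr]
      rfl
    exact (Submodule.finrank_mono hle).trans ((finrank_span_le_card _).trans_eq (by simp))
  have h1 := LinearMap.finrank_range_add_finrank_ker R
  have h2 := Submodule.finrank_mono hrange
  rw [Module.finrank_fintype_fun_eq_card, ← Nat.card_eq_fintype_card] at h1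
  omega

theorem finrank_span_lt_card :
    Module.finrank ℝ (Submodule.span ℝ (translationLattice cs hv : Set (c.supp → ℝ))) <
      Nat.card c.supp := by
  classical
  have := Fintype.ofFinite c.supp
  let g : Module.Dual ℝ (c.supp → ℝ) := ∑ s : c.supp, v s • LinearMap.proj s
  have hg : ∀ f, g f = ∑ s : c.supp, v s * f s := fun f => by simp [g]
  have hg0 : g ≠ 0 := by
    obtain ⟨s₀, hs₀⟩ := c.nonempty_supp
    intro h
    have h1 : g (Pi.single ⟨s₀, hs₀⟩ 1) = 0 := by rw [h]; rfl
    rw [hg, Finset.sum_eq_single ⟨s₀, hs₀⟩ (fun t _ ht => by simp [ht]) (by simp)] at h1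
    simp [(hv.pos s₀ hs₀).ne'] at h1
  have hle : Submodule.span ℝ (translationLattice cs hv : Set (c.supp → ℝ)) ≤
      LinearMap.ker g := by
    rw [Submodule.span_le]
    intro x hx
    obtain ⟨u, rfl⟩ := exists_translationCoord_eq hv hx
    rw [SetLike.mem_coe, LinearMap.mem_ker, hg]
    exact sum_mul_translationCoord hv u
  have h1 := Module.Dual.finrank_ker_add_one_of_ne_zero hg0
  have h2 := Submodule.finrank_mono hle
  rw [Module.finrank_fintype_fun_eq_card, ← Nat.card_eq_fintype_card] at h1
  omega

theorem nonempty_translations_equiv (hc : IsAffineComponent M c) :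
    Nonempty (translations cs hv ≃* Multiplicative (Fin (Nat.card c.supp - 1) → ℤ)) := by
  have := Fintype.ofFinite c.supp
  have hd := discreteTopology_translationLattice (cs := cs) hv
  have hrank : Module.finrank ℤ (translationLattice cs hv) = Nat.card c.supp - 1 := by
    have h1 := Real.finrank_eq_int_finrank_of_discrete
      (s := (translationLattice cs hv : Set (c.supp → ℝ)))
      (by rwa [Submodule.span_eq])
    rw [Set.finrank, Set.finrank, Submodule.span_eq] at h1
    have h2 := card_le_finrank_span (cs := cs) hv hc
    have h3 := finrank_span_lt_card (cs := cs) hv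
    omega
  let b := Module.finBasisOfFinrankEq ℤ (translationLattice cs hv) hrank
  let e : Additive (translations cs hv) ≃+ (Fin (Nat.card c.supp - 1) → ℤ) :=
    (AddMonoidHom.ofInjective (translationHom_injective (cs := cs) hv)).trans
      b.equivFun.toAddEquiv
  exact ⟨AddEquiv.toMultiplicativeRight e⟩

end Lattice

section PositiveSemidefinite

variable {B : Type*} [Fintype B] {M : CoxeterMatrix B} {W : Type*} [Group W]

theorem areCommensurable_of_isAffineComponent (cs : CoxeterSystem M W)
    {c : (coxeterGraph M).ConnectedComponent} (hc : IsAffineComponent M c) :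
    AreCommensurable (standardParabolic cs c.supp)
      (Multiplicative (Fin (Nat.card c.supp - 1) → ℤ)) := by
  obtain ⟨v, hv⟩ := exists_isRadicalVector hc
  obtain ⟨e⟩ := nonempty_translations_equiv (cs := cs) hv hc
  have := finiteIndex_translations (cs := cs) hv hc.1
  exact (areCommensurable_subgroup (translations cs hv)).symm.trans (areCommensurable_of_mulEquiv e)

end PositiveSemidefinite

section Decomposition

variable {B : Type*} [Fintype B] {M : CoxeterMatrix B} {W : Type*} [Group W]

omit [Fintype B] in
theorem eq_two_of_not_mem {c : (coxeterGraph M).ConnectedComponent} {s t : B}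
    (hs : s ∈ c.supp) (ht : t ∉ c.supp) : M s t = 2 := by
  have hst : s ≠ t := fun h => ht (h ▸ hs)
  exact (formEntry_eq_zero_iff M hst).1 (formEntry_eq_zero_of_not_mem M hs ht)

open Classical in
/-- The projection of the set of simple reflections to an irreducible component. -/
def simpleProj (cs : CoxeterSystem M W) (c : (coxeterGraph M).ConnectedComponent) (s : B) :
    standardParabolic cs c.supp :=
  if h : s ∈ c.supp then ⟨cs.simple s, simple_mem_standardParabolic h⟩ else 1

theorem simpleProj_isLiftable (cs : CoxeterSystem M W)
    (c : (coxeterGraph M).ConnectedComponent) : M.IsLiftable (simpleProj cs c) := by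
  intro s t
  apply Subtype.ext
  unfold simpleProj
  by_cases hs : s ∈ c.supp <;> by_cases ht : t ∈ c.supp
  · simp [hs, ht]
  · simp [hs, ht, eq_two_of_not_mem hs ht]
  · simp [hs, ht, M.symmetric s t, eq_two_of_not_mem ht hs]
  · simp [hs, ht]

/-- The projection to an irreducible component. -/
def proj (cs : CoxeterSystem M W) (c : (coxeterGraph M).ConnectedComponent) :
    W →* standardParabolic cs c.supp :=
  cs.lift ⟨simpleProj cs c, simpleProj_isLiftable cs c⟩

variable {cs : CoxeterSystem M W}

theorem proj_simple_of_mem {c : (coxeterGraph M).ConnectedComponent} {s : B} (h : s ∈ c.supp) :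
    proj cs c (cs.simple s) = ⟨cs.simple s, simple_mem_standardParabolic h⟩ := by
  rw [proj, cs.lift_apply_simple, simpleProj, dif_pos h]

theorem proj_simple_of_notMem {c : (coxeterGraph M).ConnectedComponent} {s : B}
    (h : s ∉ c.supp) : proj cs c (cs.simple s) = 1 := by
  rw [proj, cs.lift_apply_simple, simpleProj, dif_neg h]

theorem rep_proj {c : (coxeterGraph M).ConnectedComponent} (w : W) {s : B} (hs : s ∈ c.supp) :
    rep cs (proj cs c w) (simpleRoot s) = rep cs w (simpleRoot s) := by
  induction w using cs.simple_induction_left with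
  | one => simp
  | mul_simple_left w t ih =>
    rw [map_mul, Subgroup.coe_mul, rep_mul, rep_mul, ih]
    by_cases ht : t ∈ c.supp
    · rw [proj_simple_of_mem ht]
    · rw [proj_simple_of_notMem ht, Subgroup.coe_one, rep_one, ← ih, rep_simple,
        cform_simpleRoot_left, Finset.sum_eq_zero, mul_zero, zero_smul, sub_zero]
      intro u _
      by_cases hu : u ∈ c.supp
      · rw [formEntry_symm, formEntry_eq_zero_of_not_mem M hu ht, mul_zero]
      · rw [show rep cs (proj cs c w) (simpleRoot s) u = 0 from
          by_contra fun h => hu (support_rep_subset (proj cs c w).2 hs h), zero_mul]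

theorem eq_one_of_proj_eq_one {w : W} (h : ∀ c, proj cs c w = 1) : w = 1 := by
  refine eq_one_of_rep_eq (cs := cs) fun s => ?_
  rw [← rep_proj (c := (coxeterGraph M).connectedComponentMk s) w rfl, h, Subgroup.coe_one, rep_one]

open Classical in
theorem exists_proj_eq_mulSingle {c : (coxeterGraph M).ConnectedComponent} {w : W}
    (hw : w ∈ standardParabolic cs c.supp) :
    ∃ u : W, ∀ d : (coxeterGraph M).ConnectedComponent, proj cs d u =
      Pi.mulSingle (M := fun c : (coxeterGraph M).ConnectedComponent => standardParabolic cs c.supp) c ⟨w, hw⟩ d := by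
  refine standardParabolic_induction (p := fun w => ∀ hw : w ∈ standardParabolic cs c.supp,
    ∃ u : W, ∀ d : (coxeterGraph M).ConnectedComponent, proj cs d u =
      Pi.mulSingle (M := fun c : (coxeterGraph M).ConnectedComponent => standardParabolic cs c.supp) c ⟨w, hw⟩ d) ?_ ?_ hw hw
  · intro h
    refine ⟨1, fun d => ?_⟩
    have h1 : (⟨1, h⟩ : standardParabolic cs c.supp) = 1 := rfl
    rw [h1, Pi.mulSingle_one, map_one, Pi.one_apply]
  · intro s hs w hw' ih h
    obtain ⟨u, hu⟩ := ih hw'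
    refine ⟨cs.simple s * u, fun d => ?_⟩
    rw [map_mul, hu]
    by_cases hd : d = c
    · subst hd
      rw [proj_simple_of_mem hs, Pi.mulSingle_eq_same, Pi.mulSingle_eq_same]
      rfl
    · rw [Pi.mulSingle_eq_of_ne hd, Pi.mulSingle_eq_of_ne hd, proj_simple_of_notMem, one_mul]
      intro hsd
      rw [SimpleGraph.ConnectedComponent.mem_supp_iff] at hs hsd
      exact hd (hsd.symm.trans hs)

theorem exists_proj_eq
    (f : ∀ c : (coxeterGraph M).ConnectedComponent, standardParabolic cs c.supp) :
    ∃ w : W, ∀ c, proj cs c w = f c := by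
  classical
  let π : W →* ∀ c : (coxeterGraph M).ConnectedComponent, standardParabolic cs c.supp := MonoidHom.pi (proj cs)
  have hs : ∀ c, Pi.mulSingle c (f c) ∈ π.range := by
    intro c
    obtain ⟨u, hu⟩ := exists_proj_eq_mulSingle (f c).2
    exact ⟨u, funext hu⟩
  obtain ⟨w, hw⟩ : f ∈ π.range := Subgroup.pi_mem_of_mulSingle_mem f hs
  exact ⟨w, congrFun hw⟩

theorem nonempty_mulEquiv_components {ι : Type*}
    {X : ι → (coxeterGraph M).ConnectedComponent} (hX : Function.Injective X)
    (hXall : ∀ c : (coxeterGraph M).ConnectedComponent, ¬ PosSemidefOn M c.supp ↔ ∃ i, X i = c) :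
    Nonempty (W ≃* (∀ i, standardParabolic cs (X i).supp) ×
      ∀ c : {c : (coxeterGraph M).ConnectedComponent // PosSemidefOn M c.supp},
        standardParabolic cs c.1.supp) := by
  let π : W →* (∀ i, standardParabolic cs (X i).supp) ×
      ∀ c : {c : (coxeterGraph M).ConnectedComponent // PosSemidefOn M c.supp},
        standardParabolic cs c.1.supp :=
    (MonoidHom.pi fun i => proj cs (X i)).prod (MonoidHom.pi fun c => proj cs c.1)
  refine ⟨MulEquiv.ofBijective π ⟨?_, ?_⟩⟩
  · rw [injective_iff_map_eq_one]
    intro w hw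
    refine eq_one_of_proj_eq_one (cs := cs) fun c => ?_
    by_cases hc : PosSemidefOn M c.supp
    · exact congrFun (congrArg Prod.snd hw) ⟨c, hc⟩
    · obtain ⟨i, rfl⟩ := (hXall c).1 hc
      exact congrFun (congrArg Prod.fst hw) i
  · rintro ⟨f, g⟩
    have h : ∀ c : (coxeterGraph M).ConnectedComponent, ∃ u : standardParabolic cs c.supp,
        (∀ i, X i = c → (u : W) = f i) ∧ ∀ hc, (u : W) = g ⟨c, hc⟩ := by
      intro c
      by_cases hc : PosSemidefOn M c.supp
      · exact ⟨g ⟨c, hc⟩, fun i hi => absurd hc ((hXall c).2 ⟨i, hi⟩), fun _ => rfl⟩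
      · obtain ⟨i, rfl⟩ := (hXall c).1 hc
        exact ⟨f i, fun j hj => by rw [hX hj], fun h => absurd h hc⟩
    choose u hu hu' using h
    obtain ⟨w, hw⟩ := exists_proj_eq u
    refine ⟨w, Prod.ext (funext fun i => ?_) (funext fun c => ?_)⟩
    · exact (hw (X i)).trans (Subtype.ext (hu _ i rfl))
    · exact (hw c.1).trans (Subtype.ext (hu' _ c.2))

end Decomposition

section AffineDimension

variable {B : Type*} [Fintype B] {M : CoxeterMatrix B} {W : Type*} [Group W]

open Classical in
/-- The rank of the translation lattice of a component of finite or affine type. -/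
def componentRank (c : (coxeterGraph M).ConnectedComponent) : ℕ :=
  if IsAffineComponent M c then Nat.card c.supp - 1 else 0

theorem areCommensurable_of_posSemidefOn (cs : CoxeterSystem M W)
    {c : (coxeterGraph M).ConnectedComponent} (hc : PosSemidefOn M c.supp) :
    AreCommensurable (standardParabolic cs c.supp)
      (Multiplicative (Fin (componentRank c) → ℤ)) := by
  by_cases h : IsAffineComponent M c
  · rw [show componentRank c = Nat.card c.supp - 1 from if_pos h]
    exact areCommensurable_of_isAffineComponent cs h
  · have hd : PosDefOn M c.supp := by
      by_contra hd
      exact h ⟨hc, hd⟩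
    have := finite_of_posDefOn (cs := cs) hd
    rw [show componentRank c = 0 from if_neg h]
    have : Finite (Multiplicative (Fin 0 → ℤ)) :=
      Finite.of_equiv (Fin 0 → ℤ) Multiplicative.ofAdd
    exact areCommensurable_of_finite

theorem sum_componentRank [Fintype (coxeterGraph M).ConnectedComponent] :
    ∑ c : (coxeterGraph M).ConnectedComponent, componentRank c = affineDim B M := by
  classical
  have h1 : {s : B | IsAffineComponent M ((coxeterGraph M).connectedComponentMk s)}.ncard =
      ∑ c : (coxeterGraph M).ConnectedComponent,
        if IsAffineComponent M c then Nat.card c.supp else 0 := by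
    rw [Set.ncard_eq_toFinset_card', Set.toFinset_ofPred, Finset.card_filter,
      ← Finset.sum_fiberwise Finset.univ (coxeterGraph M).connectedComponentMk]
    refine Finset.sum_congr rfl fun c _ => ?_
    rw [Finset.sum_congr rfl (g := fun _ => if IsAffineComponent M c then 1 else 0)
      fun s hs => by rw [(Finset.mem_filter.1 hs).2], Finset.sum_const, smul_eq_mul, mul_ite,
      mul_one, mul_zero]
    congr 1
    rw [Nat.card_eq_fintype_card, Fintype.card_subtype]
    exact congrArg Finset.card (Finset.filter_congr fun s _ => by
      rw [SimpleGraph.ConnectedComponent.mem_supp_iff])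
  have h2 : Nat.card {c : (coxeterGraph M).ConnectedComponent // IsAffineComponent M c} =
      ∑ c : (coxeterGraph M).ConnectedComponent, if IsAffineComponent M c then 1 else 0 := by
    rw [Nat.card_eq_fintype_card, Fintype.card_subtype, Finset.card_filter]
  unfold affineDim
  rw [h1, h2, eq_tsub_iff_add_eq_of_le]
  · rw [← Finset.sum_add_distrib]
    refine Finset.sum_congr rfl fun c _ => ?_
    unfold componentRank
    split_ifs
    · obtain ⟨s, hs⟩ := c.nonempty_supp
      have : Nonempty c.supp := ⟨⟨s, hs⟩⟩
      exact Nat.sub_add_cancel Nat.card_pos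
    · rfl
  · refine Finset.sum_le_sum fun c _ => ?_
    split_ifs
    · obtain ⟨s, hs⟩ := c.nonempty_supp
      have : Nonempty c.supp := ⟨⟨s, hs⟩⟩
      exact Nat.card_pos
    · exact le_rfl

theorem nonempty_pi_mulEquiv {ι : Type*} [Fintype ι] (r : ι → ℕ) {n : ℕ} (hn : ∑ i, r i = n) :
    Nonempty ((∀ i, Multiplicative (Fin (r i) → ℤ)) ≃* Multiplicative (Fin n → ℤ)) := by
  have e : (Σ i, Fin (r i)) ≃ Fin n := Fintype.equivFinOfCardEq (by simp [hn])
  exact ⟨{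
    toFun := fun f => Multiplicative.ofAdd fun k => (f (e.symm k).1).toAdd (e.symm k).2
    invFun := fun g i => Multiplicative.ofAdd fun k => g.toAdd (e ⟨i, k⟩)
    left_inv := fun f => by
      funext i
      apply Multiplicative.toAdd.injective
      funext k
      change (f (e.symm (e ⟨i, k⟩)).1).toAdd (e.symm (e ⟨i, k⟩)).2 = _
      rw [e.symm_apply_apply]
    right_inv := fun g => by
      apply Multiplicative.toAdd.injective
      funext k
      simp
    map_mul' := fun _ _ => rfl }⟩

theorem areCommensurable_posSemidef_part (cs : CoxeterSystem M W) :
    AreCommensurable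
      (∀ c : {c : (coxeterGraph M).ConnectedComponent // PosSemidefOn M c.supp},
        standardParabolic cs c.1.supp)
      (Multiplicative (Fin (affineDim B M) → ℤ)) := by
  classical
  have := Fintype.ofFinite (coxeterGraph M).ConnectedComponent
  have hsum : ∑ c : {c : (coxeterGraph M).ConnectedComponent // PosSemidefOn M c.supp},
      componentRank c.1 = affineDim B M := by
    rw [← sum_componentRank, ← Finset.sum_subtype (Finset.univ.filter fun c => PosSemidefOn M c.supp)
      (by simp) (componentRank (M := M)), Finset.sum_filter_of_ne]
    intro c _ h
    by_contra hc
    exact h (if_neg fun h' => hc h'.1)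
  obtain ⟨e⟩ := nonempty_pi_mulEquiv _ hsum
  exact (areCommensurable_pi fun c => areCommensurable_of_posSemidefOn cs c.2).trans
    (areCommensurable_of_mulEquiv e)

theorem areCommensurable_product (cs : CoxeterSystem M W) {a : ℕ}
    {X : Fin a → (coxeterGraph M).ConnectedComponent} (hX : Function.Injective X)
    (hXall : ∀ c : (coxeterGraph M).ConnectedComponent, ¬ PosSemidefOn M c.supp ↔ ∃ i, X i = c)
    {N : Fin a → Type*} [∀ i, Group (N i)]
    (hN : ∀ i, AreCommensurable (standardParabolic cs (X i).supp) (N i)) :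
    AreCommensurable W ((∀ i, N i) × Multiplicative (Fin (affineDim B M) → ℤ)) := by
  obtain ⟨e⟩ := nonempty_mulEquiv_components (cs := cs) hX hXall
  exact (areCommensurable_of_mulEquiv e).trans
    (areCommensurable_prod (areCommensurable_pi hN) (areCommensurable_posSemidef_part cs))

end AffineDimension

end CoxeterPaper

namespace CoxeterPaper

variable {B : Type*} {W : Type*} [Group W]

/-- **Corollary 6.3.** Commensurability criterion for Coxeter groups: with
`X 1, …, X a` (resp. `X' 1, …, X' c`) the non-spherical non-affine components (those on whose
simple roots the canonical form is not positive semidefinite), `W` and `W'` are commensurable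
iff `a = c`, the affine dimensions agree, and the components are pairwise commensurable up to
a permutation. -/
theorem commensurability_criterion
    [Fintype B] {M : CoxeterMatrix B} (cs : CoxeterSystem M W)
    {B' : Type*} [Fintype B'] {W' : Type*} [Group W'] {M' : CoxeterMatrix B'}
    (cs' : CoxeterSystem M' W')
    (a c : ℕ)
    (X : Fin a → (coxeterGraph M).ConnectedComponent)
    (hXinj : Function.Injective X)
    (hXall : ∀ co : (coxeterGraph M).ConnectedComponent,
      ¬ PosSemidefOn M co.supp ↔ ∃ i, X i = co)
    (X' : Fin c → (coxeterGraph M').ConnectedComponent)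
    (hX'inj : Function.Injective X')
    (hX'all : ∀ co : (coxeterGraph M').ConnectedComponent,
      ¬ PosSemidefOn M' co.supp ↔ ∃ i, X' i = co) :
    AreCommensurable W W' ↔
      (a = c ∧ affineDim B M = affineDim B' M' ∧
       ∃ σ : Fin a ≃ Fin c, ∀ i : Fin a,
         AreCommensurable (standardParabolic cs (X i).supp)
           (standardParabolic cs' (X' (σ i)).supp)) := by
  constructor
  · intro h
    obtain ⟨K, hKn, hKf, hK⟩ := exists_torsionFree_normal cs
    obtain ⟨K', hKn', hKf', hK'⟩ := exists_torsionFree_normal cs'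
    have hcomm : ∀ i, AreCommensurable (standardParabolic cs (X i).supp)
        (K.subgroupOf (standardParabolic cs (X i).supp)) := fun i =>
      (areCommensurable_subgroup _).symm
    have hcomm' : ∀ i, AreCommensurable (standardParabolic cs' (X' i).supp)
        (K'.subgroupOf (standardParabolic cs' (X' i).supp)) := fun i =>
      (areCommensurable_subgroup _).symm
    obtain ⟨h1, h2, σ, hσ⟩ := areCommensurable_prime_products
      (fun i => isPrimeGroup_subgroupOf hKn hKf hK ((hXall (X i)).2 ⟨i, rfl⟩))
      (fun i => isPrimeGroup_subgroupOf hKn' hKf' hK' ((hX'all (X' i)).2 ⟨i, rfl⟩))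
      ((areCommensurable_product cs hXinj hXall hcomm).symm.trans
        (h.trans (areCommensurable_product cs' hX'inj hX'all hcomm')))
    exact ⟨h1, h2, σ, fun i => (hcomm i).trans ((hσ i).trans (hcomm' (σ i)).symm)⟩
  · rintro ⟨rfl, h2, σ, hσ⟩
    have h3 : ∀ co : (coxeterGraph M').ConnectedComponent,
        ¬ PosSemidefOn M' co.supp ↔ ∃ i, X' (σ i) = co := fun co =>
      (hX'all co).trans σ.surjective.exists
    have h4 := areCommensurable_product cs' (hX'inj.comp σ.injective) h3 fun i => (hσ i).symm
    have h5 := areCommensurable_product cs hXinj hXall fun i => areCommensurable_of_mulEquiv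
      (MulEquiv.refl (standardParabolic cs (X i).supp))
    rw [← h2] at h4
    exact h5.trans h4.symm

end CoxeterPaper
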